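/- Let n ≥ 2, p ∈ (1, ∞), α, β > 0, and let f : ℝ^{n×n}_dev → ℝ be a continuous function on the trace-free matrices satisfying α |X_ils|^p − β ≤ f(X) ≤ β(|X|^p + 1) and |f(X) − f(Y)| ≤ β (1 + |X|^{p−1} + |Y|^{p−1}) |X − Y| for all trace-free X, Y. Let (b_j) be a positive sequence with b_j ↗ ∞, define f_j : ℝ^{n×n} → ℝ by f_j(X) := f(X_dev) + b_j |tr X|^p, and let B ⊂ ℝ^n be the open unit ball. Then: (a) for every X₀ ∈ ℝ^{n×n} with tr X₀ = 0, sup_{j ∈ ℕ} inf { (1/|B|) ∫_B f_j(X₀ + ∇φ(y)) dy : φ ∈ C_c^∞(B; ℝ^n) } = inf { (1/|B|) ∫_B f(X₀ + ∇φ(y)) dy : φ ∈ C_c^∞(B; ℝ^n), div φ = 0 }; and (b) for every X₀ with tr X₀ ≠ 0, the supremum on the left-hand side equals +∞. -/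

import Mathlib

open MeasureTheory Filter Matrix

noncomputable def frobSq {n : ℕ} (X : Matrix (Fin n) (Fin n) ℝ) : ℝ := ∑ i, ∑ j, (X i j)^2
noncomputable def frob {n : ℕ} (X : Matrix (Fin n) (Fin n) ℝ) : ℝ := Real.sqrt (frobSq X)
noncomputable def msym {n : ℕ} (X : Matrix (Fin n) (Fin n) ℝ) : Matrix (Fin n) (Fin n) ℝ :=
  (1/2 : ℝ) • (X + Xᵀ)
noncomputable def mdev {n : ℕ} (X : Matrix (Fin n) (Fin n) ℝ) : Matrix (Fin n) (Fin n) ℝ :=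
  X - (X.trace / n) • (1 : Matrix (Fin n) (Fin n) ℝ)
noncomputable def mils {n : ℕ} (X : Matrix (Fin n) (Fin n) ℝ) : Matrix (Fin n) (Fin n) ℝ :=
  msym X - (X.trace / n) • (1 : Matrix (Fin n) (Fin n) ℝ)

/-- Matrix exponential, defined by its power series. -/
noncomputable def mexp {n : ℕ} (A : Matrix (Fin n) (Fin n) ℝ) : Matrix (Fin n) (Fin n) ℝ :=
  ∑' k : ℕ, ((k.factorial : ℝ)⁻¹) • A ^ k

/-- The eigenvalues of a symmetric real matrix, listed in ascending order
(and junk value `0` if the matrix is not symmetric). -/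
noncomputable def sortedEig {n : ℕ} (A : Matrix (Fin n) (Fin n) ℝ) : Fin n → ℝ :=
  if hA : A.IsHermitian then fun i => hA.eigenvalues (Tuple.sort hA.eigenvalues i) else 0

/-- The singular values of a real square matrix in ascending order. -/
noncomputable def singVals {n : ℕ} (X : Matrix (Fin n) (Fin n) ℝ) : Fin n → ℝ :=
  fun i => Real.sqrt (sortedEig (Xᵀ * X) i)

/-- The Jacobian matrix of a map `ℝ^n → ℝ^n`. -/
noncomputable def jac {n : ℕ} (u : EuclideanSpace ℝ (Fin n) → EuclideanSpace ℝ (Fin n))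
    (x : EuclideanSpace ℝ (Fin n)) : Matrix (Fin n) (Fin n) ℝ :=
  fun i j => fderiv ℝ u x (EuclideanSpace.single j 1) i

set_option linter.unusedSectionVars false

/-- The coefficient of the pure power in the Bellman function `bellman`. -/
noncomputable def bellmanCoeff (q : ℝ) : ℝ := 7 / (q * (q - 1))

/-- A Bellman function for the bilinear embedding with conjugate exponents `p ≥ 2 ≥ q`. -/
noncomputable def bellman (p q z w : ℝ) : ℝ :=
  z ^ 2 * (w + z ^ (p - 1)) ^ (2 - q) + bellmanCoeff q * w ^ q

lemma bellman_second_derivative_nonneg {p q a b m T th v σ : ℝ} (hp : 2 ≤ p) (hq1 : 1 < q)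
    (hq2 : q ≤ 2) (hT : 0 < T) (hm0 : 0 ≤ m) (hm1 : m ≤ 1) (ht0 : 0 ≤ th) (ht1 : th ≤ 1)
    (hv : 1 / T ≤ v) (hσ : |σ| ≤ 1) :
    0 ≤ T * (2 + (p - 2) * ((p + 2) * th - th ^ 2)) * a ^ 2
      + 2 * (2 - q) * m * (2 - th) * (a * b) - (2 - q) * (q - 1) * (m ^ 2 / T) * b ^ 2
      + bellmanCoeff q * (q * (q - 1)) * v * b ^ 2 + 2 * σ * (a * b) := by
  have hB : bellmanCoeff q * (q * (q - 1)) = 7 := by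
    unfold bellmanCoeff
    have : q * (q - 1) ≠ 0 := by nlinarith
    exact div_mul_cancel₀ _ this
  rw [hB]
  have h1 : T * 2 * a ^ 2 ≤ T * (2 + (p - 2) * ((p + 2) * th - th ^ 2)) * a ^ 2 := by
    have : 0 ≤ (p - 2) * ((p + 2) * th - th ^ 2) :=
      mul_nonneg (by linarith) (by nlinarith)
    gcongr
    linarith
  have h2 : (2 - q) * (q - 1) * (m ^ 2 / T) * b ^ 2 ≤ 1 / T * b ^ 2 := by
    have e1 : (2 - q) * (q - 1) ≤ 1 := by nlinarith
    have e0 : 0 ≤ (2 - q) * (q - 1) := mul_nonneg (by linarith) (by linarith)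
    have e2 : m ^ 2 / T ≤ 1 / T := by
      gcongr
      nlinarith
    calc (2 - q) * (q - 1) * (m ^ 2 / T) * b ^ 2 ≤ 1 * (1 / T) * b ^ 2 := by gcongr
      _ = _ := by ring
  have h3 : 7 * (1 / T) * b ^ 2 ≤ 7 * v * b ^ 2 := by gcongr
  have h4 : -(4 * |a * b|) ≤ 2 * (2 - q) * m * (2 - th) * (a * b) := by
    have e : |2 * (2 - q) * m * (2 - th) * (a * b)| ≤ 4 * |a * b| := by
      rw [abs_mul]
      gcongr
      have f1 : (2 - q) * m ≤ 1 * 1 := by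
        apply mul_le_mul <;> linarith
      have f0 : 0 ≤ (2 - q) * m := mul_nonneg (by linarith) hm0
      rw [abs_of_nonneg (by
        have := mul_nonneg f0 (by linarith : 0 ≤ 2 - th)
        nlinarith)]
      have := mul_le_mul f1 (by linarith : 2 - th ≤ 2) (by linarith) (by norm_num)
      linarith
    exact neg_le_of_abs_le e
  have h5 : -(2 * |a * b|) ≤ 2 * σ * (a * b) := by
    have e : |2 * σ * (a * b)| ≤ 2 * |a * b| := by
      rw [abs_mul, abs_mul, abs_two]
      nlinarith [abs_nonneg (a * b)]
    exact neg_le_of_abs_le e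
  have h6 : 6 * |a * b| ≤ T * 2 * a ^ 2 + 6 * (1 / T) * b ^ 2 := by
    have : T * 2 * a ^ 2 + 6 * (1 / T) * b ^ 2 - 6 * |a * b|
        = (2 * (T * |a| - 3 / 2 * |b|) ^ 2 + 3 / 2 * |b| ^ 2) / T := by
      rw [abs_mul]
      field_simp
      rw [← sq_abs a, ← sq_abs b]
      ring
    have h0 : 0 ≤ (2 * (T * |a| - 3 / 2 * |b|) ^ 2 + 3 / 2 * |b| ^ 2) / T := by positivity
    linarith
  linarith

lemma hasDerivAt_line (a a' t : ℝ) : HasDerivAt (fun t => a + t * a') a' t := by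
  simpa using ((hasDerivAt_id t).mul_const a').const_add a

lemma bellman_line_convex {p q : ℝ} (hpq : p.HolderConjugate q) (hp : 2 ≤ p) {σ : ℝ}
    (hσ : |σ| ≤ 1) (a b a' b' : ℝ) :
    ConvexOn ℝ {t : ℝ | 0 < a + t * a' ∧ 0 < b + t * b'}
      (fun t => bellman p q (a + t * a') (b + t * b') + σ * ((a + t * a') * (b + t * b'))) := by
  have hq1 : 1 < q := hpq.symm.lt
  have hpq1 : (p - 1) * (q - 1) = 1 := by
    have := hpq.mul_eq_add
    nlinarith
  have hq2 : q ≤ 2 := by nlinarith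
  have hopen : IsOpen {t : ℝ | 0 < a + t * a' ∧ 0 < b + t * b'} := by
    apply IsOpen.inter
    · exact isOpen_lt (f := fun _ => (0 : ℝ)) (g := fun t => a + t * a') (by fun_prop) (by fun_prop)
    · exact isOpen_lt (f := fun _ => (0 : ℝ)) (g := fun t => b + t * b') (by fun_prop) (by fun_prop)
  have hconv : Convex ℝ {t : ℝ | 0 < a + t * a' ∧ 0 < b + t * b'} := by
    intro x hx y hy s r hs hr hsr
    simp only [Set.mem_ofPred_eq, smul_eq_mul] at *
    have e1 : ∀ c c' : ℝ, c + (s * x + r * y) * c' = s * (c + x * c') + r * (c + y * c') := by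
      intro c c'
      have : c = (s + r) * c := by rw [hsr, one_mul]
      linear_combination this
    rw [e1, e1]
    have key : ∀ u v : ℝ, 0 < u → 0 < v → 0 < s * u + r * v := by
      intro u v hu hv
      rcases hs.eq_or_lt with h | h
      · have : r = 1 := by linarith
        rw [← h, this]; linarith
      · have := mul_pos h hu
        have := mul_nonneg hr hv.le
        linarith
    exact ⟨key _ _ hx.1 hy.1, key _ _ hx.2 hy.2⟩
  set Z : ℝ → ℝ := fun t => a + t * a' with hZ
  set H : ℝ → ℝ := fun t => b + t * b' with hH
  set Y : ℝ → ℝ := fun t => Z t ^ (p - 1) with hY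
  set S : ℝ → ℝ := fun t => H t + Y t with hS
  have hZd : ∀ t, HasDerivAt Z a' t := fun t => hasDerivAt_line a a' t
  have hHd : ∀ t, HasDerivAt H b' t := fun t => hasDerivAt_line b b' t
  have hYd : ∀ t, 0 < Z t → HasDerivAt Y ((p - 1) * (Y t / Z t) * a') t := by
    intro t ht
    have := (hZd t).rpow_const (p := p - 1) (Or.inl ht.ne')
    convert this using 1
    simp only [hY]
    rw [Real.rpow_sub_one ht.ne' (p - 1)]
    ring
  have hSd : ∀ t, 0 < Z t → HasDerivAt S (b' + (p - 1) * (Y t / Z t) * a') t := fun t ht =>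
    (hHd t).add (hYd t ht)
  have hYpos : ∀ t, 0 < Z t → 0 < Y t := fun t ht => Real.rpow_pos_of_pos ht _
  apply convexOn_of_hasDerivWithinAt2_nonneg hconv
    (f' := fun t => (2 * Z t * S t ^ (2 - q) + (p - 2) * (Z t * Y t * S t ^ (1 - q))) * a'
      + (2 - q) * (Z t ^ 2 * S t ^ (1 - q)) * b' + bellmanCoeff q * q * H t ^ (q - 1) * b'
      + σ * (a' * H t + Z t * b'))
    (f'' := fun t => (2 * a' * S t ^ (2 - q)
        + 2 * Z t * ((2 - q) * S t ^ (1 - q) * (b' + (p - 1) * (Y t / Z t) * a'))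
        + (p - 2) * ((a' * Y t + Z t * ((p - 1) * (Y t / Z t) * a')) * S t ^ (1 - q)
          + Z t * Y t * ((1 - q) * S t ^ (-q) * (b' + (p - 1) * (Y t / Z t) * a')))) * a'
      + (2 - q) * (2 * Z t * a' * S t ^ (1 - q)
          + Z t ^ 2 * ((1 - q) * S t ^ (-q) * (b' + (p - 1) * (Y t / Z t) * a'))) * b'
      + bellmanCoeff q * q * ((q - 1) * H t ^ (q - 2) * b') * b'
      + σ * (a' * b' + a' * b'))
  · -- continuity
    have hc1 : ContinuousOn S {t | 0 < Z t ∧ 0 < H t} := fun t ht =>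
      (hSd t ht.1).continuousAt.continuousWithinAt
    have hc2 : Continuous Z := by fun_prop
    have hc3 : Continuous H := by fun_prop
    unfold bellman
    apply ContinuousOn.add
    · apply ContinuousOn.add
      · apply ContinuousOn.mul (by fun_prop)
        apply hc1.rpow_const
        intro t ht
        left
        have := hYpos t ht.1
        have := ht.2
        simp only [hS]; positivity
      · apply ContinuousOn.mul (by fun_prop)
        exact hc3.continuousOn.rpow_const fun t ht => Or.inl ht.2.ne'
    · fun_prop
  · rw [hopen.interior_eq]
    intro t ht
    have hz : 0 < Z t := ht.1
    have hh : 0 < H t := ht.2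
    have hy := hYpos t hz
    have hs : 0 < S t := add_pos hh hy
    apply HasDerivAt.hasDerivWithinAt
    have d1 := ((hZd t).pow 2).mul ((hSd t hz).rpow_const (p := 2 - q) (Or.inl hs.ne'))
    have d2 := ((hHd t).rpow_const (p := q) (Or.inl hh.ne')).const_mul (bellmanCoeff q)
    have d3 := ((hZd t).mul (hHd t)).const_mul σ
    convert! (d1.add d2).add d3 using 1
    have e : (2 : ℝ) - q - 1 = 1 - q := by ring
    simp only [e]
    have hp2 : (2 - q) * (p - 1) = p - 2 := by linear_combination -hpq1
    rw [← hp2]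
    field_simp
    simp
    ring
  · rw [hopen.interior_eq]
    intro t ht
    have hz : 0 < Z t := ht.1
    have hh : 0 < H t := ht.2
    have hy := hYpos t hz
    have hs : 0 < S t := add_pos hh hy
    apply HasDerivAt.hasDerivWithinAt
    have s1 := (hSd t hz).rpow_const (p := 2 - q) (Or.inl hs.ne')
    have s2 := (hSd t hz).rpow_const (p := 1 - q) (Or.inl hs.ne')
    have d1 := (((hZd t).const_mul 2).mul s1).add
      ((((hZd t).mul (hYd t hz)).mul s2).const_mul (p - 2))
    have d2 := (((hZd t).pow 2).mul s2).const_mul (2 - q)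
    have d3 := ((hHd t).rpow_const (p := q - 1) (Or.inl hh.ne')).const_mul (bellmanCoeff q * q)
    have d4 := (((hHd t).const_mul a').add ((hZd t).mul_const b')).const_mul σ
    convert! (((d1.mul_const a').add (d2.mul_const b')).add (d3.mul_const b')).add d4 using 1
    have e : (2 : ℝ) - q - 1 = 1 - q := by ring
    have e' : (1 : ℝ) - q - 1 = -q := by ring
    have e'' : q - 1 - 1 = q - 2 := by ring
    simp only [e, e', e'']
    simp
    ring
  · rw [hopen.interior_eq]
    intro t ht
    have hz : 0 < Z t := ht.1
    have hh : 0 < H t := ht.2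
    have hy := hYpos t hz
    have hs : 0 < S t := add_pos hh hy
    have hT : 0 < S t ^ (2 - q) := Real.rpow_pos_of_pos hs _
    have e1 : S t ^ (1 - q) = S t ^ (2 - q) / S t := by
      rw [← Real.rpow_sub_one hs.ne']; congr 1; ring
    have e2 : S t ^ (-q) = S t ^ (2 - q) / S t ^ 2 := by
      rw [← Real.rpow_natCast, ← Real.rpow_sub hs]; congr 1; push_cast; ring
    have hZle : Z t ≤ S t ^ (q - 1) := by
      have : Z t = Y t ^ (q - 1) := by
        simp only [hY]
        rw [← Real.rpow_mul hz.le, hpq1, Real.rpow_one]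
      rw [this]
      exact Real.rpow_le_rpow hy.le (by simp only [hS]; linarith) (by linarith)
    have hm : Z t * S t ^ (2 - q) / S t ≤ 1 := by
      rw [div_le_one hs]
      calc Z t * S t ^ (2 - q) ≤ S t ^ (q - 1) * S t ^ (2 - q) := by gcongr
        _ = S t := by
          rw [← Real.rpow_add hs]
          convert! Real.rpow_one _ using 2
          ring
    have hv : 1 / S t ^ (2 - q) ≤ H t ^ (q - 2) := by
      rw [one_div, ← Real.rpow_neg hs.le]
      rw [show -(2 - q) = q - 2 by ring]
      exact Real.rpow_le_rpow_of_nonpos hh (by simp only [hS]; linarith) (by linarith)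
    have key := bellman_second_derivative_nonneg (a := a') (b := b') (p := p) hp hq1 hq2 hT
      (m := Z t * S t ^ (2 - q) / S t) (th := Y t / S t) (by positivity) hm
      (by positivity) ((div_le_one hs).2 (by simp only [hS]; linarith)) hv hσ
    refine key.trans (le_of_eq ?_)
    rw [e1, e2]
    have hp2 : p = 1 + 1 / (q - 1) := by
      have : q - 1 ≠ 0 := by linarith
      field_simp
      linarith
    have hq0 : q - 1 ≠ 0 := by linarith
    rw [hp2]
    field_simp
    ring

lemma bellman_add_convexOn_open {p q : ℝ} (hpq : p.HolderConjugate q) (hp : 2 ≤ p) {σ : ℝ}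
    (hσ : |σ| ≤ 1) :
    ConvexOn ℝ {x : ℝ × ℝ | 0 < x.1 ∧ 0 < x.2}
      (fun x => bellman p q x.1 x.2 + σ * (x.1 * x.2)) := by
  refine ⟨?_, ?_⟩
  · exact (((convex_Ioi (0 : ℝ)).prod (convex_Ioi (0 : ℝ))))
  · rintro x hx y hy s r hs hr hsr
    have h := (bellman_line_convex hpq hp hσ x.1 x.2 (y.1 - x.1) (y.2 - x.2)).2
      (x := 0) (y := 1) (by simpa using hx) (by simpa using hy) hs hr hsr
    simp only [smul_eq_mul, mul_zero, mul_one, zero_add, zero_mul, add_zero, one_mul,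
      add_sub_cancel] at h
    have hs' : s = 1 - r := by linarith
    have e1 : (s • x + r • y).1 = x.1 + r * (y.1 - x.1) := by
      simp [hs']; ring
    have e2 : (s • x + r • y).2 = x.2 + r * (y.2 - x.2) := by
      simp [hs']; ring
    simp only [e1, e2, smul_eq_mul]
    exact h

lemma bellman_continuous {p q : ℝ} (hpq : p.HolderConjugate q) (hp : 2 ≤ p) :
    Continuous (fun x : ℝ × ℝ => bellman p q x.1 x.2) := by
  have hq1 : 1 < q := hpq.symm.lt
  have hpq1 : (p - 1) * (q - 1) = 1 := by
    have := hpq.mul_eq_add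
    nlinarith
  have hq2 : q ≤ 2 := by nlinarith
  unfold bellman
  have h1 : Continuous fun x : ℝ × ℝ => x.1 ^ (p - 1) :=
    continuous_fst.rpow_const fun _ => Or.inr (by linarith)
  have h2 : Continuous fun x : ℝ × ℝ => (x.2 + x.1 ^ (p - 1)) ^ (2 - q) :=
    (continuous_snd.add h1).rpow_const fun _ => Or.inr (by linarith)
  have h3 : Continuous fun x : ℝ × ℝ => x.2 ^ q :=
    continuous_snd.rpow_const fun _ => Or.inr (by linarith)
  fun_prop

lemma bellman_add_convexOn {p q : ℝ} (hpq : p.HolderConjugate q) (hp : 2 ≤ p) {σ : ℝ}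
    (hσ : |σ| ≤ 1) :
    ConvexOn ℝ {x : ℝ × ℝ | 0 ≤ x.1 ∧ 0 ≤ x.2}
      (fun x => bellman p q x.1 x.2 + σ * (x.1 * x.2)) := by
  refine ⟨((convex_Ici (0 : ℝ)).prod (convex_Ici (0 : ℝ))), ?_⟩
  rintro x hx y hy s r hs hr hsr
  have hcont : Continuous (fun x : ℝ × ℝ => bellman p q x.1 x.2 + σ * (x.1 * x.2)) := by
    have := bellman_continuous hpq hp
    fun_prop
  set F := fun x : ℝ × ℝ => bellman p q x.1 x.2 + σ * (x.1 * x.2) with hF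
  have hl : Tendsto (fun ε : ℝ => F (s • (x + (ε, ε)) + r • (y + (ε, ε)))) (nhdsWithin 0 (Set.Ioi 0))
      (nhds (F (s • x + r • y))) := by
    have : Continuous (fun ε : ℝ => F (s • (x + (ε, ε)) + r • (y + (ε, ε)))) := by fun_prop
    have h := this.tendsto 0
    simp only [Prod.mk_zero_zero, add_zero] at h
    exact h.mono_left nhdsWithin_le_nhds
  have hr' : Tendsto (fun ε : ℝ => s • F (x + (ε, ε)) + r • F (y + (ε, ε)))
      (nhdsWithin 0 (Set.Ioi 0)) (nhds (s • F x + r • F y)) := by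
    have : Continuous (fun ε : ℝ => s • F (x + (ε, ε)) + r • F (y + (ε, ε))) := by fun_prop
    have h := this.tendsto 0
    simp only [Prod.mk_zero_zero, add_zero] at h
    exact h.mono_left nhdsWithin_le_nhds
  refine le_of_tendsto_of_tendsto hl hr' ?_
  filter_upwards [self_mem_nhdsWithin] with ε hε
  have hε' : (0 : ℝ) < ε := hε
  apply (bellman_add_convexOn_open hpq hp hσ).2 _ _ hs hr hsr
  · exact ⟨add_pos_of_nonneg_of_pos hx.1 hε', add_pos_of_nonneg_of_pos hx.2 hε'⟩
  · exact ⟨add_pos_of_nonneg_of_pos hy.1 hε', add_pos_of_nonneg_of_pos hy.2 hε'⟩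

lemma bellman_midpoint {p q : ℝ} (hpq : p.HolderConjugate q) (hp : 2 ≤ p) {z z' w w' : ℝ}
    (hz : 0 ≤ z) (hz' : 0 ≤ z') (hw : 0 ≤ w) (hw' : 0 ≤ w') :
    bellman p q ((z + z') / 2) ((w + w') / 2) + |(z - z') / 2| * |(w - w') / 2|
      ≤ (bellman p q z w + bellman p q z' w') / 2 := by
  have key : ∀ σ : ℝ, |σ| ≤ 1 → bellman p q ((z + z') / 2) ((w + w') / 2)
      + (-σ) * ((z - z') / 2 * ((w - w') / 2)) ≤ (bellman p q z w + bellman p q z' w') / 2 := by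
    intro σ hσ
    have hc := (bellman_add_convexOn hpq hp hσ).2
    have h := @hc (z, w) ⟨hz, hw⟩ (z', w') ⟨hz', hw'⟩ (1 / 2) (1 / 2) (by norm_num) (by norm_num)
      (by norm_num)
    simp only [Prod.smul_mk, Prod.mk_add_mk, smul_eq_mul] at h
    have e1 : 1 / 2 * z + 1 / 2 * z' = (z + z') / 2 := by ring
    have e2 : 1 / 2 * w + 1 / 2 * w' = (w + w') / 2 := by ring
    rw [e1, e2] at h
    nlinarith
  rw [← abs_mul]
  rcases abs_cases ((z - z') / 2 * ((w - w') / 2)) with h | h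
  · have := key (-1) (by simp)
    rw [h.1]; linarith
  · have := key 1 (by simp)
    rw [h.1]; linarith

lemma bellman_average {p q : ℝ} (hpq : p.HolderConjugate q) (hp : 2 ≤ p) {ι : Type*} [Fintype ι]
    [Nonempty ι] {z z' w w' : ι → ℝ}
    (hz : ∀ i, 0 ≤ z i) (hz' : ∀ i, 0 ≤ z' i) (hw : ∀ i, 0 ≤ w i) (hw' : ∀ i, 0 ≤ w' i) :
    bellman p q (∑ i, (Fintype.card ι : ℝ)⁻¹ * ((z i + z' i) / 2))
        (∑ i, (Fintype.card ι : ℝ)⁻¹ * ((w i + w' i) / 2))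
      + ∑ i, (Fintype.card ι : ℝ)⁻¹ * (|(z i - z' i) / 2| * |(w i - w' i) / 2|)
      ≤ ∑ i, (Fintype.card ι : ℝ)⁻¹ * ((bellman p q (z i) (w i) + bellman p q (z' i) (w' i)) / 2) := by
  have hN : (0 : ℝ) ≤ (Fintype.card ι : ℝ)⁻¹ := by positivity
  have h := (bellman_add_convexOn hpq hp (σ := 0) (by simp)).map_sum_le
    (t := Finset.univ) (w := fun _ : ι => (Fintype.card ι : ℝ)⁻¹)
    (p := fun i => ((z i + z' i) / 2, (w i + w' i) / 2)) (fun _ _ => hN)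
    (by simp) (fun i _ => ⟨by have := hz i; have := hz' i; positivity,
      by have := hw i; have := hw' i; positivity⟩)
  simp only [zero_mul, add_zero, Prod.fst_sum, Prod.snd_sum, Prod.smul_mk, smul_eq_mul] at h
  have h2 : ∀ i, (Fintype.card ι : ℝ)⁻¹ * bellman p q ((z i + z' i) / 2) ((w i + w' i) / 2)
      + (Fintype.card ι : ℝ)⁻¹ * (|(z i - z' i) / 2| * |(w i - w' i) / 2|)
      ≤ (Fintype.card ι : ℝ)⁻¹ * ((bellman p q (z i) (w i) + bellman p q (z' i) (w' i)) / 2) := by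
    intro i
    rw [← mul_add]
    exact mul_le_mul_of_nonneg_left (bellman_midpoint hpq hp (hz i) (hz' i) (hw i) (hw' i)) hN
  have h3 := Finset.sum_le_sum (s := Finset.univ) fun i _ => h2 i
  rw [Finset.sum_add_distrib] at h3
  linarith

lemma bellmanCoeff_nonneg {q : ℝ} (hq : 1 < q) : 0 ≤ bellmanCoeff q := by
  unfold bellmanCoeff
  have : 0 < q - 1 := by linarith
  positivity

lemma bellman_nonneg {p q z w : ℝ} (hq : 1 < q) (hz : 0 ≤ z) (hw : 0 ≤ w) :
    0 ≤ bellman p q z w := by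
  have := bellmanCoeff_nonneg hq
  unfold bellman
  positivity

lemma bellman_le {p q z w : ℝ} (hpq : p.HolderConjugate q) (hp : 2 ≤ p) (hz : 0 ≤ z)
    (hw : 0 ≤ w) : bellman p q z w ≤ (2 + bellmanCoeff q) * (z ^ p + w ^ q) := by
  have hq1 : 1 < q := hpq.symm.lt
  have hpq1 : (p - 1) * (q - 1) = 1 := by
    have := hpq.mul_eq_add
    nlinarith
  have hq2 : q ≤ 2 := by nlinarith
  have hB := bellmanCoeff_nonneg hq1
  have hzp : 0 ≤ z ^ p := by positivity
  have hwq : 0 ≤ w ^ q := by positivity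
  have htwo : (2 : ℝ) ^ (2 - q) ≤ 2 := by
    calc (2 : ℝ) ^ (2 - q) ≤ 2 ^ (1 : ℝ) :=
          Real.rpow_le_rpow_of_exponent_le (by norm_num) (by linarith)
      _ = 2 := Real.rpow_one _
  have main : z ^ 2 * (w + z ^ (p - 1)) ^ (2 - q) ≤ 2 * (z ^ p + w ^ q) := by
    have hzp1 : 0 ≤ z ^ (p - 1) := by positivity
    rcases le_total w (z ^ (p - 1)) with h | h
    · have : z ^ 2 * (w + z ^ (p - 1)) ^ (2 - q) ≤ 2 * z ^ p := by
        calc z ^ 2 * (w + z ^ (p - 1)) ^ (2 - q) ≤ z ^ 2 * (2 * z ^ (p - 1)) ^ (2 - q) := by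
              gcongr
              linarith
          _ = (2 : ℝ) ^ (2 - q) * (z ^ (2 : ℝ) * z ^ (p - 2)) := by
              rw [Real.mul_rpow (by norm_num) hzp1, ← Real.rpow_mul hz]
              rw [show (p - 1) * (2 - q) = p - 2 by linear_combination -hpq1]
              norm_cast
              ring
          _ = (2 : ℝ) ^ (2 - q) * z ^ p := by
              rw [← Real.rpow_add_of_nonneg hz (by norm_num) (by linarith)]
              ring_nf
          _ ≤ 2 * z ^ p := by gcongr
      linarith
    · have hzw : z ≤ w ^ (q - 1) := by
        have : (z ^ (p - 1)) ^ (q - 1) = z := by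
          rw [← Real.rpow_mul hz, hpq1, Real.rpow_one]
        rw [← this]
        exact Real.rpow_le_rpow hzp1 h (by linarith)
      have : z ^ 2 * (w + z ^ (p - 1)) ^ (2 - q) ≤ 2 * w ^ q := by
        calc z ^ 2 * (w + z ^ (p - 1)) ^ (2 - q) ≤ (w ^ (q - 1)) ^ 2 * (2 * w) ^ (2 - q) := by
              gcongr
              linarith
          _ = (2 : ℝ) ^ (2 - q) * (w ^ ((q - 1) * 2) * w ^ (2 - q)) := by
              rw [Real.mul_rpow (by norm_num) hw, ← Real.rpow_natCast, ← Real.rpow_mul hw]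
              push_cast
              ring
          _ = (2 : ℝ) ^ (2 - q) * w ^ q := by
              rw [← Real.rpow_add_of_nonneg hw (by linarith) (by linarith)]
              ring_nf
          _ ≤ 2 * w ^ q := by gcongr
      linarith
  unfold bellman
  nlinarith [mul_nonneg hB hzp]

section Embedding

variable {E : Type*} [AddCommGroup E] [MeasurableSpace E] [MeasurableAdd E] {μ : Measure E}
  {ι : Type*} [Fintype ι]

noncomputable def symAvg (d : ι → E) (u : E → ℝ) (x : E) : ℝ :=
  ∑ i, (Fintype.card ι : ℝ)⁻¹ * ((u (x + d i) + u (x - d i)) / 2)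

noncomputable def symDiff' (h : E) (u : E → ℝ) (x : E) : ℝ := (u (x + h) - u (x - h)) / 2

lemma measurable_comp_add {u : E → ℝ} (hu : Measurable u) (h : E) :
    Measurable fun x => u (x + h) := hu.comp (measurable_add_const h)

lemma measurable_comp_sub {u : E → ℝ} (hu : Measurable u) (h : E) :
    Measurable fun x => u (x - h) := by
  simpa only [sub_eq_add_neg] using measurable_comp_add hu (-h)

lemma measurable_symAvg (d : ι → E) {u : E → ℝ} (hu : Measurable u) : Measurable (symAvg d u) := by
  unfold symAvg
  refine Finset.measurable_fun_sum _ fun i _ => ?_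
  exact (((measurable_comp_add hu _).add (measurable_comp_sub hu _)).div_const 2).const_mul _

lemma measurable_symDiff' (h : E) {u : E → ℝ} (hu : Measurable u) : Measurable (symDiff' h u) :=
  ((measurable_comp_add hu _).sub (measurable_comp_sub hu _)).div_const 2

lemma symAvg_nonneg (d : ι → E) {u : E → ℝ} (hu : ∀ x, 0 ≤ u x) (x : E) : 0 ≤ symAvg d u x := by
  unfold symAvg
  refine Finset.sum_nonneg fun i _ => ?_
  have := hu (x + d i)
  have := hu (x - d i)
  positivity

lemma symAvg_sub (d : ι → E) (u v : E → ℝ) : symAvg d (u - v) = symAvg d u - symAvg d v := by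
  funext x
  simp only [symAvg, Pi.sub_apply, ← Finset.sum_sub_distrib]
  refine Finset.sum_congr rfl fun i _ => ?_
  ring

lemma iterate_symAvg_sub (d : ι → E) (k : ℕ) (u v : E → ℝ) :
    (symAvg d)^[k] (u - v) = (symAvg d)^[k] u - (symAvg d)^[k] v := by
  induction k generalizing u v with
  | zero => rfl
  | succ k ih => simp only [Function.iterate_succ, Function.comp, symAvg_sub, ih]

lemma measurable_iterate_symAvg (d : ι → E) (k : ℕ) {u : E → ℝ} (hu : Measurable u) :
    Measurable ((symAvg d)^[k] u) := by
  induction k with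
  | zero => exact hu
  | succ k ih => rw [Function.iterate_succ_apply']; exact measurable_symAvg d ih

lemma iterate_symAvg_nonneg (d : ι → E) (k : ℕ) {u : E → ℝ} (hu : ∀ x, 0 ≤ u x) (x : E) :
    0 ≤ (symAvg d)^[k] u x := by
  induction k generalizing x with
  | zero => exact hu x
  | succ k ih => rw [Function.iterate_succ_apply']; exact symAvg_nonneg d ih x

lemma symDiff'_sub (h : E) (u v : E → ℝ) :
    symDiff' h (u - v) = symDiff' h u - symDiff' h v := by
  funext x
  simp only [symDiff', Pi.sub_apply]
  ring

lemma lintegral_comp_sub_eq [μ.IsAddRightInvariant] (g : E → ENNReal) (h : E) :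
    ∫⁻ x, g (x - h) ∂μ = ∫⁻ x, g x ∂μ := by
  simpa only [sub_eq_add_neg] using lintegral_add_right_eq_self g (-h)

lemma embedding_step [μ.IsAddRightInvariant] [Nonempty ι] {p q : ℝ} (hpq : p.HolderConjugate q)
    (hp : 2 ≤ p) (d : ι → E) {u v : E → ℝ} (hu : Measurable u) (hv : Measurable v)
    (hu0 : ∀ x, 0 ≤ u x) (hv0 : ∀ x, 0 ≤ v x) (i : ι) :
    ∫⁻ x, ENNReal.ofReal (bellman p q (symAvg d u x) (symAvg d v x)) ∂μ
      + ENNReal.ofReal (Fintype.card ι : ℝ)⁻¹ *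
        ∫⁻ x, ENNReal.ofReal (|symDiff' (d i) u x| * |symDiff' (d i) v x|) ∂μ
      ≤ ∫⁻ x, ENNReal.ofReal (bellman p q (u x) (v x)) ∂μ := by
  have hq1 : 1 < q := hpq.symm.lt
  have hN : (0 : ℝ) ≤ (Fintype.card ι : ℝ)⁻¹ := by positivity
  have hQm : ∀ {a b : E → ℝ}, Measurable a → Measurable b →
      Measurable fun x => ENNReal.ofReal (bellman p q (a x) (b x)) := fun ha hb =>
    ((bellman_continuous hpq hp).measurable.comp (ha.prodMk hb)).ennreal_ofReal
  have hDm : Measurable fun x => ENNReal.ofReal (|symDiff' (d i) u x| * |symDiff' (d i) v x|) := by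
    have h1 := measurable_symDiff' (d i) hu
    have h2 := measurable_symDiff' (d i) hv
    fun_prop
  rw [← lintegral_const_mul _ hDm, ← lintegral_add_left
    (hQm (measurable_symAvg d hu) (measurable_symAvg d hv))]
  calc _ ≤ ∫⁻ x, ∑ j, ENNReal.ofReal (Fintype.card ι : ℝ)⁻¹ *
        (ENNReal.ofReal (1 / 2) * (ENNReal.ofReal (bellman p q (u (x + d j)) (v (x + d j)))
          + ENNReal.ofReal (bellman p q (u (x - d j)) (v (x - d j))))) ∂μ := by
        refine lintegral_mono fun x => ?_
        have h := bellman_average hpq hp (z := fun j => u (x + d j)) (z' := fun j => u (x - d j))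
          (w := fun j => v (x + d j)) (w' := fun j => v (x - d j)) (fun _ => hu0 _)
          (fun _ => hu0 _) (fun _ => hv0 _) (fun _ => hv0 _)
        have h1 : (Fintype.card ι : ℝ)⁻¹ * (|symDiff' (d i) u x| * |symDiff' (d i) v x|)
            ≤ ∑ j, (Fintype.card ι : ℝ)⁻¹ * (|symDiff' (d j) u x| * |symDiff' (d j) v x|) :=
          Finset.single_le_sum
            (f := fun j => (Fintype.card ι : ℝ)⁻¹ * (|symDiff' (d j) u x| * |symDiff' (d j) v x|))
            (fun j _ => by positivity) (Finset.mem_univ i)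
        have hb0 : ∀ y, 0 ≤ bellman p q (u y) (v y) := fun y =>
          bellman_nonneg hq1 (hu0 y) (hv0 y)
        simp only [← ENNReal.ofReal_add (hb0 _) (hb0 _)]
        simp only [← ENNReal.ofReal_mul (show (0 : ℝ) ≤ 1 / 2 by norm_num),
          ← ENNReal.ofReal_mul hN]
        rw [← ENNReal.ofReal_sum_of_nonneg, ← ENNReal.ofReal_add]
        · refine ENNReal.ofReal_le_ofReal ?_
          simp only [symAvg]
          refine (add_le_add le_rfl h1).trans (h.trans (le_of_eq ?_))
          refine Finset.sum_congr rfl fun j _ => ?_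
          ring
        · exact bellman_nonneg hq1 (symAvg_nonneg d hu0 x) (symAvg_nonneg d hv0 x)
        · positivity
        · intro j _
          have := hb0 (x + d j)
          have := hb0 (x - d j)
          positivity
    _ = ∫⁻ x, ENNReal.ofReal (bellman p q (u x) (v x)) ∂μ := by
        have hm1 : ∀ j, Measurable fun x => ENNReal.ofReal (bellman p q (u (x + d j)) (v (x + d j))) :=
          fun j => hQm (measurable_comp_add hu _) (measurable_comp_add hv _)
        have hm2 : ∀ j, Measurable fun x => ENNReal.ofReal (bellman p q (u (x - d j)) (v (x - d j))) :=
          fun j => hQm (measurable_comp_sub hu _) (measurable_comp_sub hv _)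
        rw [lintegral_finsetSum _ fun j _ => by
          have := hm1 j
          have := hm2 j
          fun_prop]
        have : ∀ j, ∫⁻ x, ENNReal.ofReal (Fintype.card ι : ℝ)⁻¹ *
            (ENNReal.ofReal (1 / 2) * (ENNReal.ofReal (bellman p q (u (x + d j)) (v (x + d j)))
            + ENNReal.ofReal (bellman p q (u (x - d j)) (v (x - d j))))) ∂μ
            = ENNReal.ofReal (Fintype.card ι : ℝ)⁻¹ *
              ∫⁻ x, ENNReal.ofReal (bellman p q (u x) (v x)) ∂μ := by
          intro j
          rw [lintegral_const_mul _ (((hm1 j).fun_add (hm2 j)).const_mul _),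
            lintegral_const_mul _ ((hm1 j).fun_add (hm2 j)), lintegral_add_left (hm1 j),
            lintegral_add_right_eq_self (fun x => ENNReal.ofReal (bellman p q (u x) (v x))) (d j),
            lintegral_comp_sub_eq (fun x => ENNReal.ofReal (bellman p q (u x) (v x))) (d j),
            ← two_mul, ← mul_assoc (ENNReal.ofReal (1 / 2))]
          congr 1
          rw [show (2 : ENNReal) = ENNReal.ofReal 2 by simp, ← ENNReal.ofReal_mul (by norm_num)]
          norm_num
        simp only [this, Finset.sum_const, Finset.card_univ, nsmul_eq_mul]
        rw [← mul_assoc, ← ENNReal.ofReal_natCast, ← ENNReal.ofReal_mul (by positivity),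
          mul_inv_cancel₀ (by simp)]
        simp

lemma embedding_nonneg [μ.IsAddRightInvariant] [Nonempty ι] {p q : ℝ}
    (hpq : p.HolderConjugate q)
    (hp : 2 ≤ p) (d : ι → E) {u v : E → ℝ} (hu : Measurable u) (hv : Measurable v)
    (hu0 : ∀ x, 0 ≤ u x) (hv0 : ∀ x, 0 ≤ v x) (i : ι) (K : ℕ) :
    ∑ k ∈ Finset.range K, ∫⁻ x, ENNReal.ofReal (|symDiff' (d i) ((symAvg d)^[k] u) x|
        * |symDiff' (d i) ((symAvg d)^[k] v) x|) ∂μ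
      ≤ ENNReal.ofReal (Fintype.card ι * (2 + bellmanCoeff q)) *
        (∫⁻ x, ENNReal.ofReal (|u x| ^ p) ∂μ + ∫⁻ x, ENNReal.ofReal (|v x| ^ q) ∂μ) := by
  have hq1 : 1 < q := hpq.symm.lt
  have hB := bellmanCoeff_nonneg hq1
  have key : ∀ K, ∫⁻ x, ENNReal.ofReal (bellman p q ((symAvg d)^[K] u x) ((symAvg d)^[K] v x)) ∂μ
      + ENNReal.ofReal (Fintype.card ι : ℝ)⁻¹ * ∑ k ∈ Finset.range K,
        ∫⁻ x, ENNReal.ofReal (|symDiff' (d i) ((symAvg d)^[k] u) x|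
        * |symDiff' (d i) ((symAvg d)^[k] v) x|) ∂μ
      ≤ ∫⁻ x, ENNReal.ofReal (bellman p q (u x) (v x)) ∂μ := by
    intro K
    induction K with
    | zero => simp
    | succ K ih =>
      rw [Finset.sum_range_succ, mul_add, ← add_assoc, add_right_comm]
      refine le_trans (add_le_add ?_ le_rfl) ih
      simp only [Function.iterate_succ_apply']
      exact embedding_step hpq hp d (measurable_iterate_symAvg d K hu)
        (measurable_iterate_symAvg d K hv) (iterate_symAvg_nonneg d K hu0)
        (iterate_symAvg_nonneg d K hv0) i
  have h1 := le_trans le_add_self (key K)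
  have h2 : ∫⁻ x, ENNReal.ofReal (bellman p q (u x) (v x)) ∂μ ≤ ENNReal.ofReal (2 + bellmanCoeff q)
      * (∫⁻ x, ENNReal.ofReal (|u x| ^ p) ∂μ + ∫⁻ x, ENNReal.ofReal (|v x| ^ q) ∂μ) := by
    rw [← lintegral_add_left (by fun_prop), ← lintegral_const_mul _ (by fun_prop)]
    refine lintegral_mono fun x => ?_
    rw [← ENNReal.ofReal_add (by positivity) (by positivity), ← ENNReal.ofReal_mul (by positivity),
      abs_of_nonneg (hu0 x), abs_of_nonneg (hv0 x)]
    exact ENNReal.ofReal_le_ofReal (bellman_le hpq hp (hu0 x) (hv0 x))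
  have h3 := h1.trans h2
  have h4 := mul_le_mul_right h3 (ENNReal.ofReal (Fintype.card ι : ℝ))
  rw [← mul_assoc, ← mul_assoc, ← ENNReal.ofReal_mul (by positivity),
    ← ENNReal.ofReal_mul (by positivity), mul_inv_cancel₀ (by simp)] at h4
  simpa using h4

lemma embedding_signed [μ.IsAddRightInvariant] [Nonempty ι] {p q : ℝ}
    (hpq : p.HolderConjugate q)
    (hp : 2 ≤ p) (d : ι → E) {u v : E → ℝ} (hu : Measurable u) (hv : Measurable v)
    (i : ι) (K : ℕ) :
    ∑ k ∈ Finset.range K, ∫⁻ x, ENNReal.ofReal (|symDiff' (d i) ((symAvg d)^[k] u) x|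
        * |symDiff' (d i) ((symAvg d)^[k] v) x|) ∂μ
      ≤ ENNReal.ofReal (4 * (Fintype.card ι * (2 + bellmanCoeff q))) *
        (∫⁻ x, ENNReal.ofReal (|u x| ^ p) ∂μ + ∫⁻ x, ENNReal.ofReal (|v x| ^ q) ∂μ) := by
  have hq1 : 1 < q := hpq.symm.lt
  have hp0 : 0 ≤ p := by linarith
  have hB := bellmanCoeff_nonneg hq1
  set C := ENNReal.ofReal (Fintype.card ι * (2 + bellmanCoeff q)) with hC
  set R := ∫⁻ x, ENNReal.ofReal (|u x| ^ p) ∂μ + ∫⁻ x, ENNReal.ofReal (|v x| ^ q) ∂μ with hR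
  have hone : ∀ a b : E → ℝ, Measurable a → Measurable b → (∀ x, 0 ≤ a x) → (∀ x, 0 ≤ b x) →
      (∀ x, |a x| ≤ |u x|) → (∀ x, |b x| ≤ |v x|) →
      ∑ k ∈ Finset.range K, ∫⁻ x, ENNReal.ofReal (|symDiff' (d i) ((symAvg d)^[k] a) x|
        * |symDiff' (d i) ((symAvg d)^[k] b) x|) ∂μ ≤ C * R := by
    intro a b ha hb ha0 hb0 hau hbv
    refine (embedding_nonneg hpq hp d ha hb ha0 hb0 i K).trans ?_
    refine mul_le_mul' le_rfl (add_le_add ?_ ?_)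
    · exact lintegral_mono fun x => ENNReal.ofReal_le_ofReal
        (Real.rpow_le_rpow (abs_nonneg _) (hau x) hp0)
    · exact lintegral_mono fun x => ENNReal.ofReal_le_ofReal
        (Real.rpow_le_rpow (abs_nonneg _) (hbv x) (by linarith))
  let up : E → ℝ := fun x => max (u x) 0
  let um : E → ℝ := fun x => max (-u x) 0
  let vp : E → ℝ := fun x => max (v x) 0
  let vm : E → ℝ := fun x => max (-v x) 0
  have hup : Measurable up := hu.max measurable_const
  have hum : Measurable um := hu.neg.max measurable_const
  have hvp : Measurable vp := hv.max measurable_const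
  have hvm : Measurable vm := hv.neg.max measurable_const
  have hpm : ∀ t : ℝ, t = max t 0 - max (-t) 0 := fun t => by
    rcases le_total 0 t with h | h
    · rw [max_eq_left h, max_eq_right (by linarith)]; ring
    · rw [max_eq_right h, max_eq_left (by linarith)]; ring
  have habs : ∀ t : ℝ, |max t 0| ≤ |t| := fun t => by
    rw [abs_of_nonneg (le_max_right _ _)]
    exact max_le (le_abs_self t) (abs_nonneg t)
  have habs' : ∀ t : ℝ, |max (-t) 0| ≤ |t| := fun t => by
    simpa using habs (-t)
  have hu' : u = up - um := funext fun x => hpm _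
  have hv' : v = vp - vm := funext fun x => hpm _
  have hpt : ∀ k x, ENNReal.ofReal (|symDiff' (d i) ((symAvg d)^[k] u) x|
        * |symDiff' (d i) ((symAvg d)^[k] v) x|) ≤
      (ENNReal.ofReal (|symDiff' (d i) ((symAvg d)^[k] up) x|
        * |symDiff' (d i) ((symAvg d)^[k] vp) x|) + ENNReal.ofReal (|symDiff' (d i) ((symAvg d)^[k] up) x|
        * |symDiff' (d i) ((symAvg d)^[k] vm) x|)) + (ENNReal.ofReal (|symDiff' (d i) ((symAvg d)^[k] um) x|
        * |symDiff' (d i) ((symAvg d)^[k] vp) x|) + ENNReal.ofReal (|symDiff' (d i) ((symAvg d)^[k] um) x|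
        * |symDiff' (d i) ((symAvg d)^[k] vm) x|)) := by
    intro k x
    rw [← ENNReal.ofReal_add (by positivity) (by positivity),
      ← ENNReal.ofReal_add (by positivity) (by positivity),
      ← ENNReal.ofReal_add (by positivity) (by positivity)]
    refine ENNReal.ofReal_le_ofReal ?_
    have e1 : symDiff' (d i) ((symAvg d)^[k] u) x = symDiff' (d i) ((symAvg d)^[k] up) x
        - symDiff' (d i) ((symAvg d)^[k] um) x := by
      conv_lhs => rw [hu', iterate_symAvg_sub, symDiff'_sub]
      rfl
    have e2 : symDiff' (d i) ((symAvg d)^[k] v) x = symDiff' (d i) ((symAvg d)^[k] vp) x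
        - symDiff' (d i) ((symAvg d)^[k] vm) x := by
      conv_lhs => rw [hv', iterate_symAvg_sub, symDiff'_sub]
      rfl
    rw [e1, e2]
    refine (mul_le_mul (abs_sub _ _) (abs_sub _ _) (by positivity) (by positivity)).trans
      (le_of_eq ?_)
    ring
  have hmeas : ∀ (k : ℕ) {a b : E → ℝ}, Measurable a → Measurable b → Measurable fun x =>
      ENNReal.ofReal (|symDiff' (d i) ((symAvg d)^[k] a) x|
        * |symDiff' (d i) ((symAvg d)^[k] b) x|) := by
    intro k a b ha hb
    have h1 := measurable_symDiff' (d i) (measurable_iterate_symAvg d k ha)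
    have h2 := measurable_symDiff' (d i) (measurable_iterate_symAvg d k hb)
    fun_prop
  have hsum : ∑ k ∈ Finset.range K, ∫⁻ x, ENNReal.ofReal (|symDiff' (d i) ((symAvg d)^[k] u) x|
        * |symDiff' (d i) ((symAvg d)^[k] v) x|) ∂μ ≤ (C * R + C * R) + (C * R + C * R) := by
    refine le_trans (Finset.sum_le_sum fun k _ => lintegral_mono (hpt k)) ?_
    have : ∀ k, ∫⁻ x, ((ENNReal.ofReal (|symDiff' (d i) ((symAvg d)^[k] up) x|
        * |symDiff' (d i) ((symAvg d)^[k] vp) x|) + ENNReal.ofReal (|symDiff' (d i) ((symAvg d)^[k] up) x|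
        * |symDiff' (d i) ((symAvg d)^[k] vm) x|)) + (ENNReal.ofReal (|symDiff' (d i) ((symAvg d)^[k] um) x|
        * |symDiff' (d i) ((symAvg d)^[k] vp) x|) + ENNReal.ofReal (|symDiff' (d i) ((symAvg d)^[k] um) x|
        * |symDiff' (d i) ((symAvg d)^[k] vm) x|))) ∂μ = _ := fun k => by
      rw [lintegral_add_left ((hmeas k hup hvp).fun_add (hmeas k hup hvm)),
        lintegral_add_left (hmeas k hup hvp), lintegral_add_left (hmeas k hum hvp)]
    simp only [this, Finset.sum_add_distrib]
    have n0 : ∀ t : ℝ, 0 ≤ max t 0 := fun t => le_max_right _ _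
    exact add_le_add
      (add_le_add
        (hone _ _ hup hvp (fun _ => n0 _) (fun _ => n0 _) (fun _ => habs _) (fun _ => habs _))
        (hone _ _ hup hvm (fun _ => n0 _) (fun _ => n0 _) (fun _ => habs _) (fun _ => habs' _)))
      (add_le_add
        (hone _ _ hum hvp (fun _ => n0 _) (fun _ => n0 _) (fun _ => habs' _) (fun _ => habs _))
        (hone _ _ hum hvm (fun _ => n0 _) (fun _ => n0 _) (fun _ => habs' _) (fun _ => habs' _)))
  refine hsum.trans (le_of_eq ?_)
  rw [ENNReal.ofReal_mul (by norm_num), ← hC]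
  rw [show ENNReal.ofReal 4 = 4 by simp]
  ring

lemma exists_embedding_const [μ.IsAddRightInvariant] [Nonempty ι] {p q : ℝ}
    (hpq : p.HolderConjugate q) : ∃ C : ℝ, 0 ≤ C ∧
    ∀ (d : ι → E) (u v : E → ℝ), Measurable u → Measurable v → ∀ (i : ι) (K : ℕ),
    ∑ k ∈ Finset.range K, ∫⁻ x, ENNReal.ofReal (|symDiff' (d i) ((symAvg d)^[k] u) x|
        * |symDiff' (d i) ((symAvg d)^[k] v) x|) ∂μ
      ≤ ENNReal.ofReal C *
        (∫⁻ x, ENNReal.ofReal (|u x| ^ p) ∂μ + ∫⁻ x, ENNReal.ofReal (|v x| ^ q) ∂μ) := by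
  rcases le_total 2 p with hp | hp
  · have := bellmanCoeff_nonneg hpq.symm.lt
    exact ⟨_, by positivity, fun d u v hu hv i K => embedding_signed hpq hp d hu hv i K⟩
  · have := bellmanCoeff_nonneg hpq.lt
    have hq2 : 2 ≤ q := by
      have h1 := hpq.mul_eq_add
      have h2 := hpq.lt
      nlinarith
    refine ⟨4 * (Fintype.card ι * (2 + bellmanCoeff p)), by positivity,
      fun d u v hu hv i K => ?_⟩
    have h := embedding_signed (μ := μ) hpq.symm hq2 d hv hu i K
    simp only [mul_comm |symDiff' (d i) ((symAvg d)^[_] u) _|]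
    rwa [add_comm (∫⁻ x, ENNReal.ofReal (|u x| ^ p) ∂μ)]

end Embedding

section DifferenceEstimate

lemma memLp_ofReal_iff {E : Type*} [MeasurableSpace E] {μ : Measure E} {p : ℝ} (hp : 0 < p)
    {u : E → ℝ} (hu : AEStronglyMeasurable u μ) :
    MemLp u (ENNReal.ofReal p) μ ↔ Integrable (fun x => |u x| ^ p) μ := by
  rw [← integrable_norm_rpow_iff hu (by simpa using hp) ENNReal.ofReal_ne_top]
  simp [ENNReal.toReal_ofReal hp.le]

lemma MeasureTheory.MemLp.integrable_abs_rpow {E : Type*} [MeasurableSpace E] {μ : Measure E}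
    {p : ℝ} (hp : 0 < p) {u : E → ℝ} (hu : MemLp u (ENNReal.ofReal p) μ) :
    Integrable (fun x => |u x| ^ p) μ := (memLp_ofReal_iff hp hu.1).1 hu

lemma integrable_mul_of_memLp {E : Type*} [MeasurableSpace E] {μ : Measure E}
    {p q : ℝ} (hpq : p.HolderConjugate q) {u v : E → ℝ} (hu : MemLp u (ENNReal.ofReal p) μ)
    (hv : MemLp v (ENNReal.ofReal q) μ) : Integrable (fun x => u x * v x) μ := by
  have := hpq.ennrealOfReal
  exact hu.integrable_mul hv

variable {E : Type*} [AddCommGroup E] [MeasurableSpace E] [MeasurableAdd E] {μ : Measure E}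
  [μ.IsAddRightInvariant] {ι : Type*} [Fintype ι]

lemma memLp_comp_add {p : ENNReal} {u : E → ℝ} (hu : MemLp u p μ) (h : E) :
    MemLp (fun x => u (x + h)) p μ :=
  hu.comp_measurePreserving (measurePreserving_add_right μ h)

lemma memLp_comp_sub {p : ENNReal} {u : E → ℝ} (hu : MemLp u p μ) (h : E) :
    MemLp (fun x => u (x - h)) p μ :=
  hu.comp_measurePreserving (measurePreserving_sub_right μ h)

lemma memLp_symAvg {p : ENNReal} (d : ι → E) {u : E → ℝ} (hu : MemLp u p μ) :
    MemLp (symAvg d u) p μ := by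
  refine memLp_finsetSum _ fun i _ => ?_
  have h := ((memLp_comp_add hu (d i)).add (memLp_comp_sub hu (d i))).const_mul
    ((Fintype.card ι : ℝ)⁻¹ * 2⁻¹)
  refine h.ae_eq (Eventually.of_forall fun x => ?_)
  simp only [Pi.add_apply]
  ring

lemma memLp_iterate_symAvg {p : ENNReal} (d : ι → E) (k : ℕ) {u : E → ℝ} (hu : MemLp u p μ) :
    MemLp ((symAvg d)^[k] u) p μ := by
  induction k with
  | zero => exact hu
  | succ k ih => rw [Function.iterate_succ_apply']; exact memLp_symAvg d ih

lemma memLp_symDiff' {p : ENNReal} (h : E) {u : E → ℝ} (hu : MemLp u p μ) :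
    MemLp (symDiff' h u) p μ := by
  have h := ((memLp_comp_add hu h).sub (memLp_comp_sub hu h)).const_mul (2⁻¹ : ℝ)
  refine h.ae_eq (Eventually.of_forall fun x => ?_)
  simp only [symDiff', Pi.sub_apply]
  ring

lemma integral_comp_add_mul (u v : E → ℝ) (h : E) :
    ∫ x, u (x + h) * v x ∂μ = ∫ x, u x * v (x - h) ∂μ := by
  rw [← integral_add_right_eq_self (fun x => u x * v (x - h)) h]
  simp

lemma integral_comp_sub_mul (u v : E → ℝ) (h : E) :
    ∫ x, u (x - h) * v x ∂μ = ∫ x, u x * v (x + h) ∂μ := by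
  rw [← integral_sub_right_eq_self (fun x => u x * v (x + h)) h]
  simp

lemma integral_symAvg_mul {p q : ℝ} (hpq : p.HolderConjugate q) (d : ι → E) {u v : E → ℝ}
    (hu : MemLp u (ENNReal.ofReal p) μ) (hv : MemLp v (ENNReal.ofReal q) μ) :
    ∫ x, symAvg d u x * v x ∂μ = ∫ x, u x * symAvg d v x ∂μ := by
  have hi1 := fun i => integrable_mul_of_memLp hpq (memLp_comp_add hu (d i)) hv
  have hi2 := fun i => integrable_mul_of_memLp hpq (memLp_comp_sub hu (d i)) hv
  have hj1 := fun i => integrable_mul_of_memLp hpq hu (memLp_comp_add hv (d i))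
  have hj2 := fun i => integrable_mul_of_memLp hpq hu (memLp_comp_sub hv (d i))
  have e1 : ∀ x, symAvg d u x * v x = ∑ i, (Fintype.card ι : ℝ)⁻¹ * 2⁻¹ *
      (u (x + d i) * v x + u (x - d i) * v x) := fun x => by
    rw [symAvg, Finset.sum_mul]
    exact Finset.sum_congr rfl fun i _ => by ring
  have e2 : ∀ x, u x * symAvg d v x = ∑ i, (Fintype.card ι : ℝ)⁻¹ * 2⁻¹ *
      (u x * v (x + d i) + u x * v (x - d i)) := fun x => by
    rw [symAvg, Finset.mul_sum]
    exact Finset.sum_congr rfl fun i _ => by ring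
  simp only [e1, e2]
  rw [integral_finsetSum _ fun i _ => ((hi1 i).fun_add (hi2 i)).const_mul _,
    integral_finsetSum _ fun i _ => ((hj1 i).fun_add (hj2 i)).const_mul _]
  refine Finset.sum_congr rfl fun i _ => ?_
  rw [integral_const_mul, integral_const_mul, integral_add (hi1 i) (hi2 i),
    integral_add (hj1 i) (hj2 i), integral_comp_add_mul, integral_comp_sub_mul, add_comm]

lemma integral_symDiff'_mul {p q : ℝ} (hpq : p.HolderConjugate q) (h : E) {u v : E → ℝ}
    (hu : MemLp u (ENNReal.ofReal p) μ) (hv : MemLp v (ENNReal.ofReal q) μ) :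
    ∫ x, symDiff' h u x * v x ∂μ = - ∫ x, u x * symDiff' h v x ∂μ := by
  have hi1 := integrable_mul_of_memLp hpq (memLp_comp_add hu h) hv
  have hi2 := integrable_mul_of_memLp hpq (memLp_comp_sub hu h) hv
  have hj1 := integrable_mul_of_memLp hpq hu (memLp_comp_add hv h)
  have hj2 := integrable_mul_of_memLp hpq hu (memLp_comp_sub hv h)
  have e1 : ∀ x, symDiff' h u x * v x = 2⁻¹ * (u (x + h) * v x - u (x - h) * v x) := fun x => by
    rw [symDiff']; ring
  have e2 : ∀ x, u x * symDiff' h v x = 2⁻¹ * (u x * v (x + h) - u x * v (x - h)) := fun x => by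
    rw [symDiff']; ring
  simp only [e1, e2]
  rw [integral_const_mul, integral_const_mul, integral_sub hi1 hi2,
    integral_sub hj1 hj2, integral_comp_add_mul, integral_comp_sub_mul]
  ring

lemma symDiff'_symAvg (h : E) (d : ι → E) (u : E → ℝ) :
    symDiff' h (symAvg d u) = symAvg d (symDiff' h u) := by
  funext x
  simp only [symDiff', symAvg, ← Finset.sum_sub_distrib, Finset.sum_div]
  refine Finset.sum_congr rfl fun i _ => ?_
  rw [show x + h + d i = x + d i + h by abel, show x + h - d i = x - d i + h by abel,
    show x - h + d i = x + d i - h by abel, show x - h - d i = x - d i - h by abel]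
  ring

/-- Littlewood–Paley telescoping: `∫ D²G · h` is controlled by `(1 - A²) G`. -/
lemma exists_const_abs_integral_symDiff'_le [Nonempty ι] {p q : ℝ} (hpq : p.HolderConjugate q) :
    ∃ C : ℝ, 0 ≤ C ∧ ∀ (d : ι → E) (G h : E → ℝ), Measurable G → Measurable h →
      MemLp G (ENNReal.ofReal p) μ → MemLp h (ENNReal.ofReal q) μ → ∀ i : ι,
      |∫ x, symDiff' (d i) (symDiff' (d i) G) x * h x ∂μ|
        ≤ C * (∫ x, |G x - symAvg d (symAvg d G) x| ^ p ∂μ + ∫ x, |h x| ^ q ∂μ) := by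
  obtain ⟨C, hC, H⟩ := exists_embedding_const (μ := μ) (ι := ι) hpq
  refine ⟨C, hC, fun d G h hGm hhm hG hh i => ?_⟩
  have hp0 := hpq.pos
  have hq0 := hpq.symm.pos
  have hreal : ∀ u v : E → ℝ, Measurable u → Measurable v → MemLp u (ENNReal.ofReal p) μ →
      MemLp v (ENNReal.ofReal q) μ → ∀ K, ∑ k ∈ Finset.range K,
        ∫ x, |symDiff' (d i) ((symAvg d)^[k] u) x| * |symDiff' (d i) ((symAvg d)^[k] v) x| ∂μ
      ≤ C * (∫ x, |u x| ^ p ∂μ + ∫ x, |v x| ^ q ∂μ) := by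
    intro u v hum hvm hu hv K
    have h1 := H d u v hum hvm i K
    have h_int : ∀ k, Integrable (fun x => |symDiff' (d i) ((symAvg d)^[k] u) x| *
        |symDiff' (d i) ((symAvg d)^[k] v) x|) μ := fun k => by
      simpa only [abs_mul] using (integrable_mul_of_memLp hpq
        (memLp_symDiff' (d i) (memLp_iterate_symAvg d k hu))
        (memLp_symDiff' (d i) (memLp_iterate_symAvg d k hv))).abs
    have e : ∀ k, ∫⁻ x, ENNReal.ofReal (|symDiff' (d i) ((symAvg d)^[k] u) x| *
        |symDiff' (d i) ((symAvg d)^[k] v) x|) ∂μ = ENNReal.ofReal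
        (∫ x, |symDiff' (d i) ((symAvg d)^[k] u) x| *
        |symDiff' (d i) ((symAvg d)^[k] v) x| ∂μ) := fun k =>
      (ofReal_integral_eq_lintegral_ofReal (h_int k)
        (Eventually.of_forall fun x => by simp only [Pi.zero_apply]; positivity)).symm
    simp only [e] at h1
    rw [← ofReal_integral_eq_lintegral_ofReal (hu.integrable_abs_rpow hp0)
      (Eventually.of_forall fun x => by simp only [Pi.zero_apply]; positivity),
      ← ofReal_integral_eq_lintegral_ofReal (hv.integrable_abs_rpow hq0)
      (Eventually.of_forall fun x => by simp only [Pi.zero_apply]; positivity),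
      ← ENNReal.ofReal_add (by positivity) (by positivity),
      ← ENNReal.ofReal_mul hC, ← ENNReal.ofReal_sum_of_nonneg fun k _ => by positivity] at h1
    exact (ENNReal.ofReal_le_ofReal_iff (by positivity)).1 h1
  set a : ℕ → ℝ := fun k =>
    ∫ x, symDiff' (d i) ((symAvg d)^[k] G) x * symDiff' (d i) ((symAvg d)^[k] h) x ∂μ with ha
  have hstep : ∀ k, |a k - a (k + 1)| ≤ ∫ x,
      |symDiff' (d i) ((symAvg d)^[k] (G - symAvg d (symAvg d G))) x|
        * |symDiff' (d i) ((symAvg d)^[k] h) x| ∂μ := by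
    intro k
    have hDG := memLp_symDiff' (d i) (memLp_iterate_symAvg d k hG)
    have hDh := memLp_symDiff' (d i) (memLp_iterate_symAvg d k hh)
    have e1 : a (k + 1) = ∫ x, symDiff' (d i) ((symAvg d)^[k] (symAvg d (symAvg d G))) x
        * symDiff' (d i) ((symAvg d)^[k] h) x ∂μ := by
      simp only [ha, Function.iterate_succ_apply', symDiff'_symAvg]
      rw [← integral_symAvg_mul hpq d (memLp_symAvg d hDG) hDh]
      rw [← Function.iterate_succ_apply, ← Function.iterate_succ_apply,
        Function.iterate_succ_apply', Function.iterate_succ_apply', symDiff'_symAvg,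
        symDiff'_symAvg]
    rw [e1, iterate_symAvg_sub, symDiff'_sub]
    have hDG' := memLp_symDiff' (d i) (memLp_iterate_symAvg d k (memLp_symAvg d (memLp_symAvg d hG)))
    rw [← integral_sub (integrable_mul_of_memLp hpq hDG hDh)
      (integrable_mul_of_memLp hpq hDG' hDh)]
    refine (abs_integral_le_integral_abs).trans (le_of_eq ?_)
    refine integral_congr_ae (Eventually.of_forall fun x => ?_)
    simp only [Pi.sub_apply, ← abs_mul]
    congr 1
    ring
  have hlim : Tendsto a atTop (nhds 0) := by
    rw [tendsto_zero_iff_abs_tendsto_zero]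
    refine (summable_of_sum_range_le (c := C * (∫ x, |G x| ^ p ∂μ + ∫ x, |h x| ^ q ∂μ))
      (fun k => abs_nonneg (a k)) fun K => ?_).tendsto_atTop_zero
    refine (Finset.sum_le_sum fun k _ => ?_).trans (hreal G h hGm hhm hG hh K)
    refine abs_integral_le_integral_abs.trans (le_of_eq ?_)
    simp only [abs_mul]
  have hbound : ∀ K, |a 0 - a K| ≤ C * (∫ x, |G x - symAvg d (symAvg d G) x| ^ p ∂μ
      + ∫ x, |h x| ^ q ∂μ) := by
    intro K
    rw [← Finset.sum_range_sub']
    refine (Finset.abs_sum_le_sum_abs _ _).trans ((Finset.sum_le_sum fun k _ => hstep k).trans ?_)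
    exact hreal _ _ (hGm.sub (measurable_symAvg d (measurable_symAvg d hGm))) hhm
      (hG.sub (memLp_symAvg d (memLp_symAvg d hG))) hh K
  have hfin : |a 0| ≤ C * (∫ x, |G x - symAvg d (symAvg d G) x| ^ p ∂μ + ∫ x, |h x| ^ q ∂μ) := by
    have : Tendsto (fun K => |a 0 - a K|) atTop (nhds |a 0 - 0|) := (tendsto_const_nhds.sub hlim).abs
    rw [sub_zero] at this
    exact le_of_tendsto this (Eventually.of_forall hbound)
  rw [integral_symDiff'_mul hpq (d i) (memLp_symDiff' (d i) hG) hh, abs_neg]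
  exact hfin

lemma exists_const_symDiff'_rpow_le [Nonempty ι] {p : ℝ} (hp : 1 < p) :
    ∃ C : ℝ, 0 ≤ C ∧ ∀ (d : ι → E) (G : E → ℝ), Measurable G →
      MemLp G (ENNReal.ofReal p) μ → ∀ i : ι,
      ∫ x, |symDiff' (d i) (symDiff' (d i) G) x| ^ p ∂μ
        ≤ C * ∫ x, |G x - symAvg d (symAvg d G) x| ^ p ∂μ := by
  obtain ⟨q, hpq⟩ : ∃ q, p.HolderConjugate q := ⟨_, Real.HolderConjugate.conjExponent hp⟩
  have hp0 := hpq.pos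
  have hq0 := hpq.symm.pos
  have hq1 := hpq.symm.lt
  obtain ⟨C, hC, H⟩ := exists_const_abs_integral_symDiff'_le (μ := μ) (ι := ι) hpq
  obtain ⟨l, hl, hCl⟩ : ∃ l : ℝ, 0 < l ∧ C * l ^ q ≤ l / 2 := by
    refine ⟨(2 * (C + 1)) ^ (-(q - 1)⁻¹), by positivity, ?_⟩
    set l := (2 * (C + 1)) ^ (-(q - 1)⁻¹) with hl
    have hl0 : 0 < l := by positivity
    have h1 : l ^ (q - 1) = (2 * (C + 1))⁻¹ := by
      rw [hl, ← Real.rpow_mul (by positivity), neg_mul, inv_mul_cancel₀ (by linarith),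
        Real.rpow_neg_one]
    have h2 : l ^ q = l ^ (q - 1) * l := by
      rw [← Real.rpow_add_one hl0.ne']; congr 1; ring
    rw [h2, h1, ← mul_assoc, mul_comm _ l, div_eq_mul_inv]
    refine mul_le_mul_of_nonneg_left ?_ hl0.le
    rw [← div_eq_mul_inv, div_le_iff₀ (by positivity)]
    linarith
  refine ⟨2 * C / l, by positivity, fun d G hGm hG i => ?_⟩
  set w := symDiff' (d i) (symDiff' (d i) G) with hw
  have hwm : Measurable w := measurable_symDiff' _ (measurable_symDiff' _ hGm)
  have hwp : MemLp w (ENNReal.ofReal p) μ := memLp_symDiff' _ (memLp_symDiff' _ hG)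
  set h : E → ℝ := fun x => l * (SignType.sign (w x) * |w x| ^ (p - 1)) with hh
  have hhm : Measurable h := by
    have h1 : Measurable fun x => ((SignType.sign (w x) : SignType) : ℝ) := by
      have : Measurable fun t : ℝ => ((SignType.sign t : SignType) : ℝ) := by
        have : (fun t : ℝ => ((SignType.sign t : SignType) : ℝ)) =
            fun t => if 0 < t then 1 else if t < 0 then -1 else 0 := by
          funext t
          simp only [sign_apply]
          split_ifs <;> simp
        rw [this]
        exact Measurable.ite measurableSet_Ioi measurable_const
          (Measurable.ite measurableSet_Iio measurable_const measurable_const)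
      exact this.comp hwm
    fun_prop
  have hpq1 : (p - 1) * q = p := by
    have := hpq.mul_eq_add
    linarith
  have habs : ∀ x, |h x| ^ q = l ^ q * |w x| ^ p := by
    intro x
    simp only [hh]
    rw [abs_mul, abs_of_pos hl, Real.mul_rpow hl.le (abs_nonneg _)]
    congr 1
    rcases eq_or_ne (w x) 0 with h0 | h0
    · simp [h0, Real.zero_rpow hp0.ne', Real.zero_rpow hq0.ne']
    · have : |((SignType.sign (w x) : SignType) : ℝ)| = 1 := by
        rcases lt_or_gt_of_ne h0 with h | h
        · simp [sign_neg h]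
        · simp [sign_pos h]
      rw [abs_mul, this, one_mul, abs_of_nonneg (by positivity), ← Real.rpow_mul (abs_nonneg _),
        hpq1]
  have hmul : ∀ x, w x * h x = l * |w x| ^ p := by
    intro x
    simp only [hh]
    rcases eq_or_ne (w x) 0 with h0 | h0
    · simp [h0, Real.zero_rpow hp0.ne']
    · have : w x * (SignType.sign (w x) : ℝ) = |w x| := by
        rw [mul_comm]; exact sign_mul_self (w x)
      rw [mul_left_comm, ← mul_assoc (w x), this]
      congr 1
      rw [mul_comm, ← Real.rpow_add_one (abs_ne_zero.2 h0)]
      congr 1; ring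
  have hhq : MemLp h (ENNReal.ofReal q) μ := by
    rw [memLp_ofReal_iff hq0 hhm.aestronglyMeasurable]
    simp only [habs]
    exact (hwp.integrable_abs_rpow hp0).const_mul _
  have key := H d G h hGm hhm hG hhq i
  simp only [← hw, hmul, habs, integral_const_mul] at key
  have hW : 0 ≤ ∫ x, |w x| ^ p ∂μ := by positivity
  rw [abs_of_nonneg (by positivity)] at key
  rw [div_mul_eq_mul_div, le_div_iff₀ hl]
  nlinarith

end DifferenceEstimate

section DifferenceQuotients

open scoped SchwartzMap LineDeriv

lemma abs_first_difference_sub_le {g g' : ℝ → ℝ} (hg : ∀ t, HasDerivAt g (g' t) t) {c ε s : ℝ}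
    (hs : 0 ≤ s) (h : ∀ t, |t| ≤ s → |g' t - c| ≤ ε) : |g s - g 0 - c * s| ≤ ε * s := by
  have hk : ∀ t ∈ Set.Icc 0 s, HasDerivWithinAt (fun t => g t - c * t) (g' t - c) (Set.Icc 0 s) t := by
    intro t _
    simpa using ((hg t).fun_sub ((hasDerivAt_id t).const_mul c)).hasDerivWithinAt
  have := (convex_Icc 0 s).norm_image_sub_le_of_norm_hasDerivWithin_le hk
    (fun t ht => by
      rw [Real.norm_eq_abs]
      exact h t (by rw [abs_of_nonneg ht.1]; exact ht.2))
    (Set.left_mem_Icc.2 hs) (Set.right_mem_Icc.2 hs)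
  simp only [Real.norm_eq_abs, mul_zero, sub_zero, abs_of_nonneg hs] at this
  rwa [show g s - g 0 - c * s = g s - c * s - g 0 by ring]

lemma abs_second_difference_sub_le {g g' g'' : ℝ → ℝ} (hg : ∀ t, HasDerivAt g (g' t) t)
    (hg' : ∀ t, HasDerivAt g' (g'' t) t) {c ε s : ℝ}
    (hs : 0 ≤ s) (h : ∀ t, |t| ≤ s → |g'' t - c| ≤ ε) :
    |g s + g (-s) - 2 * g 0 - c * s ^ 2| ≤ 2 * ε * s ^ 2 := by
  have hε : 0 ≤ ε := (abs_nonneg _).trans (h 0 (by simpa using hs))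
  have h1 : ∀ t, HasDerivAt (fun t => g t + g (-t) - 2 * g 0 - c * t ^ 2)
      (g' t - g' (-t) - 2 * c * t) t := by
    intro t
    have h2 : HasDerivAt (fun t => g (-t)) (g' (-t) * (-1)) t := (hg (-t)).comp t (hasDerivAt_neg t)
    refine ((((hg t).add h2).sub_const (2 * g 0)).sub
      ((hasDerivAt_pow 2 t).const_mul c)).congr_deriv ?_
    push_cast
    ring
  have h3 : ∀ t, |t| ≤ s → |g' t - g' (-t) - 2 * c * t| ≤ 2 * ε * s := by
    intro t ht
    have hk : ∀ r ∈ Set.Icc (-s) s,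
        HasDerivWithinAt (fun r => g' r - c * r) (g'' r - c) (Set.Icc (-s) s) r := by
      intro r _
      simpa using ((hg' r).fun_sub ((hasDerivAt_id r).const_mul c)).hasDerivWithinAt
    have ht' := abs_le.1 ht
    have := (convex_Icc (-s) s).norm_image_sub_le_of_norm_hasDerivWithin_le hk
      (fun r hr => by
        rw [Real.norm_eq_abs]
        exact h r (abs_le.2 hr)) (x := -t) (y := t)
      ⟨by linarith, by linarith⟩ ht'
    simp only [Real.norm_eq_abs] at this
    rw [show g' t - g' (-t) - 2 * c * t = g' t - c * t - (g' (-t) - c * -t) by ring]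
    refine this.trans ?_
    rw [show t - -t = 2 * t by ring, abs_mul, abs_two]
    nlinarith
  have h4 := abs_first_difference_sub_le h1 (c := 0) hs
    (fun t ht => by rw [sub_zero]; exact h3 t ht)
  simp only [neg_zero] at h4
  calc _ = |g s + g (-s) - 2 * g 0 - c * s ^ 2 - (g 0 + g 0 - 2 * g 0 - c * 0 ^ 2) - 0 * s| := by
        congr 1; ring
    _ ≤ _ := h4
    _ = _ := by ring

variable {E : Type*} [NormedAddCommGroup E] [NormedSpace ℝ E]

lemma SchwartzMap.hasDerivAt_line (F : 𝓢(E, ℝ)) (x m : E) (t : ℝ) :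
    HasDerivAt (fun t : ℝ => F (x + t • m)) (∂_{m} F (x + t • m)) t := by
  have h1 : HasDerivAt (fun t : ℝ => x + t • m) m t := by
    simpa using ((hasDerivAt_id t).smul_const m).const_add x
  rw [SchwartzMap.lineDerivOp_apply_eq_fderiv]
  exact (F.hasFDerivAt (x + t • m)).comp_hasDerivAt t h1

lemma SchwartzMap.exists_decay_segment (F : 𝓢(E, ℝ)) (m : E) (k : ℕ) :
    ∃ C : ℝ, 0 ≤ C ∧ ∀ (x : E) (t : ℝ), |t| ≤ 1 → |F (x + t • m)| ≤ C * (1 + ‖x‖) ^ (-(k : ℝ)) := by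
  obtain ⟨C₀, hC₀⟩ : ∃ C₀ : ℝ, ∀ x, (1 + ‖x‖) ^ k * ‖F x‖ ≤ C₀ := by
    refine ⟨2 ^ k * (Finset.Iic (k, 0)).sup (fun m => SchwartzMap.seminorm ℝ m.1 m.2) F,
      fun x => ?_⟩
    have := SchwartzMap.one_add_le_sup_seminorm_apply (𝕜 := ℝ) (m := (k, 0)) le_rfl le_rfl F x
    simpa using this
  have hC0 : 0 ≤ C₀ := le_trans (by positivity) (hC₀ 0)
  refine ⟨C₀ * (1 + ‖m‖) ^ k, by positivity, fun x t ht => ?_⟩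
  rw [Real.rpow_neg (by positivity), Real.rpow_natCast, ← div_eq_mul_inv,
    le_div_iff₀ (by positivity)]
  have h1 : 1 + ‖x‖ ≤ (1 + ‖m‖) * (1 + ‖x + t • m‖) := by
    have h2 : ‖x‖ ≤ ‖x + t • m‖ + ‖t • m‖ := by
      simpa using norm_sub_le (x + t • m) (t • m)
    have h3 : ‖t • m‖ ≤ ‖m‖ := by
      rw [norm_smul, Real.norm_eq_abs]
      exact mul_le_of_le_one_left (norm_nonneg _) ht
    have := mul_nonneg (norm_nonneg m) (norm_nonneg (x + t • m))
    nlinarith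
  calc |F (x + t • m)| * (1 + ‖x‖) ^ k
      ≤ |F (x + t • m)| * ((1 + ‖m‖) * (1 + ‖x + t • m‖)) ^ k := by gcongr
    _ = (1 + ‖m‖) ^ k * ((1 + ‖x + t • m‖) ^ k * ‖F (x + t • m)‖) := by
        rw [mul_pow, Real.norm_eq_abs]; ring
    _ ≤ (1 + ‖m‖) ^ k * C₀ := by gcongr; exact hC₀ _
    _ = _ := by ring

variable [FiniteDimensional ℝ E] [MeasurableSpace E] [BorelSpace E] {μ : Measure E}
  [μ.IsAddHaarMeasure]

lemma tendsto_integral_abs_rpow_of_decay {p : ℝ} (hp : 1 < p) {w : ℝ → E → ℝ} {w₀ : E → ℝ}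
    {C : ℝ} (hC : 0 ≤ C) (hw : ∀ s, Continuous (w s))
    (hbound : ∀ s, 0 < s → s ≤ 1 → ∀ x,
      |w s x| ≤ C * (1 + ‖x‖) ^ (-((Module.finrank ℝ E + 1 : ℕ) : ℝ)))
    (hlim : ∀ x, Tendsto (fun s => w s x) (nhdsWithin 0 (Set.Ioi 0)) (nhds (w₀ x))) :
    Tendsto (fun s => ∫ x, |w s x| ^ p ∂μ) (nhdsWithin 0 (Set.Ioi 0))
      (nhds (∫ x, |w₀ x| ^ p ∂μ)) := by
  set r : ℝ := ((Module.finrank ℝ E + 1 : ℕ) : ℝ) with hr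
  have hr0 : (Module.finrank ℝ E : ℝ) < r := by rw [hr]; push_cast; linarith
  have hr1 : 0 ≤ r := by rw [hr]; positivity
  refine tendsto_integral_filter_of_dominated_convergence
    (fun x => C ^ p * (1 + ‖x‖) ^ (-(r * p))) ?_ ?_ ?_ ?_
  · refine Eventually.of_forall fun s => Continuous.aestronglyMeasurable ?_
    exact (hw s).abs.rpow_const fun x => Or.inr (by linarith)
  · filter_upwards [Ioc_mem_nhdsGT (show (0 : ℝ) < 1 by norm_num)] with s hs
    refine Eventually.of_forall fun x => ?_
    rw [Real.norm_eq_abs, abs_of_nonneg (by positivity)]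
    calc |w s x| ^ p ≤ (C * (1 + ‖x‖) ^ (-r)) ^ p :=
          Real.rpow_le_rpow (abs_nonneg _) (hbound s hs.1 hs.2 x) (by linarith)
      _ = _ := by
          rw [Real.mul_rpow hC (by positivity), ← Real.rpow_mul (by positivity), neg_mul]
  · refine Integrable.const_mul ?_ _
    exact integrable_one_add_norm (by nlinarith)
  · refine Eventually.of_forall fun x => ?_
    exact ((hlim x).abs).rpow_const (Or.inr (by linarith))

lemma tendsto_integral_second_difference {p : ℝ} (hp : 1 < p) {ι : Type*} [Fintype ι]
    (F G : 𝓢(E, ℝ)) (c : ι → ℝ) (d : ι → E) :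
    Tendsto (fun s : ℝ => ∫ x, |G x + s⁻¹ ^ 2 * ∑ i, c i *
        (F (x + s • d i) + F (x - s • d i) - 2 * F x)| ^ p ∂μ) (nhdsWithin 0 (Set.Ioi 0))
      (nhds (∫ x, |G x + ∑ i, c i * ∂_{d i} (∂_{d i} F) x| ^ p ∂μ)) := by
  set k := Module.finrank ℝ E + 1 with hk
  choose C hC0 hC using fun i => (∂_{d i} (∂_{d i} F)).exists_decay_segment (d i) k
  obtain ⟨CG, hCG0, hCG⟩ := G.exists_decay_segment 0 k
  have hsd : ∀ (i : ι) (x : E) (c ε s : ℝ), 0 ≤ s →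
      (∀ t, |t| ≤ s → |∂_{d i} (∂_{d i} F) (x + t • d i) - c| ≤ ε) →
      |F (x + s • d i) + F (x - s • d i) - 2 * F x - c * s ^ 2| ≤ 2 * ε * s ^ 2 := by
    intro i x c ε s hs h
    have := abs_second_difference_sub_le (fun t => F.hasDerivAt_line x (d i) t)
      (fun t => (∂_{d i} F).hasDerivAt_line x (d i) t) hs h
    simpa only [neg_smul, ← sub_eq_add_neg, zero_smul, add_zero] using this
  refine tendsto_integral_abs_rpow_of_decay hp
    (C := CG + ∑ i, |c i| * (2 * C i)) ?_ ?_ ?_ ?_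
  · have : ∀ i, 0 ≤ |c i| * (2 * C i) := fun i => by have := hC0 i; positivity
    have := Finset.sum_nonneg fun i (_ : i ∈ Finset.univ) => this i
    positivity
  · intro s
    have := F.continuous
    have := G.continuous
    fun_prop
  · intro s hs hs1 x
    have h1 : |G x| ≤ CG * (1 + ‖x‖) ^ (-(k : ℝ)) := by simpa using hCG x 0 (by simp)
    have h2 : ∀ i, |s⁻¹ ^ 2 * (c i * (F (x + s • d i) + F (x - s • d i) - 2 * F x))|
        ≤ |c i| * (2 * C i) * (1 + ‖x‖) ^ (-(k : ℝ)) := by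
      intro i
      have h3 := hsd i x 0 (C i * (1 + ‖x‖) ^ (-(k : ℝ))) s hs.le
        (fun t ht => by rw [sub_zero]; exact hC i x t (ht.trans hs1))
      rw [zero_mul, sub_zero] at h3
      rw [abs_mul, abs_mul, abs_of_nonneg (show 0 ≤ s⁻¹ ^ 2 by positivity)]
      calc s⁻¹ ^ 2 * (|c i| * |F (x + s • d i) + F (x - s • d i) - 2 * F x|)
          ≤ s⁻¹ ^ 2 * (|c i| * (2 * (C i * (1 + ‖x‖) ^ (-(k : ℝ))) * s ^ 2)) := by gcongr
        _ = _ := by field_simp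
    rw [add_mul, Finset.sum_mul, Finset.mul_sum]
    exact (abs_add_le _ _).trans (add_le_add h1 ((Finset.abs_sum_le_sum_abs _ _).trans
      (Finset.sum_le_sum fun i _ => h2 i)))
  · intro x
    refine tendsto_const_nhds.add ?_
    simp only [Finset.mul_sum]
    refine tendsto_finsetSum _ fun i _ => ?_
    rw [Metric.tendsto_nhds]
    intro ε hε
    set H := ∂_{d i} (∂_{d i} F) with hH
    set ε' := ε / (4 * (|c i| + 1)) with hε'
    have hε'0 : 0 < ε' := by positivity
    have hcont : Continuous fun t : ℝ => H (x + t • d i) := by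
      have := H.continuous
      fun_prop
    have h0 := Metric.continuous_iff.1 hcont 0 ε' hε'0
    obtain ⟨δ, hδ, h0⟩ := h0
    filter_upwards [Ioo_mem_nhdsGT hδ] with s hs
    have h3 := hsd i x (H x) ε' s hs.1.le (fun t ht => by
      have := h0 t (by rw [Real.dist_eq, sub_zero]; exact ht.trans_lt hs.2)
      rw [Real.dist_eq] at this
      simpa using this.le)
    have hs0 : 0 < s := hs.1
    rw [Real.dist_eq]
    have e : s⁻¹ ^ 2 * (c i * (F (x + s • d i) + F (x - s • d i) - 2 * F x)) - c i * H x
        = s⁻¹ ^ 2 * (c i * (F (x + s • d i) + F (x - s • d i) - 2 * F x - H x * s ^ 2)) := by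
      field_simp
    rw [e, abs_mul, abs_mul, abs_of_nonneg (show 0 ≤ s⁻¹ ^ 2 by positivity)]
    calc _ ≤ s⁻¹ ^ 2 * (|c i| * (2 * ε' * s ^ 2)) := by gcongr
      _ = |c i| * (2 * ε') := by field_simp
      _ = ε * (|c i| / (2 * (|c i| + 1))) := by rw [hε']; field_simp; norm_num
      _ < ε * 1 := by
          gcongr
          rw [div_lt_one (by positivity)]
          have := abs_nonneg (c i)
          linarith
      _ = ε := mul_one ε

lemma tendsto_integral_first_difference {p : ℝ} (hp : 1 < p) (F G : 𝓢(E, ℝ)) (m : E) :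
    Tendsto (fun s : ℝ => ∫ x, |G x - s⁻¹ * (F (x + s • m) - F x)| ^ p ∂μ)
      (nhdsWithin 0 (Set.Ioi 0)) (nhds (∫ x, |G x - ∂_{m} F x| ^ p ∂μ)) := by
  set k := Module.finrank ℝ E + 1 with hk
  obtain ⟨C, hC0, hC⟩ := (∂_{m} F).exists_decay_segment m k
  obtain ⟨CG, hCG0, hCG⟩ := G.exists_decay_segment 0 k
  refine tendsto_integral_abs_rpow_of_decay hp (C := CG + C) (by positivity) ?_ ?_ ?_
  · intro s
    have := F.continuous
    have := G.continuous
    fun_prop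
  · intro s hs hs1 x
    have h1 : |G x| ≤ CG * (1 + ‖x‖) ^ (-(k : ℝ)) := by simpa using hCG x 0 (by simp)
    have h3 := abs_first_difference_sub_le (fun t => F.hasDerivAt_line x m t) (c := 0)
      (ε := C * (1 + ‖x‖) ^ (-(k : ℝ))) hs.le
      (fun t ht => by rw [sub_zero]; exact hC x t (ht.trans hs1))
    simp only [zero_smul, add_zero, zero_mul, sub_zero] at h3
    have h2 : |s⁻¹ * (F (x + s • m) - F x)| ≤ C * (1 + ‖x‖) ^ (-(k : ℝ)) := by
      rw [abs_mul, abs_of_pos (inv_pos.2 hs), inv_mul_le_iff₀ hs]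
      linarith
    rw [add_mul]
    exact (abs_sub _ _).trans (add_le_add h1 h2)
  · intro x
    refine tendsto_const_nhds.sub ?_
    have h := (F.hasDerivAt_line x m 0).tendsto_slope_zero_right
    simpa using h

end DifferenceQuotients

section SchwartzEstimates

open scoped SchwartzMap LineDeriv

lemma abs_add_rpow_le {p : ℝ} (hp : 1 ≤ p) (a b : ℝ) :
    |a + b| ^ p ≤ 2 ^ p * (|a| ^ p + |b| ^ p) := by
  have h := Real.rpow_arith_mean_le_arith_mean_rpow (s := (Finset.univ : Finset (Fin 2)))
    (w := fun _ => 1 / 2) (z := ![|a|, |b|]) (fun _ _ => by norm_num) (by norm_num)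
    (fun i _ => by fin_cases i <;> simp) hp
  simp only [Fin.sum_univ_two, Matrix.cons_val_zero, Matrix.cons_val_one] at h
  have h1 : |a + b| ^ p ≤ (2 * (1 / 2 * |a| + 1 / 2 * |b|)) ^ p := by
    refine Real.rpow_le_rpow (abs_nonneg _) ?_ (by linarith)
    have := abs_add_le a b
    linarith
  rw [Real.mul_rpow (by norm_num) (by positivity)] at h1
  refine h1.trans ?_
  refine mul_le_mul_of_nonneg_left (h.trans ?_) (by positivity)
  have : 0 ≤ |a| ^ p := by positivity
  have : 0 ≤ |b| ^ p := by positivity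
  linarith

lemma abs_sub_rpow_le {p : ℝ} (hp : 1 ≤ p) (a b : ℝ) :
    |a - b| ^ p ≤ 2 ^ p * (|a| ^ p + |b| ^ p) := by
  simpa [sub_eq_add_neg] using abs_add_rpow_le hp a (-b)

lemma abs_convex_rpow_le {p : ℝ} (hp : 1 ≤ p) {r t : ℝ} (hr : 0 ≤ r) (ht : 0 ≤ t)
    (hrt : r + t = 1) (a b : ℝ) :
    |r * a + t * b| ^ p ≤ r * |a| ^ p + t * |b| ^ p := by
  have h := (convexOn_rpow hp).2 (abs_nonneg a) (abs_nonneg b) hr ht hrt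
  simp only [smul_eq_mul] at h
  refine le_trans (Real.rpow_le_rpow (abs_nonneg _) ?_ (by linarith)) h
  refine (abs_add_le _ _).trans (le_of_eq ?_)
  rw [abs_mul, abs_mul, abs_of_nonneg hr, abs_of_nonneg ht]

lemma abs_sum_rpow_le {p : ℝ} (hp : 1 ≤ p) {ι : Type*} [Fintype ι] (a : ι → ℝ) :
    |∑ i, a i| ^ p ≤ (Fintype.card ι : ℝ) ^ (p - 1) * ∑ i, |a i| ^ p := by
  have h := Real.rpow_sum_le_const_mul_sum_rpow (s := (Finset.univ : Finset ι)) a hp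
  rw [Finset.card_univ] at h
  exact (Real.rpow_le_rpow (abs_nonneg _) (Finset.abs_sum_le_sum_abs _ _) (by linarith)).trans h

lemma integral_abs_rpow_symAvg_le {E : Type*} [AddCommGroup E] [MeasurableSpace E]
    [MeasurableAdd E] {μ : Measure E} [μ.IsAddRightInvariant] {ι : Type*} [Fintype ι] [Nonempty ι]
    {p : ℝ} (hp : 1 < p) (d : ι → E) {u : E → ℝ} (hu : MemLp u (ENNReal.ofReal p) μ) :
    ∫ x, |symAvg d u x| ^ p ∂μ ≤ ∫ x, |u x| ^ p ∂μ := by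
  have hp0 : 0 < p := by linarith
  have h1 := fun i => (memLp_comp_add hu (d i)).integrable_abs_rpow hp0
  have h2 := fun i => (memLp_comp_sub hu (d i)).integrable_abs_rpow hp0
  have hpt : ∀ x, |symAvg d u x| ^ p ≤ ∑ i, (Fintype.card ι : ℝ)⁻¹ *
      (1 / 2 * |u (x + d i)| ^ p + 1 / 2 * |u (x - d i)| ^ p) := by
    intro x
    have h := Real.rpow_arith_mean_le_arith_mean_rpow (s := (Finset.univ : Finset ι))
      (w := fun _ => (Fintype.card ι : ℝ)⁻¹) (z := fun i => |(u (x + d i) + u (x - d i)) / 2|)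
      (fun _ _ => by positivity) (by simp) (fun i _ => abs_nonneg _) hp.le
    refine le_trans (Real.rpow_le_rpow (abs_nonneg _) ?_ hp0.le) (h.trans ?_)
    · refine (Finset.abs_sum_le_sum_abs _ _).trans (Finset.sum_le_sum fun i _ => ?_)
      rw [abs_mul, abs_of_nonneg (by positivity)]
    · refine Finset.sum_le_sum fun i _ => mul_le_mul_of_nonneg_left ?_ (by positivity)
      have := abs_convex_rpow_le hp.le (r := 1 / 2) (t := 1 / 2) (by norm_num) (by norm_num)
        (by norm_num) (u (x + d i)) (u (x - d i))
      rwa [show 1 / 2 * u (x + d i) + 1 / 2 * u (x - d i) = (u (x + d i) + u (x - d i)) / 2 by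
        ring] at this
  have h_int : ∀ i, Integrable (fun x => (Fintype.card ι : ℝ)⁻¹ *
      (1 / 2 * |u (x + d i)| ^ p + 1 / 2 * |u (x - d i)| ^ p)) μ := fun i =>
    (((h1 i).const_mul _).fun_add ((h2 i).const_mul _)).const_mul _
  refine (integral_mono ((memLp_symAvg d hu).integrable_abs_rpow hp0)
    (integrable_finsetSum _ fun i _ => h_int i) hpt).trans (le_of_eq ?_)
  rw [integral_finsetSum _ fun i _ => h_int i]
  have : ∀ i, ∫ x, (Fintype.card ι : ℝ)⁻¹ *
      (1 / 2 * |u (x + d i)| ^ p + 1 / 2 * |u (x - d i)| ^ p) ∂μ =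
      (Fintype.card ι : ℝ)⁻¹ * ∫ x, |u x| ^ p ∂μ := by
    intro i
    rw [integral_const_mul, integral_add ((h1 i).const_mul _) ((h2 i).const_mul _),
      integral_const_mul, integral_const_mul,
      integral_add_right_eq_self (fun x => |u x| ^ p),
      integral_sub_right_eq_self (fun x => |u x| ^ p)]
    ring
  simp only [this, Finset.sum_const, Finset.card_univ, nsmul_eq_mul]
  rw [← mul_assoc, mul_inv_cancel₀ (by simp), one_mul]

lemma integral_abs_rpow_le_of_resolvent {E : Type*} [MeasurableSpace E] {μ : Measure E}
    {p : ℝ} (hp : 1 < p) {F T : E → ℝ} (hF : MemLp F (ENNReal.ofReal p) μ)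
    (hT : MemLp T (ENNReal.ofReal p) μ)
    (hTF : ∫ x, |T x| ^ p ∂μ ≤ ∫ x, |F x| ^ p ∂μ) {θ : ℝ} (hθ : 0 ≤ θ) :
    ∫ x, |F x| ^ p ∂μ ≤ ∫ x, |F x + θ * (F x - T x)| ^ p ∂μ := by
  have hp0 : 0 < p := by linarith
  have hφ : MemLp (fun x => F x + θ * (F x - T x)) (ENNReal.ofReal p) μ :=
    hF.add ((hF.sub hT).const_mul θ)
  have i1 := hF.integrable_abs_rpow hp0
  have i2 := hT.integrable_abs_rpow hp0
  have i3 := hφ.integrable_abs_rpow hp0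
  have hθ1 : 0 < 1 + θ := by linarith
  have h1 : ∫ x, |F x| ^ p ∂μ ≤ ∫ x, ((1 / (1 + θ)) * |F x + θ * (F x - T x)| ^ p
      + (θ / (1 + θ)) * |T x| ^ p) ∂μ := by
    refine integral_mono i1 ((i3.const_mul _).add (i2.const_mul _)) fun x => ?_
    have := abs_convex_rpow_le hp.le (r := 1 / (1 + θ)) (t := θ / (1 + θ)) (by positivity)
      (by positivity) (by field_simp) (F x + θ * (F x - T x)) (T x)
    rwa [show 1 / (1 + θ) * (F x + θ * (F x - T x)) + θ / (1 + θ) * T x = F x by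
      field_simp; ring] at this
  rw [integral_add (i3.const_mul _) (i2.const_mul _), integral_const_mul, integral_const_mul] at h1
  have h2 : θ / (1 + θ) * ∫ x, |T x| ^ p ∂μ ≤ θ / (1 + θ) * ∫ x, |F x| ^ p ∂μ := by gcongr
  have h3 := h1.trans (add_le_add le_rfl h2)
  rw [div_mul_eq_mul_div, div_mul_eq_mul_div, ← add_div, le_div_iff₀ hθ1] at h3
  linarith

variable {E : Type*} [NormedAddCommGroup E] [NormedSpace ℝ E] [FiniteDimensional ℝ E]
  [MeasurableSpace E] [BorelSpace E] {μ : Measure E} [μ.IsAddHaarMeasure]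

lemma SchwartzMap.integrable_abs_rpow {p : ℝ} (hp : 1 < p) (F : 𝓢(E, ℝ)) :
    Integrable (fun x => |F x| ^ p) μ :=
  (F.memLp (ENNReal.ofReal p) μ).integrable_abs_rpow (by linarith)

lemma sub_symAvg_eq {ι : Type*} [Fintype ι] [Nonempty ι] (d : ι → E) (F : E → ℝ) (s : ℝ) (x : E) :
    F x - symAvg (fun i => s • d i) F x =
      -(2 * (Fintype.card ι : ℝ))⁻¹ * ∑ i, (F (x + s • d i) + F (x - s • d i) - 2 * F x) := by
  have hN : (Fintype.card ι : ℝ) ≠ 0 := by simp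
  simp only [symAvg, Finset.sum_sub_distrib, ← Finset.mul_sum, ← Finset.sum_div,
    Finset.sum_const, Finset.card_univ, nsmul_eq_mul]
  field_simp
  ring

/-- `L^p` contractivity of the resolvent of a constant coefficient second order operator. -/
lemma integral_rpow_le_second_order_resolvent {p : ℝ} (hp : 1 < p) {ι : Type*} [Fintype ι]
    [Nonempty ι] (d : ι → E) {κ : ℝ} (hκ : 0 ≤ κ) (F : 𝓢(E, ℝ)) :
    ∫ x, |F x| ^ p ∂μ ≤ ∫ x, |F x + ∑ i, (-κ) * ∂_{d i} (∂_{d i} F) x| ^ p ∂μ := by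
  have hlim := tendsto_integral_second_difference (μ := μ) hp F F (fun _ : ι => -κ) d
  refine ge_of_tendsto hlim ?_
  filter_upwards [self_mem_nhdsWithin] with s hs
  have hs0 : (0 : ℝ) < s := hs
  have hN : (0 : ℝ) < Fintype.card ι := by exact_mod_cast Fintype.card_pos
  have hF := F.memLp (ENNReal.ofReal p) μ
  have h := integral_abs_rpow_le_of_resolvent hp hF (memLp_symAvg (fun i => s • d i) hF)
    (integral_abs_rpow_symAvg_le hp _ hF) (θ := κ * (2 * Fintype.card ι) * s⁻¹ ^ 2) (by positivity)
  refine h.trans (le_of_eq ?_)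
  refine integral_congr_ae (Eventually.of_forall fun x => ?_)
  simp only
  rw [sub_symAvg_eq, ← Finset.mul_sum]
  congr 2
  field_simp

lemma integral_rpow_le_first_order_resolvent {p : ℝ} (hp : 1 < p) (m : E) (F : 𝓢(E, ℝ)) :
    ∫ x, |F x| ^ p ∂μ ≤ ∫ x, |F x - ∂_{m} F x| ^ p ∂μ := by
  have hlim := tendsto_integral_first_difference (μ := μ) hp F F m
  refine ge_of_tendsto hlim ?_
  filter_upwards [self_mem_nhdsWithin] with s hs
  have hs0 : (0 : ℝ) < s := hs
  have hF := F.memLp (ENNReal.ofReal p) μ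
  have h := integral_abs_rpow_le_of_resolvent hp hF (memLp_comp_add hF (s • m))
    (le_of_eq (integral_add_right_eq_self (fun x => |F x| ^ p) _)) (θ := s⁻¹) (by positivity)
  refine h.trans (le_of_eq ?_)
  refine integral_congr_ae (Eventually.of_forall fun x => ?_)
  simp only
  congr 2
  ring

lemma integral_rpow_lineDeriv_le {p : ℝ} (hp : 1 < p) (m : E) (F : 𝓢(E, ℝ)) :
    ∫ x, |∂_{m} F x| ^ p ∂μ ≤ 2 ^ p * (2 ^ p + 1) *
      (∫ x, |F x| ^ p ∂μ + ∫ x, |∂_{m} (∂_{m} F) x| ^ p ∂μ) := by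
  set K := F + ∂_{m} F with hK
  have h1 := integral_rpow_le_first_order_resolvent (μ := μ) hp m K
  have h2 : ∀ x, K x - ∂_{m} K x = F x - ∂_{m} (∂_{m} F) x := by
    intro x
    rw [hK, LineDeriv.lineDerivOp_add]
    simp only [_root_.add_apply]
    ring
  simp only [h2] at h1
  have iF := F.integrable_abs_rpow (μ := μ) hp
  have iK := K.integrable_abs_rpow (μ := μ) hp
  have iFF := (∂_{m} (∂_{m} F)).integrable_abs_rpow (μ := μ) hp
  have h3 : ∫ x, |F x - ∂_{m} (∂_{m} F) x| ^ p ∂μ ≤ 2 ^ p *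
      (∫ x, |F x| ^ p ∂μ + ∫ x, |∂_{m} (∂_{m} F) x| ^ p ∂μ) := by
    rw [← integral_add iF iFF, ← integral_const_mul]
    exact integral_mono ((F - ∂_{m} (∂_{m} F)).integrable_abs_rpow (μ := μ) hp)
      ((iF.add iFF).const_mul _) fun x => abs_sub_rpow_le hp.le _ _
  have h4 : ∫ x, |∂_{m} F x| ^ p ∂μ ≤ 2 ^ p * (∫ x, |K x| ^ p ∂μ + ∫ x, |F x| ^ p ∂μ) := by
    rw [← integral_add iK iF, ← integral_const_mul]
    refine integral_mono ((∂_{m} F).integrable_abs_rpow (μ := μ) hp)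
      ((iK.add iF).const_mul _) fun x => ?_
    have := abs_sub_rpow_le hp.le (K x) (F x)
    rwa [show K x - F x = ∂_{m} F x by simp [hK]] at this
  have hFF : 0 ≤ ∫ x, |∂_{m} (∂_{m} F) x| ^ p ∂μ := by positivity
  have hF0 : 0 ≤ ∫ x, |F x| ^ p ∂μ := by positivity
  have h2p : (0 : ℝ) < 2 ^ p := by positivity
  calc _ ≤ _ := h4
    _ ≤ 2 ^ p * (2 ^ p * (∫ x, |F x| ^ p ∂μ + ∫ x, |∂_{m} (∂_{m} F) x| ^ p ∂μ)
        + ∫ x, |F x| ^ p ∂μ) := by gcongr; exact h1.trans h3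
    _ ≤ _ := by
        rw [mul_assoc]
        refine mul_le_mul_of_nonneg_left ?_ h2p.le
        nlinarith

/-- Second derivatives along the directions of a finite family are controlled in `L^p` by the
associated second order operator. -/
lemma exists_const_second_lineDeriv_le {p : ℝ} (hp : 1 < p) {ι : Type*} [Fintype ι] [Nonempty ι] :
    ∃ C : ℝ, 0 ≤ C ∧ ∀ (d : ι → E) (F : 𝓢(E, ℝ)) (i : ι),
      ∫ x, |∂_{d i} (∂_{d i} F) x| ^ p ∂μ ≤ C * ∫ x, |∑ j, ∂_{d j} (∂_{d j} F) x| ^ p ∂μ := by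
  obtain ⟨C, hC, H⟩ := exists_const_symDiff'_rpow_le (μ := μ) (ι := ι) hp
  have hp0 : 0 < p := by linarith
  have hN : (0 : ℝ) < Fintype.card ι := by exact_mod_cast Fintype.card_pos
  set N := (Fintype.card ι : ℝ)
  refine ⟨C * (2 ^ p * 2) * (2 * N)⁻¹ ^ p, by positivity, fun d F i => ?_⟩
  have hF := F.memLp (ENNReal.ofReal p) μ
  have hleft := tendsto_integral_second_difference (μ := μ) hp F 0 (fun _ : Unit => 1 / 4)
    (fun _ => (2 : ℝ) • d i)
  have hright := (tendsto_integral_second_difference (μ := μ) hp F 0 (fun _ : ι => -(2 * N)⁻¹)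
    d).const_mul (C * (2 ^ p * 2))
  have e1 : ∀ x, (0 : 𝓢(E, ℝ)) x + ∑ _j : Unit, 1 / 4 * ∂_{(2 : ℝ) • d i} (∂_{(2 : ℝ) • d i} F) x
      = ∂_{d i} (∂_{d i} F) x := by
    intro x
    simp only [LineDeriv.lineDerivOp_left_smul, LineDeriv.lineDerivOp_smul, _root_.smul_apply]
    simp
    ring
  have e2 : ∀ x, |(0 : 𝓢(E, ℝ)) x + ∑ j, -(2 * N)⁻¹ * ∂_{d j} (∂_{d j} F) x| ^ p
      = (2 * N)⁻¹ ^ p * |∑ j, ∂_{d j} (∂_{d j} F) x| ^ p := by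
    intro x
    rw [_root_.zero_apply, zero_add, ← Finset.mul_sum, abs_mul, abs_neg,
      abs_of_pos (by positivity), Real.mul_rpow (by positivity) (by positivity)]
  simp only [e1] at hleft
  simp only [e2, integral_const_mul, ← mul_assoc] at hright
  simp only [← mul_assoc]
  refine le_of_tendsto_of_tendsto hleft hright ?_
  filter_upwards [self_mem_nhdsWithin] with s hs
  have hs0 : (0 : ℝ) < s := hs
  have key := H (fun i => s • d i) F F.continuous.measurable hF i
  set w := fun x => F x - symAvg (fun i => s • d i) F x with hw
  have hAF := memLp_symAvg (fun i => s • d i) hF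
  have hwp : MemLp w (ENNReal.ofReal p) μ := hF.sub hAF
  have hAw := memLp_symAvg (fun i => s • d i) hwp
  have h1 : ∫ x, |F x - symAvg (fun i => s • d i) (symAvg (fun i => s • d i) F) x| ^ p ∂μ ≤
      2 ^ p * 2 * ∫ x, |w x| ^ p ∂μ := by
    have i1 := hwp.integrable_abs_rpow hp0
    have i2 := hAw.integrable_abs_rpow hp0
    have e3 : ∀ x, F x - symAvg (fun i => s • d i) (symAvg (fun i => s • d i) F) x =
        w x + symAvg (fun i => s • d i) w x := by
      intro x
      have : w = ⇑F - symAvg (fun i => s • d i) F := rfl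
      rw [this, symAvg_sub]
      simp
    simp only [e3]
    calc _ ≤ ∫ x, 2 ^ p * (|w x| ^ p + |symAvg (fun i => s • d i) w x| ^ p) ∂μ :=
          integral_mono ((hwp.add hAw).integrable_abs_rpow hp0) ((i1.add i2).const_mul _)
            fun x => abs_add_rpow_le hp.le _ _
      _ = 2 ^ p * (∫ x, |w x| ^ p ∂μ + ∫ x, |symAvg (fun i => s • d i) w x| ^ p ∂μ) := by
          rw [integral_const_mul, integral_add i1 i2]
      _ ≤ 2 ^ p * (∫ x, |w x| ^ p ∂μ + ∫ x, |w x| ^ p ∂μ) := by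
          have := integral_abs_rpow_symAvg_le hp (fun i => s • d i) hwp
          exact mul_le_mul_of_nonneg_left (add_le_add le_rfl this) (by positivity)
      _ = _ := by ring
  have h2 := key.trans (mul_le_mul_of_nonneg_left h1 hC)
  have h3 := mul_le_mul_of_nonneg_left h2 (show 0 ≤ (s⁻¹ ^ 2) ^ p by positivity)
  have e4 : ∫ x, |(0 : 𝓢(E, ℝ)) x + s⁻¹ ^ 2 * ∑ _j : Unit, 1 / 4 *
      (F (x + s • (2 : ℝ) • d i) + F (x - s • (2 : ℝ) • d i) - 2 * F x)| ^ p ∂μ =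
      (s⁻¹ ^ 2) ^ p * ∫ x, |symDiff' (s • d i) (symDiff' (s • d i) F) x| ^ p ∂μ := by
    rw [← integral_const_mul]
    refine integral_congr_ae (Eventually.of_forall fun x => ?_)
    simp only
    rw [← Real.mul_rpow (by positivity) (by positivity), _root_.zero_apply, zero_add,
      ← abs_of_nonneg (show 0 ≤ s⁻¹ ^ 2 by positivity), ← abs_mul,
      abs_of_nonneg (show 0 ≤ s⁻¹ ^ 2 by positivity)]
    congr 3
    simp only [symDiff']
    rw [show x + s • d i + s • d i = x + s • (2 : ℝ) • d i by module,
      show x - s • d i - s • d i = x - s • (2 : ℝ) • d i by module,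
      show x + s • d i - s • d i = x by module, show x - s • d i + s • d i = x by module]
    simp
    ring
  have e5 : ∫ x, |(0 : 𝓢(E, ℝ)) x + s⁻¹ ^ 2 * ∑ j, -(2 * N)⁻¹ *
      (F (x + s • d j) + F (x - s • d j) - 2 * F x)| ^ p ∂μ =
      (s⁻¹ ^ 2) ^ p * ∫ x, |w x| ^ p ∂μ := by
    rw [← integral_const_mul]
    refine integral_congr_ae (Eventually.of_forall fun x => ?_)
    simp only
    rw [← Real.mul_rpow (by positivity) (by positivity), _root_.zero_apply, zero_add,
      ← abs_of_nonneg (show 0 ≤ s⁻¹ ^ 2 by positivity), ← abs_mul,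
      abs_of_nonneg (show 0 ≤ s⁻¹ ^ 2 by positivity)]
    simp only [hw]
    rw [sub_symAvg_eq, ← Finset.mul_sum]
  rw [e4, e5]
  refine h3.trans (le_of_eq ?_)
  ring

end SchwartzEstimates

section Resolvent

open scoped SchwartzMap LineDeriv

variable {n : ℕ}

/-- The `i`-th partial derivative on Schwartz functions. -/
noncomputable def pd (i : Fin n) :
    𝓢(EuclideanSpace ℝ (Fin n), ℝ) →ₗ[ℝ] 𝓢(EuclideanSpace ℝ (Fin n), ℝ) where
  toFun F := ∂_{EuclideanSpace.single i (1 : ℝ)} F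
  map_add' F G := LineDeriv.lineDerivOp_add _ F G
  map_smul' c F := LineDeriv.lineDerivOp_smul _ c F

lemma pd_def (i : Fin n) (F : 𝓢(EuclideanSpace ℝ (Fin n), ℝ)) :
    pd i F = ∂_{EuclideanSpace.single i (1 : ℝ)} F := rfl

lemma pd_apply (i : Fin n) (F : 𝓢(EuclideanSpace ℝ (Fin n), ℝ)) (x : EuclideanSpace ℝ (Fin n)) :
    pd i F x = fderiv ℝ F x (EuclideanSpace.single i 1) :=
  SchwartzMap.lineDerivOp_apply_eq_fderiv _ _ _

lemma pd_comm (i j : Fin n) (F : 𝓢(EuclideanSpace ℝ (Fin n), ℝ)) :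
    pd i (pd j F) = pd j (pd i F) := by
  have key : ∀ (i j : Fin n) (x : EuclideanSpace ℝ (Fin n)), pd i (pd j F) x =
      fderiv ℝ (fderiv ℝ F) x (EuclideanSpace.single i 1) (EuclideanSpace.single j 1) := by
    intro i j x
    rw [pd_apply]
    have h : (⇑(pd j F)) = fun y => fderiv ℝ F y (EuclideanSpace.single j 1) :=
      funext fun y => pd_apply j F y
    rw [h, fderiv_clm_apply]
    · simp
    · exact ((F.smooth 2).fderiv_right (m := 1) (by norm_num)).differentiable (by norm_num) x
    · exact differentiableAt_const _
  ext x
  rw [key, key]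
  exact ((F.smooth 2).contDiffAt.isSymmSndFDerivAt (by simp)).eq _ _

/-- Multiplication of Schwartz functions. -/
noncomputable def mulS (η : 𝓢(EuclideanSpace ℝ (Fin n), ℝ)) :
    𝓢(EuclideanSpace ℝ (Fin n), ℝ) →ₗ[ℝ] 𝓢(EuclideanSpace ℝ (Fin n), ℝ) :=
  (SchwartzMap.pairing (ContinuousLinearMap.mul ℝ ℝ) η).toLinearMap

lemma mulS_apply (η F : 𝓢(EuclideanSpace ℝ (Fin n), ℝ)) (x : EuclideanSpace ℝ (Fin n)) :
    mulS η F x = η x * F x := rfl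

lemma pd_mulS (i : Fin n) (η F : 𝓢(EuclideanSpace ℝ (Fin n), ℝ)) :
    pd i (mulS η F) = mulS (pd i η) F + mulS η (pd i F) := by
  ext x
  rw [_root_.add_apply, mulS_apply, mulS_apply, pd_apply, pd_apply, pd_apply]
  have h : ⇑(mulS η F) = fun y => η y * F y := funext fun y => mulS_apply η F y
  rw [h, fderiv_fun_mul η.differentiableAt F.differentiableAt]
  simp
  ring

/-- The Laplace operator on Schwartz functions. -/
noncomputable def lapl :
    𝓢(EuclideanSpace ℝ (Fin n), ℝ) →ₗ[ℝ] 𝓢(EuclideanSpace ℝ (Fin n), ℝ) :=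
  ∑ i, pd i ∘ₗ pd i

lemma lapl_apply (F : 𝓢(EuclideanSpace ℝ (Fin n), ℝ)) : lapl F = ∑ i, pd i (pd i F) := by
  simp [lapl]

/-- The inverse of `(2π)²`. -/
noncomputable def kap : ℝ := ((2 * Real.pi) ^ 2)⁻¹

lemma kap_pos : 0 < kap := by unfold kap; positivity

/-- The operator `1 - (2π)⁻²Δ`, whose Fourier symbol is `1 + |ξ|²`. -/
noncomputable def res :
    𝓢(EuclideanSpace ℝ (Fin n), ℝ) →ₗ[ℝ] 𝓢(EuclideanSpace ℝ (Fin n), ℝ) :=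
  LinearMap.id - kap • lapl

lemma res_apply (F : 𝓢(EuclideanSpace ℝ (Fin n), ℝ)) : res F = F - kap • lapl F := rfl

lemma pd_lapl (i : Fin n) (F : 𝓢(EuclideanSpace ℝ (Fin n), ℝ)) :
    pd i (lapl F) = lapl (pd i F) := by
  rw [lapl_apply, lapl_apply, map_sum]
  refine Finset.sum_congr rfl fun j _ => ?_
  rw [pd_comm i j, pd_comm i j]

lemma pd_res (i : Fin n) (F : 𝓢(EuclideanSpace ℝ (Fin n), ℝ)) :
    pd i (res F) = res (pd i F) := by
  rw [res_apply, res_apply, map_sub, map_smul, pd_lapl]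

lemma exists_complex_resolvent (Φ : 𝓢(EuclideanSpace ℝ (Fin n), ℂ)) :
    ∃ G : 𝓢(EuclideanSpace ℝ (Fin n), ℂ), G - kap • ∑ i : Fin n,
      ∂_{EuclideanSpace.single i (1 : ℝ)} (∂_{EuclideanSpace.single i (1 : ℝ)} G) = Φ := by
  set g : EuclideanSpace ℝ (Fin n) → ℝ := fun x => (1 + ‖x‖ ^ 2) ^ (-1 : ℝ) with hg
  have hgt : g.HasTemperateGrowth := Function.hasTemperateGrowth_one_add_norm_sq_rpow _ _
  set q : EuclideanSpace ℝ (Fin n) → ℝ := fun x => ‖x‖ ^ 2 with hq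
  have hqt : q.HasTemperateGrowth := by fun_prop
  set G := SchwartzMap.fourierMultiplierCLM ℂ g Φ with hG
  refine ⟨G, ?_⟩
  have h1 := SchwartzMap.laplacian_eq_fourierMultiplierCLM G
  have h2 := SchwartzMap.laplacian_eq_sum (EuclideanSpace.basisFun (Fin n) ℝ) G
  simp only [EuclideanSpace.basisFun_apply] at h2
  rw [← h2, h1]
  have h3 : SchwartzMap.fourierMultiplierCLM ℂ (fun x : EuclideanSpace ℝ (Fin n) => ‖x‖ ^ 2) G =
      SchwartzMap.fourierMultiplierCLM ℂ (q * g) Φ := by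
    rw [hG]
    exact SchwartzMap.fourierMultiplierCLM_fourierMultiplierCLM_apply hqt hgt Φ
  have h4 : g + q * g = fun _ => (1 : ℝ) := by
    funext x
    simp only [hg, hq, Pi.add_apply, Pi.mul_apply, Real.rpow_neg_one]
    have : (1 + ‖x‖ ^ 2) ≠ 0 := by positivity
    field_simp
  have h5 : G + SchwartzMap.fourierMultiplierCLM ℂ (q * g) Φ = Φ := by
    have : SchwartzMap.fourierMultiplierCLM ℂ (g + q * g) Φ =
        SchwartzMap.fourierMultiplierCLM ℂ g Φ + SchwartzMap.fourierMultiplierCLM ℂ (q * g) Φ := by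
      simp only [SchwartzMap.fourierMultiplierCLM_apply]
      rw [SchwartzMap.smulLeftCLM_add hgt (hqt.mul hgt), _root_.add_apply,
        FourierTransform.fourierInv_add]
    rw [hG, ← this, h4, SchwartzMap.fourierMultiplierCLM_const]
    simp
  have h6 : (SchwartzMap.fourierMultiplierCLM ℂ
      ((fun x : EuclideanSpace ℝ (Fin n) => ‖x‖ ^ 2)) G) =
      SchwartzMap.fourierMultiplierCLM ℂ (‖·‖ ^ 2) G := rfl
  rw [← h6, h3, smul_smul]
  have : kap * -(2 * Real.pi) ^ 2 = -1 := by
    unfold kap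
    field_simp
  rw [this, neg_one_smul, sub_neg_eq_add, h5]

lemma exists_res_eq (φ : 𝓢(EuclideanSpace ℝ (Fin n), ℝ)) :
    ∃ G : 𝓢(EuclideanSpace ℝ (Fin n), ℝ), res G = φ := by
  obtain ⟨G, hG⟩ := exists_complex_resolvent (φ.postcompCLM Complex.ofRealCLM)
  have hpd : ∀ (m : EuclideanSpace ℝ (Fin n)) (H : 𝓢(EuclideanSpace ℝ (Fin n), ℂ)),
      ∂_{m} (H.postcompCLM Complex.reCLM) = (∂_{m} H).postcompCLM Complex.reCLM := by
    intro m H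
    ext x
    rw [SchwartzMap.lineDerivOp_apply_eq_fderiv, SchwartzMap.postcompCLM_apply,
      SchwartzMap.lineDerivOp_apply_eq_fderiv]
    have : ⇑(H.postcompCLM Complex.reCLM) = Complex.reCLM ∘ H := rfl
    rw [this, fderiv_comp _ Complex.reCLM.differentiableAt H.differentiableAt]
    simp
  refine ⟨G.postcompCLM Complex.reCLM, ?_⟩
  rw [res_apply, lapl_apply]
  simp only [pd_def, hpd]
  ext x
  have h := congrArg Complex.re (DFunLike.congr_fun hG x)
  simpa [SchwartzMap.postcompCLM_apply] using h

/-- `L^p` domination of a family of Schwartz functions, up to a constant. -/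
def LpBdd (p : ℝ) {X : Type*} (F : X → 𝓢(EuclideanSpace ℝ (Fin n), ℝ)) (T : X → ℝ) : Prop :=
  ∃ C : ℝ, 0 ≤ C ∧ ∀ x, ∫ y, |F x y| ^ p ≤ C * T x

namespace LpBdd

variable {p : ℝ} {X : Type*} {F G : X → 𝓢(EuclideanSpace ℝ (Fin n), ℝ)} {T T' : X → ℝ}

lemma mono (h : LpBdd p F T) (hT : ∀ x, T x ≤ T' x) : LpBdd p F T' := by
  obtain ⟨C, hC, h⟩ := h
  exact ⟨C, hC, fun x => (h x).trans (mul_le_mul_of_nonneg_left (hT x) hC)⟩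

lemma trans (h : LpBdd p F (fun x => ∫ y, |G x y| ^ p)) (h' : LpBdd p G T) : LpBdd p F T := by
  obtain ⟨C, hC, h⟩ := h
  obtain ⟨C', hC', h'⟩ := h'
  refine ⟨C * C', by positivity, fun x => (h x).trans ?_⟩
  rw [mul_assoc]
  exact mul_le_mul_of_nonneg_left (h' x) hC

lemma comp (h : LpBdd p F T) {Y : Type*} (g : Y → X) :
    LpBdd p (fun y => F (g y)) (fun y => T (g y)) := by
  obtain ⟨C, hC, h⟩ := h
  exact ⟨C, hC, fun y => h (g y)⟩

lemma refl (p : ℝ) (F : X → 𝓢(EuclideanSpace ℝ (Fin n), ℝ)) :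
    LpBdd p F (fun x => ∫ y, |F x y| ^ p) :=
  ⟨1, zero_le_one, fun _ => by rw [one_mul]⟩

lemma add (hp : 1 < p) (hF : LpBdd p F T) (hG : LpBdd p G T) :
    LpBdd p (fun x => F x + G x) T := by
  obtain ⟨C, hC, hF⟩ := hF
  obtain ⟨C', hC', hG⟩ := hG
  refine ⟨2 ^ p * (C + C'), by positivity, fun x => ?_⟩
  have i1 := (F x).integrable_abs_rpow (μ := volume) hp
  have i2 := (G x).integrable_abs_rpow (μ := volume) hp
  calc ∫ y, |(F x + G x) y| ^ p ≤ ∫ y, 2 ^ p * (|F x y| ^ p + |G x y| ^ p) :=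
        integral_mono ((F x + G x).integrable_abs_rpow hp) ((i1.add i2).const_mul _)
          fun y => abs_add_rpow_le hp.le _ _
    _ = 2 ^ p * ((∫ y, |F x y| ^ p) + ∫ y, |G x y| ^ p) := by
        rw [integral_const_mul, integral_add i1 i2]
    _ ≤ 2 ^ p * (C * T x + C' * T x) :=
        mul_le_mul_of_nonneg_left (add_le_add (hF x) (hG x)) (by positivity)
    _ = _ := by ring

lemma const_smul (hF : LpBdd p F T) (c : ℝ) : LpBdd p (fun x => c • F x) T := by
  obtain ⟨C, hC, hF⟩ := hF
  refine ⟨|c| ^ p * C, by positivity, fun x => ?_⟩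
  have : ∀ y, |(c • F x) y| ^ p = |c| ^ p * |F x y| ^ p := fun y => by
    rw [_root_.smul_apply, smul_eq_mul, abs_mul, Real.mul_rpow (abs_nonneg _) (abs_nonneg _)]
  simp only [this]
  rw [integral_const_mul, mul_assoc]
  exact mul_le_mul_of_nonneg_left (hF x) (by positivity)

lemma sub (hp : 1 < p) (hF : LpBdd p F T) (hG : LpBdd p G T) :
    LpBdd p (fun x => F x - G x) T := by
  simpa [sub_eq_add_neg] using hF.add hp (hG.const_smul (-1))

lemma zero (hp : 1 < p) : LpBdd p (fun _ : X => (0 : 𝓢(EuclideanSpace ℝ (Fin n), ℝ))) T :=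
  ⟨0, le_rfl, fun x => by
    simp [Real.zero_rpow (by linarith : p ≠ 0)]⟩

lemma sum (hp : 1 < p) {ι : Type*} {s : Finset ι} {F : ι → X → 𝓢(EuclideanSpace ℝ (Fin n), ℝ)}
    (hF : ∀ i ∈ s, LpBdd p (F i) T) : LpBdd p (fun x => ∑ i ∈ s, F i x) T := by
  classical
  induction s using Finset.induction_on with
  | empty => simpa using zero hp
  | insert a s ha ih =>
    simp only [Finset.sum_insert ha]
    exact (hF a (Finset.mem_insert_self _ _)).add hp
      (ih fun i hi => hF i (Finset.mem_insert_of_mem hi))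

lemma mulS (hp : 1 < p) (hF : LpBdd p F T) (η : 𝓢(EuclideanSpace ℝ (Fin n), ℝ)) :
    LpBdd p (fun x => mulS η (F x)) T := by
  obtain ⟨M, hM⟩ : ∃ M : ℝ, ∀ y, ‖η y‖ ≤ M := by
    obtain ⟨M, hM⟩ := η.decay 0 0
    exact ⟨M, fun y => by simpa using hM.2 y⟩
  have hM0 : 0 ≤ M := (norm_nonneg _).trans (hM 0)
  refine trans ⟨M ^ p, by positivity, fun x => ?_⟩ hF
  rw [← integral_const_mul]
  refine integral_mono ((_root_.mulS η (F x)).integrable_abs_rpow hp)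
    (((F x).integrable_abs_rpow hp).const_mul _) fun y => ?_
  simp only
  rw [mulS_apply, abs_mul, Real.mul_rpow (abs_nonneg _) (abs_nonneg _)]
  gcongr
  exact hM y

end LpBdd

variable {p : ℝ}

lemma lpBdd_self (hn : n ≠ 0) (hp : 1 < p) :
    LpBdd p (fun F : 𝓢(EuclideanSpace ℝ (Fin n), ℝ) => F) (fun F => ∫ y, |res F y| ^ p) := by
  have : Nonempty (Fin n) := ⟨⟨0, Nat.pos_of_ne_zero hn⟩⟩
  refine ⟨1, zero_le_one, fun F => ?_⟩
  rw [one_mul]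
  refine (integral_rpow_le_second_order_resolvent (μ := volume) hp
    (fun i : Fin n => EuclideanSpace.single i (1 : ℝ)) kap_pos.le F).trans (le_of_eq ?_)
  congr 1
  funext x
  rw [res_apply, lapl_apply]
  simp [pd_def, Finset.mul_sum, sub_eq_add_neg]

lemma lpBdd_lapl (hn : n ≠ 0) (hp : 1 < p) :
    LpBdd p (fun F : 𝓢(EuclideanSpace ℝ (Fin n), ℝ) => lapl F)
      (fun F => ∫ y, |res F y| ^ p) := by
  have h := (((lpBdd_self hn hp).sub hp (LpBdd.refl p _)).const_smul kap⁻¹)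
  refine cast ?_ h
  congr 1
  funext F
  rw [res_apply, sub_sub_cancel, smul_smul, inv_mul_cancel₀ kap_pos.ne', one_smul]

lemma lpBdd_pd_pd (hn : n ≠ 0) (hp : 1 < p) (i j : Fin n) :
    LpBdd p (fun F : 𝓢(EuclideanSpace ℝ (Fin n), ℝ) => pd i (pd j F))
      (fun F => ∫ y, |res F y| ^ p) := by
  have : Nonempty (Fin n) := ⟨i⟩
  refine LpBdd.trans (G := fun F => lapl F) ?_ (lpBdd_lapl hn hp)
  obtain ⟨C, hC, H⟩ := exists_const_second_lineDeriv_le (μ := (volume : Measure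
    (EuclideanSpace ℝ (Fin n)))) hp (ι := (Fin n × Fin n) × Bool)
  set d : (Fin n × Fin n) × Bool → EuclideanSpace ℝ (Fin n) := fun k =>
    EuclideanSpace.single k.1.1 (1 : ℝ) + (if k.2 then (1 : ℝ) else -1) •
      EuclideanSpace.single k.1.2 (1 : ℝ) with hd
  have hdd : ∀ (k : (Fin n × Fin n) × Bool) (F : 𝓢(EuclideanSpace ℝ (Fin n), ℝ)),
      ∂_{d k} (∂_{d k} F) = pd k.1.1 (pd k.1.1 F) + pd k.1.2 (pd k.1.2 F) +
        (2 * (if k.2 then (1 : ℝ) else -1)) • pd k.1.1 (pd k.1.2 F) := by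
    intro k F
    have h1 : ∀ H : 𝓢(EuclideanSpace ℝ (Fin n), ℝ), ∂_{d k} H =
        pd k.1.1 H + (if k.2 then (1 : ℝ) else -1) • pd k.1.2 H := by
      intro H
      rw [hd, LineDeriv.lineDerivOp_left_add, LineDeriv.lineDerivOp_left_smul]
      rfl
    rw [h1, h1, map_add, map_add, map_smul, map_smul, pd_comm k.1.2 k.1.1, smul_add, smul_smul]
    have : (if k.2 then (1 : ℝ) else -1) * (if k.2 then (1 : ℝ) else -1) = 1 := by
      split_ifs <;> norm_num
    rw [this]
    module
  have hsum : ∀ F : 𝓢(EuclideanSpace ℝ (Fin n), ℝ), ∑ k, ∂_{d k} (∂_{d k} F) =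
      (4 * n : ℝ) • lapl F := by
    intro F
    rw [Fintype.sum_prod_type, Fintype.sum_prod_type, lapl_apply]
    simp only [hdd, Fintype.sum_bool]
    simp only [if_true, Bool.false_eq_true, if_false]
    have : ∀ a b : Fin n, (pd a (pd a F) + pd b (pd b F) + (2 * (1 : ℝ)) • pd a (pd b F) +
        (pd a (pd a F) + pd b (pd b F) + (2 * (-1 : ℝ)) • pd a (pd b F))) =
        (2 : ℝ) • pd a (pd a F) + (2 : ℝ) • pd b (pd b F) := by
      intro a b
      module
    simp only [this, Finset.sum_add_distrib, Finset.sum_const, ← Finset.smul_sum,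
      Finset.card_univ, Fintype.card_fin]
    rw [← Nat.cast_smul_eq_nsmul ℝ]
    module
  have hk : ∀ k : (Fin n × Fin n) × Bool, LpBdd p
      (fun F : 𝓢(EuclideanSpace ℝ (Fin n), ℝ) => ∂_{d k} (∂_{d k} F))
      (fun F => ∫ y, |lapl F y| ^ p) := by
    intro k
    refine LpBdd.trans (G := fun F => (4 * n : ℝ) • lapl F) ⟨C, hC, fun F => ?_⟩
      ((LpBdd.refl p _).const_smul _)
    refine (H d F k).trans (le_of_eq ?_)
    simp only [← hsum, _root_.sum_apply]
  have := ((hk ((i, j), true)).sub hp (hk ((i, j), false))).const_smul (1 / 4)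
  refine cast ?_ this
  congr 1
  funext F
  rw [hdd, hdd]
  simp only [if_true, Bool.false_eq_true, if_false]
  module

lemma lpBdd_pd (hn : n ≠ 0) (hp : 1 < p) (i : Fin n) :
    LpBdd p (fun F : 𝓢(EuclideanSpace ℝ (Fin n), ℝ) => pd i F)
      (fun F => ∫ y, |res F y| ^ p) := by
  obtain ⟨C, hC, h⟩ := lpBdd_self hn hp
  obtain ⟨C', hC', h'⟩ := lpBdd_pd_pd hn hp i i
  refine ⟨2 ^ p * (2 ^ p + 1) * (C + C'), by positivity, fun F => ?_⟩
  refine (integral_rpow_lineDeriv_le hp _ F).trans ?_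
  rw [mul_assoc _ (C + C'), add_mul]
  exact mul_le_mul_of_nonneg_left (add_le_add (h F) (h' F)) (by positivity)

end Resolvent

section DivergenceFree

open scoped SchwartzMap LineDeriv

variable {n : ℕ} {p : ℝ}

lemma tsupport_pd_subset (i : Fin n) (F : 𝓢(EuclideanSpace ℝ (Fin n), ℝ)) :
    tsupport (pd i F) ⊆ tsupport F := SchwartzMap.tsupport_lineDerivOp_subset _ F

lemma tsupport_mulS_subset (η F : 𝓢(EuclideanSpace ℝ (Fin n), ℝ)) :
    tsupport (mulS η F) ⊆ tsupport η := by
  refine closure_mono fun x hx => ?_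
  rw [Function.mem_support, mulS_apply] at hx
  exact left_ne_zero_of_mul hx

/-- The divergence of a vector of Schwartz functions. -/
noncomputable def divS (G : Fin n → 𝓢(EuclideanSpace ℝ (Fin n), ℝ)) :
    𝓢(EuclideanSpace ℝ (Fin n), ℝ) := ∑ i, pd i (G i)

/-- The symmetrized gradient of a vector of Schwartz functions. -/
noncomputable def symS (G : Fin n → 𝓢(EuclideanSpace ℝ (Fin n), ℝ)) (i j : Fin n) :
    𝓢(EuclideanSpace ℝ (Fin n), ℝ) := (1 / 2 : ℝ) • (pd i (G j) + pd j (G i))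

/-- The antisymmetric potential `(2π)⁻²(∂ⱼGᵢ - ∂ᵢGⱼ)`. -/
noncomputable def potS (G : Fin n → 𝓢(EuclideanSpace ℝ (Fin n), ℝ)) (i j : Fin n) :
    𝓢(EuclideanSpace ℝ (Fin n), ℝ) := kap • (pd j (G i) - pd i (G j))

/-- The divergence of the localized potential. -/
noncomputable def corrS (η : 𝓢(EuclideanSpace ℝ (Fin n), ℝ))
    (G : Fin n → 𝓢(EuclideanSpace ℝ (Fin n), ℝ)) (i : Fin n) :
    𝓢(EuclideanSpace ℝ (Fin n), ℝ) := -∑ j, pd j (mulS η (potS G i j))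

lemma potS_swap (G : Fin n → 𝓢(EuclideanSpace ℝ (Fin n), ℝ)) (i j : Fin n) :
    potS G j i = -potS G i j := by
  unfold potS
  rw [← smul_neg, neg_sub]

lemma divS_corrS (η : 𝓢(EuclideanSpace ℝ (Fin n), ℝ))
    (G : Fin n → 𝓢(EuclideanSpace ℝ (Fin n), ℝ)) : divS (corrS η G) = 0 := by
  have h : divS (corrS η G) = -∑ i, ∑ j, pd i (pd j (mulS η (potS G i j))) := by
    simp only [divS, corrS, map_neg, map_sum, Finset.sum_neg_distrib]
  have h2 : ∑ i, ∑ j, pd i (pd j (mulS η (potS G i j))) =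
      -∑ i, ∑ j, pd i (pd j (mulS η (potS G i j))) := by
    conv_lhs => rw [Finset.sum_comm]
    rw [← Finset.sum_neg_distrib]
    refine Finset.sum_congr rfl fun i _ => ?_
    rw [← Finset.sum_neg_distrib]
    refine Finset.sum_congr rfl fun j _ => ?_
    rw [pd_comm j i, potS_swap G i j, map_neg, map_neg, map_neg]
  rw [h, neg_eq_zero]
  ext x
  have h3 := DFunLike.congr_fun h2 x
  rw [_root_.neg_apply] at h3
  rw [_root_.zero_apply]
  linarith

lemma sum_pd_potS (G : Fin n → 𝓢(EuclideanSpace ℝ (Fin n), ℝ)) (i : Fin n) :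
    ∑ j, pd j (potS G i j) = kap • (lapl (G i) - pd i (divS G)) := by
  simp only [potS, map_smul, map_sub, lapl_apply, divS, map_sum, ← Finset.smul_sum,
    Finset.sum_sub_distrib]
  congr 2
  exact Finset.sum_congr rfl fun j _ => pd_comm j i _

lemma res_sub_corrS {η : 𝓢(EuclideanSpace ℝ (Fin n), ℝ)}
    {G : Fin n → 𝓢(EuclideanSpace ℝ (Fin n), ℝ)} {i : Fin n}
    (hη : mulS η (res (G i)) = res (G i)) :
    res (G i) - corrS η G i = mulS η (G i - kap • pd i (divS G)) +
      ∑ j, mulS (pd j η) (potS G i j) := by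
  have h1 : corrS η G i = -(∑ j, mulS (pd j η) (potS G i j)) -
      mulS η (kap • (lapl (G i) - pd i (divS G))) := by
    rw [corrS, ← sum_pd_potS, map_sum]
    simp only [pd_mulS, Finset.sum_add_distrib]
    abel
  have h2 : mulS η (G i - kap • pd i (divS G)) =
      mulS η (res (G i)) + mulS η (kap • (lapl (G i) - pd i (divS G))) := by
    rw [← map_add, res_apply]
    congr 1
    module
  rw [h1, h2, hη]
  abel

lemma pd_res_sub_corrS {η : 𝓢(EuclideanSpace ℝ (Fin n), ℝ)}
    {G : Fin n → 𝓢(EuclideanSpace ℝ (Fin n), ℝ)} {i : Fin n}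
    (hη : mulS η (res (G i)) = res (G i)) (k : Fin n) :
    pd k (res (G i) - corrS η G i) =
      (mulS (pd k η) (G i - kap • pd i (divS G)) + mulS η (pd k (G i)) +
        ∑ j, (mulS (pd k (pd j η)) (potS G i j) + mulS (pd j η) (pd k (potS G i j)))) -
      kap • mulS η (pd k (pd i (divS G))) := by
  rw [res_sub_corrS hη, map_add, pd_mulS, map_sum]
  simp only [pd_mulS, map_sub, map_smul]
  abel

variable (hn : n ≠ 0) (hp : 1 < p)
include hn hp

lemma lpBdd_pd_res_sub_corrS (η : 𝓢(EuclideanSpace ℝ (Fin n), ℝ)) (i k : Fin n) :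
    LpBdd p (fun G : {G : Fin n → 𝓢(EuclideanSpace ℝ (Fin n), ℝ) //
        ∀ i, mulS η (res (G i)) = res (G i)} => pd k (res (G.1 i) - corrS η G.1 i))
      (fun G => (∫ y, |res (divS G.1) y| ^ p) + ∑ i, ∫ y, |res (G.1 i) y| ^ p) := by
  have hX : ∀ G : {G : Fin n → 𝓢(EuclideanSpace ℝ (Fin n), ℝ) //
        ∀ i, mulS η (res (G i)) = res (G i)}, pd k (res (G.1 i) - corrS η G.1 i) = _ :=
    fun G => pd_res_sub_corrS (G.2 i) k
  simp only [hX]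
  have hdiv0 : ∀ G : Fin n → 𝓢(EuclideanSpace ℝ (Fin n), ℝ),
      0 ≤ ∫ y, |res (divS G) y| ^ p := fun G => by positivity
  have hS0 : ∀ G : Fin n → 𝓢(EuclideanSpace ℝ (Fin n), ℝ),
      0 ≤ ∑ i, ∫ y, |res (G i) y| ^ p := fun G => by positivity
  have hT : ∀ (j : Fin n) (G : {G : Fin n → 𝓢(EuclideanSpace ℝ (Fin n), ℝ) //
        ∀ i, mulS η (res (G i)) = res (G i)}), ∫ y, |res (G.1 j) y| ^ p ≤
      (∫ y, |res (divS G.1) y| ^ p) + ∑ i, ∫ y, |res (G.1 i) y| ^ p := by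
    intro j G
    have h1 := Finset.single_le_sum (f := fun i => ∫ y, |res (G.1 i) y| ^ p)
      (fun i _ => by positivity) (Finset.mem_univ j)
    have h2 := hdiv0 G.1
    linarith
  have a0 := fun j => ((lpBdd_self hn hp).comp (fun G : {G : Fin n →
    𝓢(EuclideanSpace ℝ (Fin n), ℝ) // ∀ i, mulS η (res (G i)) = res (G i)} => G.1 j)).mono (hT j)
  have a1 := fun l j => ((lpBdd_pd hn hp l).comp (fun G : {G : Fin n →
    𝓢(EuclideanSpace ℝ (Fin n), ℝ) // ∀ i, mulS η (res (G i)) = res (G i)} => G.1 j)).mono (hT j)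
  have a2 := fun m l j => ((lpBdd_pd_pd hn hp m l).comp (fun G : {G : Fin n →
    𝓢(EuclideanSpace ℝ (Fin n), ℝ) // ∀ i, mulS η (res (G i)) = res (G i)} => G.1 j)).mono (hT j)
  have adiv : LpBdd p (fun G : {G : Fin n →
      𝓢(EuclideanSpace ℝ (Fin n), ℝ) // ∀ i, mulS η (res (G i)) = res (G i)} =>
      pd i (divS G.1)) (fun G =>
        (∫ y, |res (divS G.1) y| ^ p) + ∑ i, ∫ y, |res (G.1 i) y| ^ p) := by
    have := LpBdd.sum hp (s := Finset.univ) fun j _ => a2 i j j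
    simpa only [divS, map_sum] using this
  have apot : ∀ j, LpBdd p (fun G : {G : Fin n →
      𝓢(EuclideanSpace ℝ (Fin n), ℝ) // ∀ i, mulS η (res (G i)) = res (G i)} =>
      potS G.1 i j) (fun G =>
        (∫ y, |res (divS G.1) y| ^ p) + ∑ i, ∫ y, |res (G.1 i) y| ^ p) := fun j => ((a1 j i).sub hp (a1 i j)).const_smul kap
  have apotk : ∀ j, LpBdd p (fun G : {G : Fin n →
      𝓢(EuclideanSpace ℝ (Fin n), ℝ) // ∀ i, mulS η (res (G i)) = res (G i)} =>
      pd k (potS G.1 i j)) (fun G =>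
        (∫ y, |res (divS G.1) y| ^ p) + ∑ i, ∫ y, |res (G.1 i) y| ^ p) := fun j => by
    have := ((a2 k j i).sub hp (a2 k i j)).const_smul kap
    simpa only [potS, map_smul, map_sub] using this
  have addiv : LpBdd p (fun G : {G : Fin n →
      𝓢(EuclideanSpace ℝ (Fin n), ℝ) // ∀ i, mulS η (res (G i)) = res (G i)} =>
      pd k (pd i (divS G.1))) (fun G =>
        (∫ y, |res (divS G.1) y| ^ p) + ∑ i, ∫ y, |res (G.1 i) y| ^ p) :=
    ((lpBdd_pd_pd hn hp k i).comp _).mono fun G => le_add_of_nonneg_right (hS0 G.1)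
  exact (((((a0 i).sub hp (adiv.const_smul kap)).mulS hp (pd k η)).add hp
    ((a1 k i).mulS hp η)).add hp (LpBdd.sum hp fun j _ =>
      ((apot j).mulS hp (pd k (pd j η))).add hp ((apotk j).mulS hp (pd j η)))).sub hp
      ((addiv.mulS hp η).const_smul kap)

/-- A vector field supported where `η = 1` is, up to an error controlled by its divergence and by
itself, a divergence free field supported in the support of `η`. -/
lemma exists_divS_eq_zero_approx (η : 𝓢(EuclideanSpace ℝ (Fin n), ℝ)) :
    ∃ C : ℝ, 0 ≤ C ∧ ∀ φ : Fin n → 𝓢(EuclideanSpace ℝ (Fin n), ℝ),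
      (∀ i, mulS η (φ i) = φ i) →
      ∃ ψ : Fin n → 𝓢(EuclideanSpace ℝ (Fin n), ℝ), (∀ i, tsupport (ψ i) ⊆ tsupport η) ∧
        divS ψ = 0 ∧ ∀ i k, ∫ y, |pd k (φ i - ψ i) y| ^ p ≤
          C * ((∫ y, |divS φ y| ^ p) + ∑ i, ∫ y, |φ i y| ^ p) := by
  choose C hC H using fun ik : Fin n × Fin n => lpBdd_pd_res_sub_corrS hn hp η ik.1 ik.2
  refine ⟨∑ ik, C ik, Finset.sum_nonneg fun ik _ => hC ik, fun φ hφ => ?_⟩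
  choose G hG using fun i => exists_res_eq (φ i)
  have hdiv : res (divS G) = divS φ := by
    simp only [divS, map_sum, ← pd_res, hG]
  refine ⟨corrS η G, fun i => ?_, divS_corrS η G, fun i k => ?_⟩
  · have : ∀ j ∈ (Finset.univ : Finset (Fin n)), tsupport (pd j (mulS η (potS G i j))) ⊆
        tsupport η := fun j _ => (tsupport_pd_subset _ _).trans (tsupport_mulS_subset _ _)
    refine closure_minimal (fun x hx => ?_) (isClosed_tsupport _)
    by_contra hxη
    refine hx ?_
    simp only [corrS]
    rw [_root_.neg_apply, _root_.sum_apply, neg_eq_zero]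
    exact Finset.sum_eq_zero fun j hj => image_eq_zero_of_notMem_tsupport fun h => hxη (this j hj h)
  · have h := H (i, k) ⟨G, fun i => by rw [hG]; exact hφ i⟩
    simp only [hG, hdiv] at h
    refine h.trans (mul_le_mul_of_nonneg_right
      (Finset.single_le_sum (fun ik _ => hC ik) (Finset.mem_univ (i, k))) (by positivity))

/-- Korn's inequality, with a lower order term. -/
lemma exists_korn_const : ∃ C : ℝ, 0 ≤ C ∧ ∀ (φ : Fin n → 𝓢(EuclideanSpace ℝ (Fin n), ℝ))
    (i k : Fin n), ∫ y, |pd k (φ i) y| ^ p ≤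
      C * ((∑ i, ∑ j, ∫ y, |symS φ i j y| ^ p) + ∑ i, ∫ y, |φ i y| ^ p) := by
  have key : ∀ ik : Fin n × Fin n,
      LpBdd p (fun G : Fin n → 𝓢(EuclideanSpace ℝ (Fin n), ℝ) => pd ik.2 (res (G ik.1)))
      (fun G => (∑ i, ∑ j, ∫ y, |res (symS G i j) y| ^ p) + ∑ i, ∫ y, |res (G i) y| ^ p) := by
    rintro ⟨i, k⟩
    have hE0 : ∀ G : Fin n → 𝓢(EuclideanSpace ℝ (Fin n), ℝ),
      0 ≤ ∑ i, ∑ j, ∫ y, |res (symS G i j) y| ^ p := fun G => by positivity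
    have hS0 : ∀ G : Fin n → 𝓢(EuclideanSpace ℝ (Fin n), ℝ),
      0 ≤ ∑ i, ∫ y, |res (G i) y| ^ p := fun G => by positivity
    have a1 := ((lpBdd_pd hn hp k).comp
      (fun G : Fin n → 𝓢(EuclideanSpace ℝ (Fin n), ℝ) => G i)).mono
      (T' := fun G => (∑ i, ∑ j, ∫ y, |res (symS G i j) y| ^ p) + ∑ i, ∫ y, |res (G i) y| ^ p)
      fun G => by
        have h1 := Finset.single_le_sum (f := fun i => ∫ y, |res (G i) y| ^ p)
          (fun i _ => by positivity) (Finset.mem_univ i)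
        have h2 := hE0 G
        linarith
    have a2 := fun l i j => ((lpBdd_pd_pd hn hp k l).comp
      (fun G : Fin n → 𝓢(EuclideanSpace ℝ (Fin n), ℝ) => symS G i j)).mono
      (T' := fun G => (∑ i, ∑ j, ∫ y, |res (symS G i j) y| ^ p) + ∑ i, ∫ y, |res (G i) y| ^ p)
      fun G => by
        have h1 := Finset.single_le_sum (f := fun j => ∫ y, |res (symS G i j) y| ^ p)
          (fun i _ => by positivity) (Finset.mem_univ j)
        have h3 := Finset.single_le_sum (f := fun i => ∑ j, ∫ y, |res (symS G i j) y| ^ p)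
          (fun i _ => by positivity) (Finset.mem_univ i)
        have h2 := hS0 G
        linarith
    have hform : ∀ G : Fin n → 𝓢(EuclideanSpace ℝ (Fin n), ℝ), pd k (res (G i)) =
        pd k (G i) - kap • ∑ j, ((2 : ℝ) • pd k (pd j (symS G i j)) -
          pd k (pd i (symS G j j))) := by
      intro G
      rw [res_apply, map_sub, map_smul, lapl_apply, map_sum]
      congr 2
      refine Finset.sum_congr rfl fun j _ => ?_
      simp only [symS, map_smul, map_add]
      rw [pd_comm j i]
      module
    simp only [hform]
    exact a1.sub hp ((LpBdd.sum hp fun j _ =>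
      ((a2 j i j).const_smul 2).sub hp (a2 i j j)).const_smul kap)
  choose C hC H using key
  refine ⟨∑ ik, C ik, Finset.sum_nonneg fun ik _ => hC ik, fun φ i k => ?_⟩
  choose G hG using fun i => exists_res_eq (φ i)
  have hsym : ∀ i j, res (symS G i j) = symS φ i j := by
    intro i j
    simp only [symS, map_smul, map_add, ← pd_res, hG]
  have h := H (i, k) G
  simp only [hG, hsym] at h
  refine h.trans (mul_le_mul_of_nonneg_right
    (Finset.single_le_sum (fun ik _ => hC ik) (Finset.mem_univ (i, k))) (by positivity))

end DivergenceFree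

section Rescaling

open Metric

variable {E : Type*} [NormedAddCommGroup E] [NormedSpace ℝ E] [FiniteDimensional ℝ E]

/-- Almost all of a ball can be filled by finitely many disjoint small balls. -/
lemma exists_finset_disjoint_closedBall [MeasurableSpace E] [BorelSpace E] [Nontrivial E]
    {ρ r ε : ℝ} (hρ : 0 < ρ) (hρ1 : ρ ≤ 1) (hr : 0 < r) (hε : 0 < ε) :
    ∃ (t : Finset E) (R : E → ℝ),
      (∀ c ∈ t, 0 < R c ∧ R c ≤ r ∧ closedBall c (R c) ⊆ ball 0 ρ) ∧
      ((t : Set E).PairwiseDisjoint fun c => closedBall c (R c)) ∧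
      ρ ^ Module.finrank ℝ E - ε ≤ ∑ c ∈ t, R c ^ Module.finrank ℝ E ∧
      ∑ c ∈ t, R c ^ Module.finrank ℝ E ≤ 1 := by
  set μ : Measure E := Measure.addHaar
  set d := Module.finrank ℝ E
  have hd : 0 < d := Module.finrank_pos
  obtain ⟨T, R, hTc, hTs, hTR, hTμ, hTd⟩ := Besicovitch.exists_disjoint_closedBall_covering_ae μ
    (fun _ => Set.univ) (ball (0 : E) ρ)
    (fun x _ δ hδ => ⟨δ / 2, trivial, by positivity, by linarith⟩)
    (fun x => min r (ρ - ‖x‖)) (fun x hx => lt_min hr (by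
      rw [mem_ball_zero_iff] at hx
      linarith))
  have hR : ∀ c ∈ T, 0 < R c ∧ R c ≤ r ∧ closedBall c (R c) ⊆ ball 0 ρ := by
    intro c hc
    obtain ⟨-, h0, h1⟩ := hTR c hc
    refine ⟨h0, (h1.trans_le (min_le_left _ _)).le, fun y hy => ?_⟩
    have h2 := h1.trans_le (min_le_right _ _)
    rw [mem_closedBall, dist_eq_norm] at hy
    rw [mem_ball_zero_iff]
    have := norm_le_norm_add_norm_sub' y c
    linarith
  set V := μ (ball (0 : E) 1)
  have hV0 : V ≠ 0 := (measure_ball_pos μ 0 one_pos).ne'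
  have hVt : V ≠ ⊤ := measure_ball_lt_top.ne
  have hvol : ∀ c ∈ T, μ (closedBall c (R c)) = ENNReal.ofReal (R c ^ d) * V :=
    fun c hc => Measure.addHaar_closedBall μ c (hR c hc).1.le
  have hunion : μ (⋃ c ∈ T, closedBall c (R c)) = ENNReal.ofReal (ρ ^ d) * V := by
    rw [← Measure.addHaar_ball μ 0 hρ.le]
    refine le_antisymm (measure_mono (Set.iUnion₂_subset fun c hc => (hR c hc).2.2)) ?_
    exact measure_mono_ae (ae_le_set.2 hTμ)
  rw [measure_biUnion hTc hTd fun c _ => measurableSet_closedBall] at hunion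
  have hle : ∀ t : Finset E, ↑t ⊆ T → ∑ c ∈ t, R c ^ d ≤ 1 := by
    intro t ht
    have h1 : μ (⋃ c ∈ t, closedBall c (R c)) ≤ V :=
      measure_mono (Set.iUnion₂_subset fun c hc =>
        ((hR c (ht hc)).2.2).trans (ball_subset_ball hρ1))
    rw [measure_biUnion_finset (hTd.subset ht) fun c _ => measurableSet_closedBall,
      Finset.sum_congr rfl fun c hc => hvol c (ht hc), ← Finset.sum_mul,
      ← ENNReal.ofReal_sum_of_nonneg fun c hc => pow_nonneg (hR c (ht hc)).1.le _] at h1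
    have h2 : ENNReal.ofReal (∑ c ∈ t, R c ^ d) ≤ 1 := by
      by_contra! h
      have := ENNReal.mul_lt_mul_left hV0 hVt h
      simp only [one_mul] at this
      exact absurd h1 (not_le.2 this)
    rwa [ENNReal.ofReal_le_one] at h2
  by_cases hsmall : ρ ^ d - ε ≤ 0
  · exact ⟨∅, R, by simp, by simp, by simpa using hsmall, by simp⟩
  have hlt : ENNReal.ofReal (ρ ^ d - ε) * V < ∑' c : T, μ (closedBall (c : E) (R c)) := by
    rw [hunion]
    refine ENNReal.mul_lt_mul_left hV0 hVt ?_
    rw [ENNReal.ofReal_lt_ofReal_iff (by positivity)]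
    linarith
  rw [ENNReal.tsum_eq_iSup_sum, lt_iSup_iff] at hlt
  obtain ⟨u, hu⟩ := hlt
  classical
  have huT : ↑(u.map (Function.Embedding.subtype (· ∈ T))) ⊆ T := by
    intro c hc
    simp only [Finset.coe_map, Set.mem_image] at hc
    obtain ⟨a, -, rfl⟩ := hc
    exact a.2
  refine ⟨u.map (Function.Embedding.subtype (· ∈ T)), R, fun c hc => hR c (huT hc),
    hTd.subset huT, ?_, hle _ huT⟩
  rw [Finset.sum_map]
  simp only [Function.Embedding.subtype_apply]
  rw [Finset.sum_congr rfl fun (c : T) _ => hvol (c : E) c.2, ← Finset.sum_mul,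
    ← ENNReal.ofReal_sum_of_nonneg fun (c : T) _ => pow_nonneg (hR c c.2).1.le _] at hu
  have h3 : ENNReal.ofReal (ρ ^ d - ε) < ENNReal.ofReal (∑ c ∈ u, R c ^ d) :=
    lt_of_mul_lt_mul_right' hu
  exact ((ENNReal.ofReal_lt_ofReal_iff_of_nonneg (by linarith)).1 h3).le

/-- Superposition of rescaled copies of a map. -/
noncomputable def rescale (t : Finset E) (R : E → ℝ) (φ : E → E) (x : E) : E :=
  ∑ c ∈ t, R c • φ ((R c)⁻¹ • (x - c))

variable {t : Finset E} {R : E → ℝ} {φ : E → E}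

omit [FiniteDimensional ℝ E] in
lemma contDiff_rescale (hφ : ContDiff ℝ (⊤ : ℕ∞) φ) : ContDiff ℝ (⊤ : ℕ∞) (rescale t R φ) := by
  unfold rescale
  fun_prop

omit [FiniteDimensional ℝ E] in
lemma fderiv_rescale (hφ : Differentiable ℝ φ) (hR : ∀ c ∈ t, R c ≠ 0) (x : E) :
    fderiv ℝ (rescale t R φ) x = ∑ c ∈ t, fderiv ℝ φ ((R c)⁻¹ • (x - c)) := by
  refine HasFDerivAt.fderiv ?_
  refine HasFDerivAt.fun_sum fun c hc => ?_
  have h1 : HasFDerivAt (fun y => (R c)⁻¹ • (y - c)) ((R c)⁻¹ • ContinuousLinearMap.id ℝ E) x :=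
    ((hasFDerivAt_id x).sub_const c).const_smul _
  have h2 := ((hφ ((R c)⁻¹ • (x - c))).hasFDerivAt.comp x h1).const_smul (R c)
  refine h2.congr_fderiv ?_
  rw [ContinuousLinearMap.comp_smul, ContinuousLinearMap.comp_id, smul_smul,
    mul_inv_cancel₀ (hR c hc), one_smul]

omit [FiniteDimensional ℝ E] in
lemma mem_ball_of_smul_sub {c x : E} {s : ℝ} (hs : 0 < s) (h : s⁻¹ • (x - c) ∈ ball (0 : E) 1) :
    x ∈ closedBall c s := by
  rw [mem_ball_zero_iff, norm_smul, norm_inv, Real.norm_of_nonneg hs.le, inv_mul_lt_iff₀ hs,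
    mul_one] at h
  rw [mem_closedBall, dist_eq_norm]
  exact h.le

omit [FiniteDimensional ℝ E] in
lemma apply_sum_rescale {V : Type*} [AddCommMonoid V] {K : E → V} (hK : ∀ y, K y ≠ 0 → y ∈ ball (0 : E) 1)
    (hR : ∀ c ∈ t, 0 < R c) (hd : (t : Set E).PairwiseDisjoint fun c => closedBall c (R c))
    {W : Type*} [AddCommMonoid W] {F : V → W} (hF : F 0 = 0) (x : E) :
    F (∑ c ∈ t, K ((R c)⁻¹ • (x - c))) = ∑ c ∈ t, F (K ((R c)⁻¹ • (x - c))) := by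
  by_cases h : ∃ c ∈ t, K ((R c)⁻¹ • (x - c)) ≠ 0
  · obtain ⟨c, hc, hcK⟩ := h
    have hz : ∀ c' ∈ t, c' ≠ c → K ((R c')⁻¹ • (x - c')) = 0 := by
      intro c' hc' hne
      by_contra hK'
      exact Set.disjoint_left.1 (hd hc' hc hne) (mem_ball_of_smul_sub (hR c' hc') (hK _ hK'))
        (mem_ball_of_smul_sub (hR c hc) (hK _ hcK))
    rw [Finset.sum_eq_single_of_mem c hc hz,
      Finset.sum_eq_single_of_mem c hc fun c' hc' hne => by rw [hz c' hc' hne, hF]]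
  · push Not at h
    rw [Finset.sum_eq_zero h, hF, Finset.sum_eq_zero fun c hc => by rw [h c hc, hF]]

lemma integral_sum_rescale [MeasurableSpace E] [BorelSpace E] {μ : Measure E} [μ.IsAddHaarMeasure]
    {V : Type*} [AddCommMonoid V] {K : E → V}
    (hK : ∀ y, K y ≠ 0 → y ∈ ball (0 : E) 1)
    (hR : ∀ c ∈ t, 0 < R c) (hd : (t : Set E).PairwiseDisjoint fun c => closedBall c (R c))
    {F : V → ℝ} (hF : F 0 = 0) (h_int : Integrable (fun y => F (K y)) μ) :
    ∫ x, F (∑ c ∈ t, K ((R c)⁻¹ • (x - c))) ∂μ =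
      (∑ c ∈ t, R c ^ Module.finrank ℝ E) * ∫ y, F (K y) ∂μ := by
  simp only [apply_sum_rescale hK hR hd hF]
  rw [integral_finsetSum, Finset.sum_mul]
  · refine Finset.sum_congr rfl fun c hc => ?_
    rw [integral_sub_right_eq_self (fun x => F (K ((R c)⁻¹ • x))),
      Measure.integral_comp_inv_smul_of_nonneg μ (fun x => F (K x)) (hR c hc).le, smul_eq_mul]
  · intro c hc
    exact (h_int.comp_smul (inv_ne_zero (hR c hc).ne')).comp_sub_right c

end Rescaling

section MatrixEstimates

variable {n : ℕ}

lemma frob_eq_norm (X : Matrix (Fin n) (Fin n) ℝ) :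
    frob X = ‖(WithLp.toLp 2 fun ij : Fin n × Fin n => X ij.1 ij.2)‖ := by
  rw [EuclideanSpace.norm_eq, frob, frobSq, Fintype.sum_prod_type]
  simp

lemma frob_nonneg (X : Matrix (Fin n) (Fin n) ℝ) : 0 ≤ frob X := Real.sqrt_nonneg _

lemma frob_zero : frob (0 : Matrix (Fin n) (Fin n) ℝ) = 0 := by
  simp [frob, frobSq]

lemma frob_add_le (X Y : Matrix (Fin n) (Fin n) ℝ) : frob (X + Y) ≤ frob X + frob Y := by
  simp only [frob_eq_norm]
  exact norm_add_le (WithLp.toLp 2 fun ij : Fin n × Fin n => X ij.1 ij.2)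
    (WithLp.toLp 2 fun ij : Fin n × Fin n => Y ij.1 ij.2)

lemma abs_apply_le_frob (X : Matrix (Fin n) (Fin n) ℝ) (i j : Fin n) : |X i j| ≤ frob X := by
  rw [frob_eq_norm]
  exact PiLp.norm_apply_le (WithLp.toLp 2 fun ij : Fin n × Fin n => X ij.1 ij.2) (i, j)

lemma frob_le_sum (X : Matrix (Fin n) (Fin n) ℝ) : frob X ≤ ∑ ij : Fin n × Fin n, |X ij.1 ij.2| := by
  have h : frobSq X ≤ (∑ ij : Fin n × Fin n, |X ij.1 ij.2|) ^ 2 := by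
    rw [frobSq, ← Fintype.sum_prod_type' fun i j => X i j ^ 2]
    simp only [← sq_abs (X _ _)]
    exact Finset.sum_sq_le_sq_sum_of_nonneg fun _ _ => abs_nonneg _
  exact (Real.sqrt_le_sqrt h).trans (le_of_eq (Real.sqrt_sq (by positivity)))

lemma continuous_frob : Continuous (frob : Matrix (Fin n) (Fin n) ℝ → ℝ) := by
  unfold frob frobSq
  fun_prop

lemma frob_rpow_le {p : ℝ} (hp : 1 ≤ p) (X : Matrix (Fin n) (Fin n) ℝ) :
    frob X ^ p ≤ (Fintype.card (Fin n × Fin n) : ℝ) ^ (p - 1) *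
      ∑ ij : Fin n × Fin n, |X ij.1 ij.2| ^ p := by
  refine (Real.rpow_le_rpow (frob_nonneg X) (frob_le_sum X) (by linarith)).trans ?_
  have := abs_sum_rpow_le hp fun ij : Fin n × Fin n => |X ij.1 ij.2|
  rw [abs_of_nonneg (by positivity)] at this
  simpa using this

lemma frob_add_rpow_le {p : ℝ} (hp : 1 ≤ p) (X Y : Matrix (Fin n) (Fin n) ℝ) :
    frob (X + Y) ^ p ≤ 2 ^ p * (frob X ^ p + frob Y ^ p) := by
  have h := abs_add_rpow_le hp (frob X) (frob Y)
  rw [abs_of_nonneg (add_nonneg (frob_nonneg X) (frob_nonneg Y)), abs_of_nonneg (frob_nonneg X),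
    abs_of_nonneg (frob_nonneg Y)] at h
  exact (Real.rpow_le_rpow (frob_nonneg _) (frob_add_le X Y) (by linarith)).trans h

lemma trace_mdev (hn : n ≠ 0) (X : Matrix (Fin n) (Fin n) ℝ) : (mdev X).trace = 0 := by
  have : (n : ℝ) ≠ 0 := by exact_mod_cast hn
  simp [mdev, Matrix.trace_sub, Matrix.trace_smul, Matrix.trace_one]
  field_simp
  ring

lemma mdev_of_trace_eq_zero {X : Matrix (Fin n) (Fin n) ℝ} (hX : X.trace = 0) : mdev X = X := by
  simp [mdev, hX]

lemma mdev_add (X Y : Matrix (Fin n) (Fin n) ℝ) : mdev (X + Y) = mdev X + mdev Y := by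
  simp only [mdev, Matrix.trace_add, add_div, add_smul]
  abel

lemma mils_add (X Y : Matrix (Fin n) (Fin n) ℝ) : mils (X + Y) = mils X + mils Y := by
  simp only [mils, msym, Matrix.trace_add, add_div, add_smul, Matrix.transpose_add, smul_add]
  abel

lemma mils_mdev (hn : n ≠ 0) (X : Matrix (Fin n) (Fin n) ℝ) : mils (mdev X) = mils X := by
  rw [mils, trace_mdev hn, zero_div, zero_smul, sub_zero, mils, msym, msym, mdev,
    Matrix.transpose_sub, Matrix.transpose_smul, Matrix.transpose_one]
  module

lemma mdev_apply (X : Matrix (Fin n) (Fin n) ℝ) (i j : Fin n) :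
    mdev X i j = X i j - if i = j then X.trace / n else 0 := by
  simp [mdev, Matrix.one_apply]

lemma mils_apply (X : Matrix (Fin n) (Fin n) ℝ) (i j : Fin n) :
    mils X i j = 1 / 2 * (X i j + X j i) - if i = j then X.trace / n else 0 := by
  simp [mils, msym, Matrix.one_apply]
  ring

lemma continuous_mdev : Continuous (mdev : Matrix (Fin n) (Fin n) ℝ → _) := by
  unfold mdev
  fun_prop

lemma continuous_mils : Continuous (mils : Matrix (Fin n) (Fin n) ℝ → _) := by
  unfold mils msym
  fun_prop

/-- A weighted inequality absorbing the local Lipschitz term with growth of order `p - 1`. -/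
lemma exists_lipschitz_absorption {p : ℝ} (hp : 1 < p) {δ : ℝ} (hδ : 0 < δ) :
    ∃ C : ℝ, 0 ≤ C ∧ ∀ a z : ℝ, 0 ≤ a → 0 ≤ z →
      (1 + (a + z) ^ (p - 1) + a ^ (p - 1)) * z ≤ δ * (1 + a ^ p) + C * z ^ p := by
  have hs : 0 < p - 1 := by linarith
  set A : ℝ := (2 + 2 ^ (p - 1)) * 2 ^ p with hA
  have hA0 : 0 < A := by positivity
  set τ : ℝ := min 1 (δ / A) with hτ
  have hτ0 : 0 < τ := lt_min one_pos (by positivity)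
  have hτ1 : τ ≤ 1 := min_le_left _ _
  have hτA : A * τ ≤ δ := by
    have := min_le_right 1 (δ / A)
    rwa [le_div_iff₀ hA0, mul_comm] at this
  refine ⟨(2 + 2 ^ (p - 1)) * τ⁻¹ ^ (p - 1), by positivity, fun a z ha hz => ?_⟩
  have hpow : ∀ m : ℝ, 0 < m → m ^ (p - 1) * m = m ^ p := fun m hm => by
    rw [← Real.rpow_add_one hm.ne', sub_add_cancel]
  -- the left factor is controlled by any upper bound of `1 + a` and `z`
  have hfac : ∀ m : ℝ, 1 ≤ m → a ≤ m → z ≤ m →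
      1 + (a + z) ^ (p - 1) + a ^ (p - 1) ≤ (2 + 2 ^ (p - 1)) * m ^ (p - 1) := by
    intro m h1 h2 h3
    have e1 : 1 ≤ m ^ (p - 1) := Real.one_le_rpow h1 hs.le
    have e2 : a ^ (p - 1) ≤ m ^ (p - 1) := Real.rpow_le_rpow ha h2 hs.le
    have e3 : (a + z) ^ (p - 1) ≤ (2 * m) ^ (p - 1) :=
      Real.rpow_le_rpow (by positivity) (by linarith) hs.le
    rw [Real.mul_rpow (by norm_num) (by linarith)] at e3
    linarith
  by_cases h : z ≤ τ * (1 + a)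
  · have h1 := hfac (1 + a) (by linarith) (by linarith)
      (h.trans (mul_le_of_le_one_left (by linarith) hτ1))
    have h2 := mul_le_mul h1 h hz (by positivity)
    have h3 := abs_add_rpow_le hp.le 1 a
    rw [abs_of_nonneg (by linarith), abs_one, Real.one_rpow, abs_of_nonneg ha] at h3
    calc _ ≤ _ := h2
      _ = (2 + 2 ^ (p - 1)) * τ * ((1 + a) ^ (p - 1) * (1 + a)) := by ring
      _ = (2 + 2 ^ (p - 1)) * τ * (1 + a) ^ p := by rw [hpow _ (by linarith)]
      _ ≤ (2 + 2 ^ (p - 1)) * τ * (2 ^ p * (1 + a ^ p)) := by gcongr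
      _ = A * τ * (1 + a ^ p) := by rw [hA]; ring
      _ ≤ δ * (1 + a ^ p) := by gcongr
      _ ≤ _ := le_add_of_nonneg_right (by positivity)
  · push Not at h
    have hz0 : 0 < z := lt_of_le_of_lt (by positivity) h
    have h4 : 1 + a ≤ τ⁻¹ * z := by
      rw [inv_mul_eq_div, le_div_iff₀ hτ0, mul_comm]
      exact h.le
    have h1 := hfac (τ⁻¹ * z) (by linarith) (by linarith)
      (le_mul_of_one_le_left hz ((one_le_inv₀ hτ0).2 hτ1))
    calc _ ≤ _ := mul_le_mul_of_nonneg_right h1 hz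
      _ = (2 + 2 ^ (p - 1)) * τ⁻¹ ^ (p - 1) * (z ^ (p - 1) * z) := by
          rw [Real.mul_rpow (by positivity) hz]; ring
      _ = (2 + 2 ^ (p - 1)) * τ⁻¹ ^ (p - 1) * z ^ p := by rw [hpow _ hz0]
      _ ≤ _ := le_add_of_nonneg_left (by positivity)

end MatrixEstimates

section Gradient

open scoped SchwartzMap

variable {n : ℕ} {p : ℝ}

/-- The gradient matrix of a vector of Schwartz functions. -/
noncomputable def gradS (φ : Fin n → 𝓢(EuclideanSpace ℝ (Fin n), ℝ)) (y : EuclideanSpace ℝ (Fin n)) :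
    Matrix (Fin n) (Fin n) ℝ := fun i k => pd k (φ i) y

lemma trace_gradS (φ : Fin n → 𝓢(EuclideanSpace ℝ (Fin n), ℝ)) (y : EuclideanSpace ℝ (Fin n)) :
    (gradS φ y).trace = divS φ y := by
  rw [divS, _root_.sum_apply]
  rfl

lemma frob_schwartz_continuous (M : Fin n → Fin n → 𝓢(EuclideanSpace ℝ (Fin n), ℝ)) :
    Continuous fun y => frob (fun i j => M i j y : Matrix (Fin n) (Fin n) ℝ) :=
  continuous_frob.comp (continuous_pi fun i => continuous_pi fun j => (M i j).continuous)

lemma integrable_frob_rpow (hp : 1 < p) (M : Fin n → Fin n → 𝓢(EuclideanSpace ℝ (Fin n), ℝ)) :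
    Integrable fun y => frob (fun i j => M i j y : Matrix (Fin n) (Fin n) ℝ) ^ p := by
  have hi : Integrable fun y => (Fintype.card (Fin n × Fin n) : ℝ) ^ (p - 1) *
      ∑ ij : Fin n × Fin n, |M ij.1 ij.2 y| ^ p :=
    (integrable_finsetSum _ fun ij _ => (M ij.1 ij.2).integrable_abs_rpow hp).const_mul _
  refine hi.mono' ?_ (Eventually.of_forall fun y => ?_)
  · exact ((frob_schwartz_continuous M).rpow_const
      fun _ => Or.inr (by linarith)).aestronglyMeasurable
  · have h := frob_rpow_le hp.le (fun i j => M i j y : Matrix (Fin n) (Fin n) ℝ)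
    exact (Real.norm_of_nonneg (Real.rpow_nonneg (frob_nonneg _) _)).trans_le h

lemma integral_frob_rpow_le (hp : 1 < p) (M : Fin n → Fin n → 𝓢(EuclideanSpace ℝ (Fin n), ℝ)) :
    ∫ y, frob (fun i j => M i j y : Matrix (Fin n) (Fin n) ℝ) ^ p ≤
      (Fintype.card (Fin n × Fin n) : ℝ) ^ (p - 1) *
        ∑ ij : Fin n × Fin n, ∫ y, |M ij.1 ij.2 y| ^ p := by
  rw [← integral_finsetSum _ fun ij _ => (M ij.1 ij.2).integrable_abs_rpow hp,
    ← integral_const_mul]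
  exact integral_mono (integrable_frob_rpow hp M)
    ((integrable_finsetSum _ fun ij _ => (M ij.1 ij.2).integrable_abs_rpow hp).const_mul _)
    fun y => frob_rpow_le hp.le _

lemma exists_const_frob_rpow_le (hp : 1 < p) {X : Type*}
    {M : X → Fin n → Fin n → 𝓢(EuclideanSpace ℝ (Fin n), ℝ)} {T : X → ℝ}
    (hM : ∀ i j, LpBdd p (fun x => M x i j) T) :
    ∃ C : ℝ, 0 ≤ C ∧ ∀ x, ∫ y, frob (fun i j => M x i j y : Matrix (Fin n) (Fin n) ℝ) ^ p ≤
      C * T x := by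
  choose C hC H using fun ij : Fin n × Fin n => hM ij.1 ij.2
  refine ⟨(Fintype.card (Fin n × Fin n) : ℝ) ^ (p - 1) * ∑ ij, C ij,
    mul_nonneg (by positivity) (Finset.sum_nonneg fun ij _ => hC ij), fun x => ?_⟩
  refine (integral_frob_rpow_le hp (M x)).trans ?_
  rw [mul_assoc, Finset.sum_mul]
  gcongr with ij
  exact H ij x

variable (hn : n ≠ 0) (hp : 1 < p)
include hn hp

lemma exists_divS_eq_zero_frob_approx (η : 𝓢(EuclideanSpace ℝ (Fin n), ℝ)) :
    ∃ C : ℝ, 0 ≤ C ∧ ∀ φ : Fin n → 𝓢(EuclideanSpace ℝ (Fin n), ℝ),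
      (∀ i, mulS η (φ i) = φ i) →
      ∃ ψ : Fin n → 𝓢(EuclideanSpace ℝ (Fin n), ℝ), (∀ i, tsupport (ψ i) ⊆ tsupport η) ∧
        divS ψ = 0 ∧ Integrable (fun y => frob (gradS ψ y - mdev (gradS φ y)) ^ p) ∧
        ∫ y, frob (gradS ψ y - mdev (gradS φ y)) ^ p ≤
          C * ((∫ y, |divS φ y| ^ p) + ∑ i, ∫ y, |φ i y| ^ p) := by
  obtain ⟨C, hC, H⟩ := exists_divS_eq_zero_approx hn hp η
  choose ψ hψ using fun φ : {φ : Fin n → 𝓢(EuclideanSpace ℝ (Fin n), ℝ) //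
    ∀ i, mulS η (φ i) = φ i} => H φ.1 φ.2
  have h0 : ∀ φ : Fin n → 𝓢(EuclideanSpace ℝ (Fin n), ℝ), 0 ≤ ∑ i, ∫ y, |φ i y| ^ p :=
    fun φ => by positivity
  have hM : ∀ i k : Fin n, LpBdd p (fun φ : {φ : Fin n → 𝓢(EuclideanSpace ℝ (Fin n), ℝ) //
    ∀ i, mulS η (φ i) = φ i} => (if i = k then (1 / n : ℝ) else 0) • divS φ.1 -
      pd k (φ.1 i - ψ φ i)) (fun φ => (∫ y, |divS φ.1 y| ^ p) + ∑ i, ∫ y, |φ.1 i y| ^ p) := by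
    intro i k
    have a1 : LpBdd p (fun φ : {φ : Fin n → 𝓢(EuclideanSpace ℝ (Fin n), ℝ) //
      ∀ i, mulS η (φ i) = φ i} => divS φ.1)
      (fun φ => (∫ y, |divS φ.1 y| ^ p) + ∑ i, ∫ y, |φ.1 i y| ^ p) :=
      (LpBdd.refl p _).mono fun φ => le_add_of_nonneg_right (h0 φ.1)
    exact (a1.const_smul _).sub hp ⟨C, hC, fun φ => (hψ φ).2.2 i k⟩
  obtain ⟨C', hC', H'⟩ := exists_const_frob_rpow_le hp hM
  have hform : ∀ (φ : {φ : Fin n → 𝓢(EuclideanSpace ℝ (Fin n), ℝ) //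
      ∀ i, mulS η (φ i) = φ i}) (y : EuclideanSpace ℝ (Fin n)),
      gradS (ψ φ) y - mdev (gradS φ.1 y) = fun i k =>
        ((if i = k then (1 / n : ℝ) else 0) • divS φ.1 - pd k (φ.1 i - ψ φ i)) y := by
    intro φ y
    ext i k
    rw [Matrix.sub_apply, mdev_apply, trace_gradS, map_sub]
    simp only [_root_.sub_apply, _root_.smul_apply, smul_eq_mul, gradS]
    split_ifs <;> ring
  refine ⟨C', hC', fun φ hφ => ⟨ψ ⟨φ, hφ⟩, (hψ ⟨φ, hφ⟩).1, (hψ ⟨φ, hφ⟩).2.1, ?_, ?_⟩⟩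
  · simp only [hform ⟨φ, hφ⟩]
    exact integrable_frob_rpow hp _
  · simp only [hform ⟨φ, hφ⟩]
    exact H' ⟨φ, hφ⟩

lemma exists_korn_const_frob : ∃ C : ℝ, 0 ≤ C ∧
    ∀ φ : Fin n → 𝓢(EuclideanSpace ℝ (Fin n), ℝ),
      Integrable (fun y => frob (mdev (gradS φ y)) ^ p) ∧
      ∫ y, frob (mdev (gradS φ y)) ^ p ≤
      C * ((∫ y, frob (mils (gradS φ y)) ^ p) + (∫ y, |divS φ y| ^ p) +
        ∑ i, ∫ y, |φ i y| ^ p) := by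
  obtain ⟨C, hC, H⟩ := exists_korn_const hn hp
  set T : (Fin n → 𝓢(EuclideanSpace ℝ (Fin n), ℝ)) → ℝ := fun φ =>
    (∫ y, frob (mils (gradS φ y)) ^ p) + (∫ y, |divS φ y| ^ p) + ∑ i, ∫ y, |φ i y| ^ p with hT
  have h1 : ∀ φ : Fin n → 𝓢(EuclideanSpace ℝ (Fin n), ℝ),
      0 ≤ ∫ y, frob (mils (gradS φ y)) ^ p := fun φ =>
    integral_nonneg fun y => Real.rpow_nonneg (frob_nonneg _) _
  have h2 : ∀ φ : Fin n → 𝓢(EuclideanSpace ℝ (Fin n), ℝ), 0 ≤ ∫ y, |divS φ y| ^ p :=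
    fun φ => by positivity
  have h3 : ∀ φ : Fin n → 𝓢(EuclideanSpace ℝ (Fin n), ℝ), 0 ≤ ∑ i, ∫ y, |φ i y| ^ p :=
    fun φ => by positivity
  have adiv : LpBdd p (fun φ : Fin n → 𝓢(EuclideanSpace ℝ (Fin n), ℝ) => divS φ) T :=
    (LpBdd.refl p _).mono fun φ => by
      have := h1 φ
      have := h3 φ
      simp only [hT]
      linarith
  have amils : ∀ i j : Fin n, LpBdd p (fun φ : Fin n → 𝓢(EuclideanSpace ℝ (Fin n), ℝ) =>
      symS φ i j - (if i = j then (1 / n : ℝ) else 0) • divS φ) T := by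
    intro i j
    refine ⟨1, zero_le_one, fun φ => ?_⟩
    have hform : ∀ y, mils (gradS φ y) = fun i j =>
        (symS φ i j - (if i = j then (1 / n : ℝ) else 0) • divS φ) y := by
      intro y
      ext i j
      rw [mils_apply, trace_gradS]
      simp only [_root_.sub_apply, _root_.smul_apply, _root_.add_apply, smul_eq_mul, gradS, symS]
      split_ifs <;> ring
    have hle : ∫ y, |(symS φ i j - (if i = j then (1 / n : ℝ) else 0) • divS φ) y| ^ p ≤
        ∫ y, frob (mils (gradS φ y)) ^ p := by
      refine integral_mono (SchwartzMap.integrable_abs_rpow hp _) ?_ fun y => ?_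
      · simp only [hform]
        exact integrable_frob_rpow hp _
      · have h := abs_apply_le_frob (mils (gradS φ y)) i j
        simp only [hform y] at h ⊢
        exact Real.rpow_le_rpow (abs_nonneg _) h (by linarith)
    have := h2 φ
    have := h3 φ
    simp only [hT]
    linarith
  have asym : ∀ i j : Fin n, LpBdd p (fun φ : Fin n → 𝓢(EuclideanSpace ℝ (Fin n), ℝ) =>
      symS φ i j) T := by
    intro i j
    simpa using (amils i j).add hp (adiv.const_smul (if i = j then (1 / n : ℝ) else 0))
  choose A hA HA using fun ij : Fin n × Fin n => asym ij.1 ij.2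
  have apd : ∀ i k : Fin n, LpBdd p (fun φ : Fin n → 𝓢(EuclideanSpace ℝ (Fin n), ℝ) =>
      pd k (φ i)) T := by
    intro i k
    have hA0 : 0 ≤ ∑ i, ∑ j, A (i, j) :=
      Finset.sum_nonneg fun i _ => Finset.sum_nonneg fun j _ => hA (i, j)
    refine ⟨C * ((∑ i, ∑ j, A (i, j)) + 1), by positivity, fun φ => (H φ i k).trans ?_⟩
    rw [mul_assoc]
    refine mul_le_mul_of_nonneg_left ?_ hC
    rw [add_mul, one_mul]
    refine add_le_add ?_ ?_
    · simp only [Finset.sum_mul]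
      exact Finset.sum_le_sum fun i _ => Finset.sum_le_sum fun j _ => HA (i, j) φ
    · have := h1 φ
      have := h2 φ
      simp only [hT]
      linarith
  have hM : ∀ i k : Fin n, LpBdd p (fun φ : Fin n → 𝓢(EuclideanSpace ℝ (Fin n), ℝ) =>
      pd k (φ i) - (if i = k then (1 / n : ℝ) else 0) • divS φ) T := fun i k =>
    (apd i k).sub hp (adiv.const_smul _)
  obtain ⟨C', hC', H'⟩ := exists_const_frob_rpow_le hp hM
  have hform : ∀ (φ : Fin n → 𝓢(EuclideanSpace ℝ (Fin n), ℝ)) (y : EuclideanSpace ℝ (Fin n)),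
      mdev (gradS φ y) = fun i k =>
        (pd k (φ i) - (if i = k then (1 / n : ℝ) else 0) • divS φ) y := by
    intro φ y
    ext i k
    rw [mdev_apply, trace_gradS]
    simp only [_root_.sub_apply, _root_.smul_apply, smul_eq_mul, gradS]
    split_ifs <;> ring
  refine ⟨C', hC', fun φ => ⟨?_, ?_⟩⟩
  · simp only [hform φ]
    exact integrable_frob_rpow hp _
  · have := H' φ
    simp only [hform φ]
    exact this

end Gradient

section Fields

open scoped SchwartzMap
open Metric

variable {n : ℕ}

/-- Smooth vector fields with compact support in the open unit ball. -/
structure IsTestField (φ : EuclideanSpace ℝ (Fin n) → EuclideanSpace ℝ (Fin n)) : Prop where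
  contDiff : ContDiff ℝ (⊤ : ℕ∞) φ
  hasCompactSupport : HasCompactSupport φ
  tsupport_subset : tsupport φ ⊆ ball 0 1

lemma exists_schwartz_components {φ : EuclideanSpace ℝ (Fin n) → EuclideanSpace ℝ (Fin n)}
    (hφ : ContDiff ℝ (⊤ : ℕ∞) φ) (hc : HasCompactSupport φ) :
    ∃ φS : Fin n → 𝓢(EuclideanSpace ℝ (Fin n), ℝ), (∀ i x, φS i x = φ x i) ∧
      ∀ x, gradS φS x = jac φ x := by
  have h1 : ∀ i, HasCompactSupport fun x => φ x i := fun i =>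
    hc.comp_left (g := fun v : EuclideanSpace ℝ (Fin n) => v i) rfl
  have h2 : ∀ i, ContDiff ℝ (⊤ : ℕ∞) fun x => φ x i := fun i => by fun_prop
  refine ⟨fun i => (h1 i).toSchwartzMap (h2 i), fun i x => rfl, fun x => ?_⟩
  ext i k
  have h3 : HasFDerivAt (fun x => φ x i)
      ((EuclideanSpace.proj i : EuclideanSpace ℝ (Fin n) →L[ℝ] ℝ).comp (fderiv ℝ φ x)) x :=
    (EuclideanSpace.proj i : EuclideanSpace ℝ (Fin n) →L[ℝ] ℝ).hasFDerivAt.comp x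
      ((hφ.differentiable (by simp)) x).hasFDerivAt
  rw [gradS, pd_apply]
  change fderiv ℝ (fun x => φ x i) x _ = _
  rw [h3.fderiv]
  rfl

lemma exists_field_of_schwartz (ψ : Fin n → 𝓢(EuclideanSpace ℝ (Fin n), ℝ))
    {S : Set (EuclideanSpace ℝ (Fin n))} (hS : IsClosed S) (hψ : ∀ i, tsupport (ψ i) ⊆ S) :
    ∃ u : EuclideanSpace ℝ (Fin n) → EuclideanSpace ℝ (Fin n), ContDiff ℝ (⊤ : ℕ∞) u ∧
      tsupport u ⊆ S ∧ ∀ x, jac u x = gradS ψ x := by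
  have hu : ContDiff ℝ (⊤ : ℕ∞) fun x => (WithLp.toLp 2 fun i => ψ i x : EuclideanSpace ℝ (Fin n)) :=
    contDiff_euclidean.2 fun i => (ψ i).smooth _
  refine ⟨_, hu, closure_minimal (fun x hx => ?_) hS, fun x => ?_⟩
  · by_contra hxS
    refine hx ?_
    ext i
    exact image_eq_zero_of_notMem_tsupport (f := ψ i) fun h => hxS (hψ i h)
  · ext i k
    have h3 := (EuclideanSpace.proj i : EuclideanSpace ℝ (Fin n) →L[ℝ] ℝ).hasFDerivAt.comp x
      ((hu.differentiable (by simp)) x).hasFDerivAt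
    rw [gradS, pd_apply]
    change _ = fderiv ℝ (fun x => ψ i x) x _
    erw [h3.fderiv]
    rfl

lemma exists_schwartz_cutoff {ρ : ℝ} (hρ : 0 < ρ) (hρ1 : ρ < 1) :
    ∃ η : 𝓢(EuclideanSpace ℝ (Fin n), ℝ), (∀ x ∈ closedBall 0 ρ, η x = 1) ∧
      IsCompact (tsupport η) ∧ tsupport η ⊆ ball 0 1 := by
  let χ : ContDiffBump (0 : EuclideanSpace ℝ (Fin n)) := ⟨ρ, (1 + ρ) / 2, hρ, by linarith⟩
  refine ⟨χ.hasCompactSupport.toSchwartzMap χ.contDiff, fun x hx => χ.one_of_mem_closedBall hx,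
    χ.hasCompactSupport, ?_⟩
  change tsupport χ ⊆ _
  rw [χ.tsupport_eq]
  exact closedBall_subset_ball (by change (1 + ρ) / 2 < 1; linarith)

lemma jac_rescale {φ : EuclideanSpace ℝ (Fin n) → EuclideanSpace ℝ (Fin n)}
    (hφ : Differentiable ℝ φ) {t : Finset (EuclideanSpace ℝ (Fin n))}
    {R : EuclideanSpace ℝ (Fin n) → ℝ} (hR : ∀ c ∈ t, 0 < R c) (x : EuclideanSpace ℝ (Fin n)) :
    jac (rescale t R φ) x = ∑ c ∈ t, jac φ ((R c)⁻¹ • (x - c)) := by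
  ext i j
  rw [jac, fderiv_rescale hφ fun c hc => (hR c hc).ne', Matrix.sum_apply,
    _root_.sum_apply]
  simp [jac]

namespace IsTestField

variable {φ : EuclideanSpace ℝ (Fin n) → EuclideanSpace ℝ (Fin n)} (hφ : IsTestField φ)
include hφ

lemma continuous_jac : Continuous (jac φ) := by
  have := hφ.contDiff.continuous_fderiv (by simp)
  refine continuous_pi fun i => continuous_pi fun j => ?_
  unfold jac
  fun_prop

lemma mem_ball_of_ne_zero {y : EuclideanSpace ℝ (Fin n)} (hy : φ y ≠ 0) : y ∈ ball 0 1 :=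
  hφ.tsupport_subset (subset_tsupport _ hy)

lemma jac_eq_zero {y : EuclideanSpace ℝ (Fin n)} (hy : y ∉ tsupport φ) : jac φ y = 0 := by
  ext i j
  have : fderiv ℝ φ y = 0 := image_eq_zero_of_notMem_tsupport fun h =>
    hy (tsupport_fderiv_subset ℝ h)
  simp [jac, this]

lemma mem_ball_of_jac_ne_zero {y : EuclideanSpace ℝ (Fin n)} (hy : jac φ y ≠ 0) : y ∈ ball 0 1 :=
  hφ.tsupport_subset (by_contra fun h => hy (hφ.jac_eq_zero h))

lemma hasCompactSupport_comp_jac {G : Matrix (Fin n) (Fin n) ℝ → ℝ} (hG0 : G 0 = 0) :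
    HasCompactSupport fun y => G (jac φ y) :=
  HasCompactSupport.intro hφ.hasCompactSupport fun y hy => by rw [hφ.jac_eq_zero hy, hG0]

lemma integrable_comp_jac {G : Matrix (Fin n) (Fin n) ℝ → ℝ} (hG : Continuous G) (hG0 : G 0 = 0) :
    Integrable fun y => G (jac φ y) :=
  (hG.comp hφ.continuous_jac).integrable_of_hasCompactSupport (hφ.hasCompactSupport_comp_jac hG0)

lemma integrableOn_comp_jac {G : Matrix (Fin n) (Fin n) ℝ → ℝ} (hG : Continuous G) :
    IntegrableOn (fun y => G (jac φ y)) (ball 0 1) := by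
  have h1 := hφ.integrable_comp_jac (G := fun X => G X - G 0) (hG.sub continuous_const) (sub_self _)
  have h2 : IntegrableOn (fun _ => G 0) (ball (0 : EuclideanSpace ℝ (Fin n)) 1) :=
    integrableOn_const measure_ball_lt_top.ne
  exact (h1.integrableOn.add h2).congr (Eventually.of_forall fun y => by simp)

lemma setIntegral_comp_jac {G : Matrix (Fin n) (Fin n) ℝ → ℝ} (hG0 : G 0 = 0) :
    ∫ y in ball (0 : EuclideanSpace ℝ (Fin n)) 1, G (jac φ y) = ∫ y, G (jac φ y) :=
  setIntegral_eq_integral_of_forall_compl_eq_zero fun y hy => by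
    rw [hφ.jac_eq_zero fun h => hy (hφ.tsupport_subset h), hG0]

lemma setIntegral_comp_jac_eq_add {G : Matrix (Fin n) (Fin n) ℝ → ℝ} (hG : Continuous G) :
    ∫ y in ball (0 : EuclideanSpace ℝ (Fin n)) 1, G (jac φ y) =
      (volume (ball (0 : EuclideanSpace ℝ (Fin n)) 1)).toReal * G 0 +
        ∫ y, (G (jac φ y) - G 0) := by
  rw [← hφ.setIntegral_comp_jac (G := fun X => G X - G 0) (sub_self _),
    integral_sub (hφ.integrableOn_comp_jac hG) (integrableOn_const measure_ball_lt_top.ne),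
    setIntegral_const]
  simp [Measure.real]

section Rescale

variable {t : Finset (EuclideanSpace ℝ (Fin n))} {R : EuclideanSpace ℝ (Fin n) → ℝ}
  (hR : ∀ c ∈ t, 0 < R c) (hd : (t : Set _).PairwiseDisjoint fun c => closedBall c (R c))
include hR

lemma support_rescale_subset {ρ : ℝ} (hsub : ∀ c ∈ t, closedBall c (R c) ⊆ ball 0 ρ) :
    tsupport (rescale t R φ) ⊆ closedBall 0 ρ := by
  refine closure_minimal (fun x hx => ?_) isClosed_closedBall
  obtain ⟨c, hc, h⟩ := Finset.exists_ne_zero_of_sum_ne_zero hx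
  have h' : φ ((R c)⁻¹ • (x - c)) ≠ 0 := fun h0 => h (by rw [h0, smul_zero])
  exact ball_subset_closedBall
    (hsub c hc (mem_ball_of_smul_sub (hR c hc) (hφ.mem_ball_of_ne_zero h')))

lemma rescale {ρ : ℝ} (hρ : ρ < 1) (hsub : ∀ c ∈ t, closedBall c (R c) ⊆ ball 0 ρ) :
    IsTestField (rescale t R φ) where
  contDiff := contDiff_rescale hφ.contDiff
  hasCompactSupport := (isCompact_closedBall _ _).of_isClosed_subset (isClosed_tsupport _)
    (hφ.support_rescale_subset hR hsub)
  tsupport_subset := (hφ.support_rescale_subset hR hsub).trans (closedBall_subset_ball hρ)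

include hd

lemma integral_comp_jac_rescale {G : Matrix (Fin n) (Fin n) ℝ → ℝ} (hG : Continuous G)
    (hG0 : G 0 = 0) :
    ∫ y, G (jac (_root_.rescale t R φ) y) = (∑ c ∈ t, R c ^ n) * ∫ y, G (jac φ y) := by
  simp only [jac_rescale (hφ.contDiff.differentiable (by simp)) hR]
  have := integral_sum_rescale (μ := volume) (fun y hy => hφ.mem_ball_of_jac_ne_zero hy) hR hd hG0
    (hφ.integrable_comp_jac hG hG0)
  rwa [finrank_euclideanSpace_fin] at this

lemma integral_norm_rescale_rpow_le {p r : ℝ} (hp : 1 < p) (hr : ∀ c ∈ t, R c ≤ r)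
    (h1 : ∑ c ∈ t, R c ^ n ≤ 1) (hr0 : 0 ≤ r) :
    ∫ y, ‖_root_.rescale t R φ y‖ ^ p ≤ r ^ p * ∫ y, ‖φ y‖ ^ p := by
  have hp0 : p ≠ 0 := by linarith
  have hcont := hφ.contDiff.continuous
  have h_int : Integrable fun y => ‖φ y‖ ^ p := by
    refine Continuous.integrable_of_hasCompactSupport
      (hcont.norm.rpow_const fun _ => Or.inr (by linarith)) ?_
    exact hφ.hasCompactSupport.comp_left (g := fun v => ‖v‖ ^ p) (by simp [hp0])
  have key := integral_sum_rescale (μ := volume) (F := fun v => ‖v‖ ^ p)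
    (fun y hy => hφ.mem_ball_of_ne_zero hy) hR hd (by simp [hp0]) h_int
  rw [finrank_euclideanSpace_fin] at key
  have hcs : HasCompactSupport fun x => ∑ c ∈ t, φ ((R c)⁻¹ • (x - c)) := by
    refine HasCompactSupport.intro (K := ⋃ c ∈ t, closedBall c (R c))
      (t.isCompact_biUnion fun c _ => isCompact_closedBall _ _) fun x hx => ?_
    refine Finset.sum_eq_zero fun c hc => by_contra fun h => hx ?_
    exact Set.mem_biUnion hc (mem_ball_of_smul_sub (hR c hc) (hφ.mem_ball_of_ne_zero h))
  have h_int' : Integrable fun x => ‖∑ c ∈ t, φ ((R c)⁻¹ • (x - c))‖ ^ p := by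
    refine Continuous.integrable_of_hasCompactSupport
      (Continuous.rpow_const (by fun_prop) fun _ => Or.inr (by linarith)) ?_
    exact hcs.comp_left (g := fun v => ‖v‖ ^ p) (by simp [hp0])
  have hpt : ∀ x, ‖_root_.rescale t R φ x‖ ^ p ≤
      r ^ p * ‖∑ c ∈ t, φ ((R c)⁻¹ • (x - c))‖ ^ p := by
    intro x
    rw [← Real.mul_rpow hr0 (norm_nonneg _)]
    refine Real.rpow_le_rpow (norm_nonneg _) ?_ (by linarith)
    rw [apply_sum_rescale (fun y hy => hφ.mem_ball_of_ne_zero hy) hR hd (F := fun v => ‖v‖)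
      norm_zero, Finset.mul_sum]
    refine norm_sum_le_of_le _ fun c hc => ?_
    rw [norm_smul, Real.norm_of_nonneg (hR c hc).le]
    exact mul_le_mul_of_nonneg_right (hr c hc) (norm_nonneg _)
  calc _ ≤ ∫ x, r ^ p * ‖∑ c ∈ t, φ ((R c)⁻¹ • (x - c))‖ ^ p :=
        integral_mono_of_nonneg (Eventually.of_forall fun x => by positivity)
          (h_int'.const_mul _) (Eventually.of_forall hpt)
    _ = r ^ p * ((∑ c ∈ t, R c ^ n) * ∫ y, ‖φ y‖ ^ p) := by rw [integral_const_mul, key]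
    _ ≤ r ^ p * (1 * ∫ y, ‖φ y‖ ^ p) := by gcongr
    _ = _ := by rw [one_mul]

end Rescale

lemma integral_trace_jac : ∫ y, (jac φ y).trace = 0 := by
  obtain ⟨φS, -, h2⟩ := exists_schwartz_components hφ.contDiff hφ.hasCompactSupport
  have hpd : ∀ i, ∫ y, pd i (φS i) y = 0 := fun i => by
    have h := integral_mul_fderiv_eq_neg_fderiv_mul_of_integrable (μ := volume)
      (f := fun _ : EuclideanSpace ℝ (Fin n) => (1 : ℝ)) (g := φS i)
      (v := EuclideanSpace.single i 1) (by simp)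
      (by simpa only [one_mul, ← pd_apply] using (pd i (φS i)).integrable)
      (by simpa only [one_mul] using (φS i).integrable) (fun _ _ => differentiableAt_const _)
      (fun x _ => (φS i).differentiableAt)
    simpa [← pd_apply] using h
  simp only [← h2, trace_gradS, divS, _root_.sum_apply]
  rw [integral_finsetSum _ fun i _ => (pd i (φS i)).integrable]
  exact Finset.sum_eq_zero fun i _ => hpd i

end IsTestField

end Fields

section Relaxation

open scoped SchwartzMap
open Metric

variable {n : ℕ} {p : ℝ}

lemma sum_integral_component_le (hp : 1 < p)
    {φ : EuclideanSpace ℝ (Fin n) → EuclideanSpace ℝ (Fin n)} (hφ : IsTestField φ) :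
    ∑ i, ∫ y, |φ y i| ^ p ≤ n * ∫ y, ‖φ y‖ ^ p := by
  have h_int : Integrable fun y => ‖φ y‖ ^ p := by
    refine Continuous.integrable_of_hasCompactSupport
      (hφ.contDiff.continuous.norm.rpow_const fun _ => Or.inr (by linarith)) ?_
    exact hφ.hasCompactSupport.comp_left (g := fun v => ‖v‖ ^ p)
      (by simp [show p ≠ 0 by linarith])
  have h : ∀ i, ∫ y, |φ y i| ^ p ≤ ∫ y, ‖φ y‖ ^ p := fun i =>
    integral_mono_of_nonneg (Eventually.of_forall fun y => by positivity) h_int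
      (Eventually.of_forall fun y =>
        Real.rpow_le_rpow (abs_nonneg _) (PiLp.norm_apply_le (φ y) i) (by linarith))
  calc _ ≤ ∑ _i : Fin n, ∫ y, ‖φ y‖ ^ p := Finset.sum_le_sum fun i _ => h i
    _ = _ := by simp

lemma continuous_trace_rpow (hp : 1 < p) :
    Continuous fun X : Matrix (Fin n) (Fin n) ℝ => |X.trace| ^ p :=
  (continuous_abs.comp (by fun_prop)).rpow_const fun _ => Or.inr (by linarith)

lemma continuous_frob_rpow (hp : 1 < p) :
    Continuous fun X : Matrix (Fin n) (Fin n) ℝ => frob X ^ p :=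
  continuous_frob.rpow_const fun _ => Or.inr (by linarith)

lemma mdev_zero : mdev (0 : Matrix (Fin n) (Fin n) ℝ) = 0 := by simp [mdev]

lemma mils_zero : mils (0 : Matrix (Fin n) (Fin n) ℝ) = 0 := by simp [mils, msym]

/-- Korn's inequality for test fields, with a lower order term. -/
lemma exists_korn_const_testField (hn : n ≠ 0) (hp : 1 < p) :
    ∃ C : ℝ, 0 ≤ C ∧ ∀ φ : EuclideanSpace ℝ (Fin n) → EuclideanSpace ℝ (Fin n), IsTestField φ →
      ∫ y, frob (mdev (jac φ y)) ^ p ≤ C * ((∫ y, frob (mils (jac φ y)) ^ p) +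
        (∫ y, |(jac φ y).trace| ^ p) + n * ∫ y, ‖φ y‖ ^ p) := by
  obtain ⟨C, hC, H⟩ := exists_korn_const_frob hn hp
  refine ⟨C, hC, fun φ hφ => ?_⟩
  obtain ⟨φS, h1, h2⟩ := exists_schwartz_components hφ.contDiff hφ.hasCompactSupport
  have h := (H φS).2
  simp only [← trace_gradS, h2, h1] at h
  refine h.trans (mul_le_mul_of_nonneg_left ?_ hC)
  gcongr
  exact sum_integral_component_le hp hφ

/-- Test fields are close to divergence free ones when their divergence is small. -/
lemma exists_div_free_testField (hn : n ≠ 0) (hp : 1 < p) {ρ : ℝ} (hρ : 0 < ρ) (hρ1 : ρ < 1) :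
    ∃ C : ℝ, 0 ≤ C ∧ ∀ φ : EuclideanSpace ℝ (Fin n) → EuclideanSpace ℝ (Fin n), IsTestField φ →
      tsupport φ ⊆ closedBall 0 ρ → ∃ ψ : EuclideanSpace ℝ (Fin n) → EuclideanSpace ℝ (Fin n),
        IsTestField ψ ∧ (∀ y, (jac ψ y).trace = 0) ∧
        Integrable (fun y => frob (jac ψ y - mdev (jac φ y)) ^ p) ∧
        ∫ y, frob (jac ψ y - mdev (jac φ y)) ^ p ≤
          C * ((∫ y, |(jac φ y).trace| ^ p) + n * ∫ y, ‖φ y‖ ^ p) := by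
  obtain ⟨η, hη1, hηc, hηB⟩ := exists_schwartz_cutoff (n := n) hρ hρ1
  obtain ⟨C, hC, H⟩ := exists_divS_eq_zero_frob_approx hn hp η
  refine ⟨C, hC, fun φ hφ hsupp => ?_⟩
  obtain ⟨φS, h1, h2⟩ := exists_schwartz_components hφ.contDiff hφ.hasCompactSupport
  obtain ⟨ψ, hψ1, hψ2, hψ3, hψ4⟩ := H φS fun i => by
    ext x
    rw [mulS_apply, h1]
    by_cases hx : x ∈ tsupport φ
    · rw [hη1 x (hsupp hx), one_mul]
    · rw [image_eq_zero_of_notMem_tsupport hx]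
      simp
  obtain ⟨u, hu1, hu2, hu3⟩ := exists_field_of_schwartz ψ (isClosed_tsupport η) hψ1
  simp only [← trace_gradS, h2, ← hu3, h1] at hψ3 hψ4
  refine ⟨u, ⟨hu1, hηc.of_isClosed_subset (isClosed_tsupport _) hu2, hu2.trans hηB⟩, fun y => ?_,
    hψ3, hψ4.trans (mul_le_mul_of_nonneg_left ?_ hC)⟩
  · rw [hu3, trace_gradS, hψ2]
    rfl
  · gcongr
    exact sum_integral_component_le hp hφ

lemma volume_ball_pos : 0 < (volume (ball (0 : EuclideanSpace ℝ (Fin n)) 1)).toReal :=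
  ENNReal.toReal_pos (measure_ball_pos _ _ one_pos).ne' measure_ball_lt_top.ne

variable {α β : ℝ} {f : Matrix (Fin n) (Fin n) ℝ → ℝ}

/-- The density `f` may be evaluated at a nearby field at the cost of a small multiple of the energy
and a large multiple of the `p`-th power of the distance. -/
lemma exists_setIntegral_le_add (hn : n ≠ 0) (hp : 1 < p) (hβ : 0 < β)
    (hfc : ContinuousOn f { X : Matrix (Fin n) (Fin n) ℝ | X.trace = 0 })
    (hlip : ∀ X Y : Matrix (Fin n) (Fin n) ℝ, X.trace = 0 → Y.trace = 0 →
      |f X - f Y| ≤ β * (1 + frob X ^ (p - 1) + frob Y ^ (p - 1)) * frob (X - Y))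
    {X₀ : Matrix (Fin n) (Fin n) ℝ} (hX₀ : X₀.trace = 0) {δ : ℝ} (hδ : 0 < δ) :
    ∃ C : ℝ, 0 ≤ C ∧ ∀ φ ψ : EuclideanSpace ℝ (Fin n) → EuclideanSpace ℝ (Fin n), IsTestField φ →
      IsTestField ψ → (∀ y, (jac ψ y).trace = 0) →
      Integrable (fun y => frob (jac ψ y - mdev (jac φ y)) ^ p) →
      ∫ y in ball (0 : EuclideanSpace ℝ (Fin n)) 1, f (X₀ + jac ψ y) ≤
        (∫ y in ball (0 : EuclideanSpace ℝ (Fin n)) 1, f (X₀ + mdev (jac φ y))) +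
        β * (δ * ((volume (ball (0 : EuclideanSpace ℝ (Fin n)) 1)).toReal +
          ∫ y in ball (0 : EuclideanSpace ℝ (Fin n)) 1, frob (X₀ + mdev (jac φ y)) ^ p) +
          C * ∫ y, frob (jac ψ y - mdev (jac φ y)) ^ p) := by
  obtain ⟨C, hC, H⟩ := exists_lipschitz_absorption hp hδ
  refine ⟨C, hC, fun φ ψ hφ hψ hdiv h_int => ?_⟩
  have hF : Continuous fun X : Matrix (Fin n) (Fin n) ℝ => f (X₀ + mdev X) :=
    hfc.comp_continuous (continuous_const.add continuous_mdev) fun X => by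
      change (X₀ + mdev X).trace = 0
      rw [Matrix.trace_add, hX₀, trace_mdev hn, add_zero]
  have i1 : IntegrableOn (fun y => f (X₀ + jac ψ y)) (ball 0 1) := by
    have := hψ.integrableOn_comp_jac hF
    simpa only [mdev_of_trace_eq_zero (hdiv _)] using this
  have i2 := hφ.integrableOn_comp_jac hF
  have i3 : IntegrableOn (fun y => frob (X₀ + mdev (jac φ y)) ^ p) (ball 0 1) :=
    hφ.integrableOn_comp_jac (G := fun X => frob (X₀ + mdev X) ^ p)
      ((continuous_frob_rpow hp).comp (continuous_const.add continuous_mdev))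
  have i4 : IntegrableOn (fun _ => (1 : ℝ)) (ball (0 : EuclideanSpace ℝ (Fin n)) 1) :=
    integrableOn_const measure_ball_lt_top.ne
  have hpt : ∀ y, f (X₀ + jac ψ y) ≤ f (X₀ + mdev (jac φ y)) +
      β * (δ * (1 + frob (X₀ + mdev (jac φ y)) ^ p) +
        C * frob (jac ψ y - mdev (jac φ y)) ^ p) := by
    intro y
    set Y := X₀ + mdev (jac φ y) with hY
    set Z := jac ψ y - mdev (jac φ y) with hZ
    have hX : X₀ + jac ψ y = Y + Z := by rw [hY, hZ]; abel
    have hYt : Y.trace = 0 := by rw [hY, Matrix.trace_add, hX₀, trace_mdev hn, add_zero]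
    have hZt : Z.trace = 0 := by rw [hZ, Matrix.trace_sub, hdiv, trace_mdev hn, sub_zero]
    rw [hX]
    have h1 := (le_abs_self _).trans
      (hlip (Y + Z) Y (by rw [Matrix.trace_add, hYt, hZt, add_zero]) hYt)
    rw [add_sub_cancel_left, mul_assoc] at h1
    have h2 := H (frob Y) (frob Z) (frob_nonneg _) (frob_nonneg _)
    have h3 : (1 + frob (Y + Z) ^ (p - 1) + frob Y ^ (p - 1)) * frob Z ≤
        (1 + (frob Y + frob Z) ^ (p - 1) + frob Y ^ (p - 1)) * frob Z := by
      have := frob_nonneg Z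
      have := Real.rpow_le_rpow (frob_nonneg _) (frob_add_le Y Z) (by linarith : 0 ≤ p - 1)
      gcongr
    have := mul_le_mul_of_nonneg_left (h3.trans h2) hβ.le
    linarith
  have j1 : IntegrableOn (fun y => δ * (1 + frob (X₀ + mdev (jac φ y)) ^ p)) (ball 0 1) :=
    (i4.add i3).const_mul δ
  have j2 : IntegrableOn (fun y => C * frob (jac ψ y - mdev (jac φ y)) ^ p) (ball 0 1) :=
    h_int.integrableOn.const_mul C
  have j3 : IntegrableOn (fun y => β * (δ * (1 + frob (X₀ + mdev (jac φ y)) ^ p) +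
      C * frob (jac ψ y - mdev (jac φ y)) ^ p)) (ball 0 1) := (j1.add j2).const_mul β
  refine (setIntegral_mono i1 (i2.add j3) hpt).trans ?_
  have e1 : ∫ y in ball (0 : EuclideanSpace ℝ (Fin n)) 1, frob (jac ψ y - mdev (jac φ y)) ^ p ≤
      ∫ y, frob (jac ψ y - mdev (jac φ y)) ^ p :=
    setIntegral_le_integral h_int
      (Eventually.of_forall fun y => Real.rpow_nonneg (frob_nonneg _) _)
  have e2 : ∫ y in ball (0 : EuclideanSpace ℝ (Fin n)) 1, (f (X₀ + mdev (jac φ y)) +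
      β * (δ * (1 + frob (X₀ + mdev (jac φ y)) ^ p) + C * frob (jac ψ y - mdev (jac φ y)) ^ p)) =
      (∫ y in ball (0 : EuclideanSpace ℝ (Fin n)) 1, f (X₀ + mdev (jac φ y))) +
        β * (δ * ((volume (ball (0 : EuclideanSpace ℝ (Fin n)) 1)).toReal +
          ∫ y in ball (0 : EuclideanSpace ℝ (Fin n)) 1, frob (X₀ + mdev (jac φ y)) ^ p) +
          C * ∫ y in ball (0 : EuclideanSpace ℝ (Fin n)) 1,
            frob (jac ψ y - mdev (jac φ y)) ^ p) := by
    rw [integral_add i2 j3, integral_const_mul, integral_add j1 j2,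
      integral_const_mul, integral_const_mul, integral_add i4 i3, setIntegral_const]
    simp [Measure.real]
  refine e2.le.trans ?_
  gcongr

/-- A priori bounds for fields of bounded penalized energy. -/
lemma energy_bounds (hn : n ≠ 0) (hp : 1 < p)
    (hfc : ContinuousOn f { X : Matrix (Fin n) (Fin n) ℝ | X.trace = 0 })
    (hlow : ∀ X : Matrix (Fin n) (Fin n) ℝ, X.trace = 0 → α * frob (mils X) ^ p - β ≤ f X)
    {b : ℝ} {X₀ : Matrix (Fin n) (Fin n) ℝ} (hX₀ : X₀.trace = 0)
    {φ : EuclideanSpace ℝ (Fin n) → EuclideanSpace ℝ (Fin n)} (hφ : IsTestField φ) :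
    α * (∫ y in ball (0 : EuclideanSpace ℝ (Fin n)) 1, frob (mils (X₀ + jac φ y)) ^ p) +
      b * (∫ y, |(jac φ y).trace| ^ p) ≤
      (∫ y in ball (0 : EuclideanSpace ℝ (Fin n)) 1,
        (f (mdev (X₀ + jac φ y)) + b * |(X₀ + jac φ y).trace| ^ p)) +
      β * (volume (ball (0 : EuclideanSpace ℝ (Fin n)) 1)).toReal := by
  have i1 : IntegrableOn (fun y => f (mdev (X₀ + jac φ y))) (ball 0 1) :=
    hφ.integrableOn_comp_jac (G := fun X => f (mdev (X₀ + X)))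
      (hfc.comp_continuous (continuous_mdev.comp (by fun_prop)) fun X => trace_mdev hn _)
  have i2 : IntegrableOn (fun y => |(X₀ + jac φ y).trace| ^ p) (ball 0 1) :=
    hφ.integrableOn_comp_jac (G := fun X => |(X₀ + X).trace| ^ p)
      ((continuous_trace_rpow hp).comp (by fun_prop))
  have i3 : IntegrableOn (fun y => frob (mils (X₀ + jac φ y)) ^ p) (ball 0 1) :=
    hφ.integrableOn_comp_jac (G := fun X => frob (mils (X₀ + X)) ^ p)
      ((continuous_frob_rpow hp).comp (continuous_mils.comp (by fun_prop)))
  have i4 : IntegrableOn (fun _ => β) (ball (0 : EuclideanSpace ℝ (Fin n)) 1) :=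
    integrableOn_const measure_ball_lt_top.ne
  have e1 : ∫ y in ball (0 : EuclideanSpace ℝ (Fin n)) 1, |(X₀ + jac φ y).trace| ^ p =
      ∫ y, |(jac φ y).trace| ^ p := by
    simp only [Matrix.trace_add, hX₀, zero_add]
    exact hφ.setIntegral_comp_jac (G := fun X => |X.trace| ^ p)
      (by simp [show p ≠ 0 by linarith])
  have h : ∫ y in ball (0 : EuclideanSpace ℝ (Fin n)) 1, (α * frob (mils (X₀ + jac φ y)) ^ p - β) ≤
      ∫ y in ball (0 : EuclideanSpace ℝ (Fin n)) 1, f (mdev (X₀ + jac φ y)) := by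
    refine setIntegral_mono ((i3.const_mul α).sub i4) i1 fun y => ?_
    have := hlow _ (trace_mdev hn (X₀ + jac φ y))
    rwa [mils_mdev hn] at this
  rw [integral_sub (i3.const_mul α) i4, integral_const_mul, setIntegral_const, smul_eq_mul,
    Measure.real] at h
  rw [integral_add i1 (i2.const_mul b), integral_const_mul, e1]
  linarith

end Relaxation

section Core

open Metric

variable {n : ℕ} {p α β : ℝ} {f : Matrix (Fin n) (Fin n) ℝ → ℝ}

/-- Finely rescaled copies of a test field fill the unit ball up to small measure. -/
lemma exists_rescaled_testField (hn : n ≠ 0) (hp : 1 < p) {κ : ℝ} (hκ : 0 < κ) :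
    ∃ ρ : ℝ, 0 < ρ ∧ ρ < 1 ∧
      ∀ φ : EuclideanSpace ℝ (Fin n) → EuclideanSpace ℝ (Fin n), IsTestField φ →
      ∀ θ : ℝ, 0 < θ → ∃ (φr : EuclideanSpace ℝ (Fin n) → EuclideanSpace ℝ (Fin n)) (τ : ℝ),
        IsTestField φr ∧ tsupport φr ⊆ closedBall 0 ρ ∧ 1 - κ ≤ τ ∧ 0 ≤ τ ∧ τ ≤ 1 ∧
        n * (∫ y, ‖φr y‖ ^ p) ≤ θ ∧
        ∀ G : Matrix (Fin n) (Fin n) ℝ → ℝ, Continuous G → G 0 = 0 →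
          ∫ y, G (jac φr y) = τ * ∫ y, G (jac φ y) := by
  have hn0 : (0 : ℝ) < n := by exact_mod_cast Nat.pos_of_ne_zero hn
  have : Nonempty (Fin n) := ⟨⟨0, Nat.pos_of_ne_zero hn⟩⟩
  set s : ℝ := min (1 / 2) (κ / (2 * n)) with hs
  have hs0 : 0 < s := lt_min (by norm_num) (by positivity)
  have hs1 : s ≤ 1 / 2 := min_le_left _ _
  have hs2 : n * s ≤ κ / 2 := by
    have := min_le_right (1 / 2) (κ / (2 * n))
    rw [← hs, le_div_iff₀ (by positivity)] at this
    linarith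
  refine ⟨1 - s, by linarith, by linarith, fun φ hφ θ hθ => ?_⟩
  have hA : 0 ≤ n * ∫ y, ‖φ y‖ ^ p := by positivity
  set A : ℝ := n * ∫ y, ‖φ y‖ ^ p with hAdef
  set r : ℝ := (θ / (A + 1)) ^ (1 / p) with hr
  have hr0 : 0 < r := by positivity
  obtain ⟨t, R, h1, h2, h3, h4⟩ := exists_finset_disjoint_closedBall
    (E := EuclideanSpace ℝ (Fin n)) (ρ := 1 - s) (r := r) (ε := κ / 2) (by linarith) (by linarith)
    hr0 (by positivity)
  rw [finrank_euclideanSpace_fin] at h3 h4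
  have hR : ∀ c ∈ t, 0 < R c := fun c hc => (h1 c hc).1
  have hb : 1 - κ / 2 ≤ (1 - s) ^ n := by
    have := one_add_mul_le_pow (a := -s) (by linarith) n
    rw [← sub_eq_add_neg] at this
    linarith
  refine ⟨rescale t R φ, ∑ c ∈ t, R c ^ n, hφ.rescale hR (by linarith) fun c hc => (h1 c hc).2.2,
    hφ.support_rescale_subset hR fun c hc => (h1 c hc).2.2, by linarith,
    Finset.sum_nonneg fun c hc => pow_nonneg (hR c hc).le _, h4, ?_,
    fun G hG hG0 => hφ.integral_comp_jac_rescale hR h2 hG hG0⟩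
  have h5 := hφ.integral_norm_rescale_rpow_le hR h2 hp (fun c hc => (h1 c hc).2.1) h4 hr0.le
  have hrp : r ^ p = θ / (A + 1) := by
    rw [hr, ← Real.rpow_mul (by positivity), one_div_mul_cancel (by linarith), Real.rpow_one]
  calc _ ≤ n * (r ^ p * ∫ y, ‖φ y‖ ^ p) := by gcongr
    _ = θ * (A / (A + 1)) := by rw [hrp, hAdef]; ring
    _ ≤ θ * 1 := by
      gcongr
      exact (div_le_one (by positivity)).2 (by linarith)
    _ = θ := mul_one θ

/-- Fields of bounded penalized energy can be replaced by divergence free ones without increasing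
the energy much, once the penalization is strong enough. -/
lemma exists_div_free_energy_le (hn : n ≠ 0) (hp : 1 < p) (hα : 0 < α) (hβ : 0 < β)
    (hfc : ContinuousOn f { X : Matrix (Fin n) (Fin n) ℝ | X.trace = 0 })
    (hlow : ∀ X : Matrix (Fin n) (Fin n) ℝ, X.trace = 0 → α * frob (mils X) ^ p - β ≤ f X)
    (hlip : ∀ X Y : Matrix (Fin n) (Fin n) ℝ, X.trace = 0 → Y.trace = 0 →
      |f X - f Y| ≤ β * (1 + frob X ^ (p - 1) + frob Y ^ (p - 1)) * frob (X - Y))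
    {X₀ : Matrix (Fin n) (Fin n) ℝ} (hX₀ : X₀.trace = 0) (K : ℝ) {ε : ℝ} (hε : 0 < ε) :
    ∃ b₀ : ℝ, ∀ b, b₀ ≤ b → ∀ φ : EuclideanSpace ℝ (Fin n) → EuclideanSpace ℝ (Fin n),
      IsTestField φ →
      ∫ y in ball (0 : EuclideanSpace ℝ (Fin n)) 1,
        (f (mdev (X₀ + jac φ y)) + b * |(X₀ + jac φ y).trace| ^ p) ≤ K →
      ∃ ψ : EuclideanSpace ℝ (Fin n) → EuclideanSpace ℝ (Fin n), IsTestField ψ ∧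
        (∀ y, (jac ψ y).trace = 0) ∧
        ∫ y in ball (0 : EuclideanSpace ℝ (Fin n)) 1, f (X₀ + jac ψ y) ≤
          (∫ y in ball (0 : EuclideanSpace ℝ (Fin n)) 1,
            (f (mdev (X₀ + jac φ y)) + b * |(X₀ + jac φ y).trace| ^ p)) + ε := by
  have hp0 : p ≠ 0 := by linarith
  set V := (volume (ball (0 : EuclideanSpace ℝ (Fin n)) 1)).toReal with hV
  have hV0 : 0 < V := volume_ball_pos
  have hfr : ∀ X : Matrix (Fin n) (Fin n) ℝ, 0 ≤ frob X ^ p :=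
    fun X => Real.rpow_nonneg (frob_nonneg X) p
  obtain ⟨C₁, hC₁, korn⟩ := exists_korn_const_testField hn hp
  set L := K + β * V with hL
  set A₂ : ℝ := 2 ^ p * (|L| / α + V * frob (mils (-X₀)) ^ p) with hA₂
  have hA₂0 : 0 ≤ A₂ := by have := hfr (mils (-X₀)); positivity
  set M : ℝ := V + 2 ^ p * (V * frob X₀ ^ p + C₁ * (A₂ + 1 + 1)) with hM
  have hM0 : 0 < M := by have := hfr X₀; positivity
  set δ : ℝ := ε / (3 * β * M) with hδ
  have hδ0 : 0 < δ := by positivity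
  have hδM : β * (δ * M) = ε / 3 := by rw [hδ]; field_simp
  set κ : ℝ := ε / (3 * V * (|f X₀| + β)) with hκ
  have hκ0 : 0 < κ := by positivity
  have hκV : κ * (V * (|f X₀| + β)) = ε / 3 := by
    have : |f X₀| + β ≠ 0 := by positivity
    rw [hκ]; field_simp
  obtain ⟨ρ, hρ, hρ1, scale⟩ := exists_rescaled_testField (p := p) hn hp hκ0
  obtain ⟨C₃, hC₃, free⟩ := exists_div_free_testField hn hp hρ hρ1
  obtain ⟨C₂, hC₂, cmp⟩ := exists_setIntegral_le_add hn hp hβ hfc hlip hX₀ hδ0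
  set θ : ℝ := min 1 (ε / (6 * (β * (C₂ * C₃) + 1))) with hθ
  have hθ0 : 0 < θ := lt_min one_pos (by positivity)
  have hθ1 : θ ≤ 1 := min_le_left _ _
  have hθε : β * (C₂ * C₃) * (2 * θ) ≤ ε / 3 := by
    have h := min_le_right 1 (ε / (6 * (β * (C₂ * C₃) + 1)))
    rw [← hθ, le_div_iff₀ (by positivity)] at h
    nlinarith
  refine ⟨max 1 (|L| / θ), fun b hb φ hφ hK => ?_⟩
  have hb0 : 0 < b := lt_of_lt_of_le one_pos ((le_max_left _ _).trans hb)
  have hbθ : |L| ≤ b * θ := by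
    have := (le_max_right _ _).trans hb
    rwa [div_le_iff₀ hθ0] at this
  obtain ⟨φr, τ, hφr, hsupp, hτ1, hτ0, hτ2, hsmall, hG⟩ := scale φ hφ θ hθ0
  obtain ⟨ψ, hψ, hψdiv, hψint, hψle⟩ := free φr hφr hsupp
  refine ⟨ψ, hψ, hψdiv, ?_⟩
  -- a priori bounds
  have hE := energy_bounds (b := b) hn hp hfc hlow hX₀ hφ
  rw [← hV] at hE
  have hD0 : 0 ≤ ∫ y, |(jac φ y).trace| ^ p := by positivity
  have hm0 : 0 ≤ ∫ y in ball (0 : EuclideanSpace ℝ (Fin n)) 1, frob (mils (X₀ + jac φ y)) ^ p :=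
    integral_nonneg fun y => hfr _
  have hLle : L ≤ |L| := le_abs_self L
  have hD : ∫ y, |(jac φ y).trace| ^ p ≤ θ := by
    have h1 : b * (∫ y, |(jac φ y).trace| ^ p) ≤ b * θ := by
      have := mul_nonneg hα.le hm0
      linarith
    exact le_of_mul_le_mul_left h1 hb0
  have hm : ∫ y in ball (0 : EuclideanSpace ℝ (Fin n)) 1, frob (mils (X₀ + jac φ y)) ^ p ≤
      |L| / α := by
    rw [le_div_iff₀ hα, mul_comm]
    have := mul_nonneg hb0.le hD0
    linarith
  have hmils : ∫ y, frob (mils (jac φ y)) ^ p ≤ A₂ := by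
    have hg : Continuous fun X : Matrix (Fin n) (Fin n) ℝ => frob (mils X) ^ p :=
      (continuous_frob_rpow hp).comp continuous_mils
    have i1 : IntegrableOn (fun y => frob (mils (X₀ + jac φ y)) ^ p) (ball 0 1) :=
      hφ.integrableOn_comp_jac (hg.comp (continuous_const.add continuous_id))
    have i2 : IntegrableOn (fun _ => frob (mils (-X₀)) ^ p)
        (ball (0 : EuclideanSpace ℝ (Fin n)) 1) := integrableOn_const measure_ball_lt_top.ne
    rw [← hφ.setIntegral_comp_jac (G := fun X => frob (mils X) ^ p)
      (by simp [mils_zero, frob_zero, hp0])]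
    refine (setIntegral_mono (hφ.integrableOn_comp_jac hg) ((i1.add i2).const_mul (2 ^ p))
      fun y => ?_).trans ?_
    · have := frob_add_rpow_le hp.le (mils (X₀ + jac φ y)) (mils (-X₀))
      rwa [← mils_add, add_neg_cancel_comm] at this
    · simp only [Pi.add_apply]
      rw [integral_const_mul, integral_add i1 i2, setIntegral_const, smul_eq_mul, Measure.real,
        ← hV, hA₂]
      gcongr
  -- bounds for the rescaled field
  have hDr : ∫ y, |(jac φr y).trace| ^ p ≤ θ := by
    rw [hG (fun X => |X.trace| ^ p) (continuous_trace_rpow hp) (by simp [hp0])]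
    exact (mul_le_of_le_one_left hD0 hτ2).trans hD
  have hmr : ∫ y, frob (mils (jac φr y)) ^ p ≤ A₂ := by
    rw [hG (fun X => frob (mils X) ^ p) ((continuous_frob_rpow hp).comp continuous_mils)
      (by simp [mils_zero, frob_zero, hp0])]
    exact (mul_le_of_le_one_left (integral_nonneg fun y => hfr _) hτ2).trans hmils
  have hkr : ∫ y, frob (mdev (jac φr y)) ^ p ≤ C₁ * (A₂ + 1 + 1) := by
    refine (korn φr hφr).trans (mul_le_mul_of_nonneg_left ?_ hC₁)
    linarith
  have hMr : V + ∫ y in ball (0 : EuclideanSpace ℝ (Fin n)) 1,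
      frob (X₀ + mdev (jac φr y)) ^ p ≤ M := by
    have hg : Continuous fun X : Matrix (Fin n) (Fin n) ℝ => frob (mdev X) ^ p :=
      (continuous_frob_rpow hp).comp continuous_mdev
    have i0 : IntegrableOn (fun y => frob (X₀ + mdev (jac φr y)) ^ p) (ball 0 1) :=
      hφr.integrableOn_comp_jac (G := fun X => frob (X₀ + mdev X) ^ p)
        ((continuous_frob_rpow hp).comp (continuous_const.add continuous_mdev))
    have i1 : IntegrableOn (fun y => frob (mdev (jac φr y)) ^ p) (ball 0 1) :=
      hφr.integrableOn_comp_jac hg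
    have i2 : IntegrableOn (fun _ => frob X₀ ^ p)
        (ball (0 : EuclideanSpace ℝ (Fin n)) 1) := integrableOn_const measure_ball_lt_top.ne
    rw [hM]
    refine add_le_add le_rfl ((setIntegral_mono i0 ((i2.add i1).const_mul (2 ^ p))
      fun y => frob_add_rpow_le hp.le _ _).trans ?_)
    simp only [Pi.add_apply]
    rw [integral_const_mul, integral_add i2 i1, setIntegral_const, smul_eq_mul, Measure.real,
      ← hV, hφr.setIntegral_comp_jac (G := fun X => frob (mdev X) ^ p)
        (by simp [mdev_zero, frob_zero, hp0])]
    gcongr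
  -- the energy of the rescaled field
  have hF : Continuous fun X : Matrix (Fin n) (Fin n) ℝ => f (X₀ + mdev X) :=
    hfc.comp_continuous (continuous_const.add continuous_mdev) fun X => by
      change (X₀ + mdev X).trace = 0
      rw [Matrix.trace_add, hX₀, trace_mdev hn, add_zero]
  have e1 := hφr.setIntegral_comp_jac_eq_add hF
  have e2 := hφ.setIntegral_comp_jac_eq_add hF
  rw [hG (fun X => f (X₀ + mdev X) - f (X₀ + mdev 0)) (hF.sub continuous_const) (sub_self _)] at e1
  simp only [mdev_zero, add_zero, ← hV] at e1 e2
  have hYφ : ∫ y in ball (0 : EuclideanSpace ℝ (Fin n)) 1, f (X₀ + mdev (jac φ y)) ≤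
      ∫ y in ball (0 : EuclideanSpace ℝ (Fin n)) 1,
        (f (mdev (X₀ + jac φ y)) + b * |(X₀ + jac φ y).trace| ^ p) := by
    have i2 : IntegrableOn (fun y => f (mdev (X₀ + jac φ y)) + b * |(X₀ + jac φ y).trace| ^ p)
        (ball 0 1) :=
      hφ.integrableOn_comp_jac (G := fun X => f (mdev (X₀ + X)) + b * |(X₀ + X).trace| ^ p)
        ((hfc.comp_continuous (continuous_mdev.comp (continuous_const.add continuous_id))
          fun X => trace_mdev hn _).add (((continuous_trace_rpow hp).comp
            (continuous_const.add continuous_id)).const_mul b))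
    refine setIntegral_mono (hφ.integrableOn_comp_jac hF) i2 fun y => ?_
    have : 0 ≤ b * |(X₀ + jac φ y).trace| ^ p := by positivity
    change f (X₀ + mdev (jac φ y)) ≤ _
    rw [mdev_add, mdev_of_trace_eq_zero hX₀]
    linarith
  have hYlow : -(β * V) ≤ ∫ y in ball (0 : EuclideanSpace ℝ (Fin n)) 1, f (X₀ + mdev (jac φ y)) := by
    have i2 : IntegrableOn (fun _ => -β)
        (ball (0 : EuclideanSpace ℝ (Fin n)) 1) := integrableOn_const measure_ball_lt_top.ne
    have := setIntegral_mono i2 (hφ.integrableOn_comp_jac hF) fun y => by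
      have h1 := hlow (X₀ + mdev (jac φ y))
        (by rw [Matrix.trace_add, hX₀, trace_mdev hn, add_zero])
      have h2 := mul_nonneg hα.le (hfr (mils (X₀ + mdev (jac φ y))))
      change -β ≤ f (X₀ + mdev (jac φ y))
      linarith
    rw [setIntegral_const, smul_eq_mul, Measure.real, ← hV] at this
    linarith
  have hYr : ∫ y in ball (0 : EuclideanSpace ℝ (Fin n)) 1, f (X₀ + mdev (jac φr y)) ≤
      (∫ y in ball (0 : EuclideanSpace ℝ (Fin n)) 1, f (X₀ + mdev (jac φ y))) + ε / 3 := by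
    set S := ∫ y in ball (0 : EuclideanSpace ℝ (Fin n)) 1, f (X₀ + mdev (jac φ y)) with hS
    have h1 : ∫ y in ball (0 : EuclideanSpace ℝ (Fin n)) 1, f (X₀ + mdev (jac φr y)) =
        S + (1 - τ) * (V * f X₀ - S) := by
      rw [e1]
      linear_combination -τ * e2
    have h2 : V * f X₀ - S ≤ V * (|f X₀| + β) := by
      have := mul_le_mul_of_nonneg_left (le_abs_self (f X₀)) hV0.le
      linarith
    have h3 : 0 ≤ V * (|f X₀| + β) := by positivity
    have h4 : (1 - τ) * (V * f X₀ - S) ≤ (1 - τ) * (V * (|f X₀| + β)) :=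
      mul_le_mul_of_nonneg_left h2 (by linarith)
    have h5 : (1 - τ) * (V * (|f X₀| + β)) ≤ κ * (V * (|f X₀| + β)) :=
      mul_le_mul_of_nonneg_right (by linarith) h3
    linarith
  have hfin := cmp φr ψ hφr hψ hψdiv hψint
  rw [← hV] at hfin
  have g1 : β * (δ * (V + ∫ y in ball (0 : EuclideanSpace ℝ (Fin n)) 1,
      frob (X₀ + mdev (jac φr y)) ^ p)) ≤ ε / 3 := by
    rw [← hδM]
    gcongr
  have g2 : β * (C₂ * ∫ y, frob (jac ψ y - mdev (jac φr y)) ^ p) ≤ ε / 3 := by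
    calc _ ≤ β * (C₂ * (C₃ * (2 * θ))) := by
          gcongr
          exact hψle.trans (mul_le_mul_of_nonneg_left (by linarith) hC₃)
      _ = β * (C₂ * C₃) * (2 * θ) := by ring
      _ ≤ _ := hθε
  rw [mul_add] at hfin
  linarith

end Core

section Envelope

open Metric

variable {n : ℕ} {p α β : ℝ} {f : Matrix (Fin n) (Fin n) ℝ → ℝ}

lemma isTestField_zero :
    IsTestField (fun _ => 0 : EuclideanSpace ℝ (Fin n) → EuclideanSpace ℝ (Fin n)) where
  contDiff := contDiff_const
  hasCompactSupport := HasCompactSupport.zero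
  tsupport_subset := by
    have : tsupport (fun _ => 0 : EuclideanSpace ℝ (Fin n) → EuclideanSpace ℝ (Fin n)) = ∅ :=
      tsupport_eq_empty_iff.2 rfl
    rw [this]
    exact Set.empty_subset _

lemma jac_zero (y : EuclideanSpace ℝ (Fin n)) :
    jac (fun _ => 0 : EuclideanSpace ℝ (Fin n) → EuclideanSpace ℝ (Fin n)) y = 0 := by
  ext i j
  simp [jac]

/-- The tangent line inequality for `|·| ^ p`. -/
lemma abs_rpow_mul_le_abs_add_rpow (hp : 1 < p) {s : ℝ} (hs : s ≠ 0) (d : ℝ) :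
    |s| ^ p * (1 + p * (d / s)) ≤ |s + d| ^ p := by
  have hs' : 0 < |s| := abs_pos.2 hs
  have h1 : d / s ≤ |s + d| / |s| - 1 := by
    rw [← abs_div, add_div, div_self hs]
    have := le_abs_self (1 + d / s)
    linarith
  have h2 := one_add_mul_self_le_rpow_one_add (s := |s + d| / |s| - 1) (p := p)
    (by have : 0 ≤ |s + d| / |s| := by positivity
        linarith) hp.le
  rw [add_sub_cancel, Real.div_rpow (abs_nonneg _) (abs_nonneg _)] at h2
  calc _ ≤ |s| ^ p * (1 + p * (|s + d| / |s| - 1)) := by gcongr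
    _ ≤ |s| ^ p * (|s + d| ^ p / |s| ^ p) := by gcongr
    _ = _ := by field_simp

lemma le_average_penalized (hn : n ≠ 0) (hp : 1 < p)
    (hfc : ContinuousOn f { X : Matrix (Fin n) (Fin n) ℝ | X.trace = 0 })
    (hlow : ∀ X : Matrix (Fin n) (Fin n) ℝ, X.trace = 0 → -β ≤ f X)
    {b : ℝ} (hb : 0 ≤ b) (X₀ : Matrix (Fin n) (Fin n) ℝ)
    {φ : EuclideanSpace ℝ (Fin n) → EuclideanSpace ℝ (Fin n)} (hφ : IsTestField φ) :
    -β + b * |X₀.trace| ^ p ≤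
      (volume (ball (0 : EuclideanSpace ℝ (Fin n)) 1)).toReal⁻¹ *
        ∫ y in ball (0 : EuclideanSpace ℝ (Fin n)) 1,
          (f (mdev (X₀ + jac φ y)) + b * |(X₀ + jac φ y).trace| ^ p) := by
  set s := X₀.trace with hs
  have i1 : IntegrableOn (fun y => f (mdev (X₀ + jac φ y)) + b * |(X₀ + jac φ y).trace| ^ p)
      (ball 0 1) :=
    hφ.integrableOn_comp_jac (G := fun X => f (mdev (X₀ + X)) + b * |(X₀ + X).trace| ^ p)
      ((hfc.comp_continuous (continuous_mdev.comp (continuous_const.add continuous_id))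
        fun X => trace_mdev hn _).add (((continuous_trace_rpow hp).comp
          (continuous_const.add continuous_id)).const_mul b))
  have i2 : IntegrableOn (fun _ => -β + b * |s| ^ p)
      (ball (0 : EuclideanSpace ℝ (Fin n)) 1) := integrableOn_const measure_ball_lt_top.ne
  have htr : Continuous fun X : Matrix (Fin n) (Fin n) ℝ => X.trace := by fun_prop
  have i3 : IntegrableOn (fun y => b * |s| ^ p * (p / s) * (jac φ y).trace) (ball 0 1) :=
    (hφ.integrableOn_comp_jac htr).const_mul _
  rw [← div_eq_inv_mul, le_div_iff₀ volume_ball_pos]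
  calc _ = ∫ y in ball (0 : EuclideanSpace ℝ (Fin n)) 1,
        ((-β + b * |s| ^ p) + b * |s| ^ p * (p / s) * (jac φ y).trace) := by
        rw [integral_add i2 i3, integral_const_mul,
          hφ.setIntegral_comp_jac (G := fun X => X.trace) (by simp), hφ.integral_trace_jac,
          setIntegral_const, smul_eq_mul, Measure.real]
        ring
    _ ≤ _ := setIntegral_mono (i2.add i3) i1 fun y => by
        have h1 := hlow _ (trace_mdev hn (X₀ + jac φ y))
        have h2 : |s| ^ p * (1 + p / s * (jac φ y).trace) ≤ |(X₀ + jac φ y).trace| ^ p := by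
          rw [Matrix.trace_add, ← hs]
          rcases eq_or_ne s 0 with h0 | h0
          · simp only [h0, abs_zero, Real.zero_rpow (by linarith : p ≠ 0), zero_mul]
            positivity
          · have := abs_rpow_mul_le_abs_add_rpow hp h0 (jac φ y).trace
            rwa [mul_div_assoc', ← div_mul_eq_mul_div] at this
        have h3 := mul_le_mul_of_nonneg_left h2 hb
        linarith

end Envelope

/-- Penalization of the trace recovers the incompressible quasiconvex envelope:
`sup_j (f_j)^{qc}(X₀) = f^{iqc}(X₀)` for trace-free `X₀`, and the supremum is `+∞`
(unbounded) when `tr X₀ ≠ 0`. Here `f_j(X) = f(X_dev) + b_j |tr X|^p` and the envelopes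
are expressed by Dacorogna's formula on the unit ball `B`. -/
theorem stmt14 (n : ℕ) (hn : 2 ≤ n) (p α β : ℝ) (hp1 : 1 < p) (hα : 0 < α) (hβ : 0 < β)
    (f : Matrix (Fin n) (Fin n) ℝ → ℝ)
    (hfc : ContinuousOn f { X : Matrix (Fin n) (Fin n) ℝ | X.trace = 0 })
    (hgrowth : ∀ X : Matrix (Fin n) (Fin n) ℝ, X.trace = 0 →
      α * frob (mils X) ^ p - β ≤ f X ∧ f X ≤ β * (frob X ^ p + 1))
    (hlip : ∀ X Y : Matrix (Fin n) (Fin n) ℝ, X.trace = 0 → Y.trace = 0 →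
      |f X - f Y| ≤ β * (1 + frob X ^ (p - 1) + frob Y ^ (p - 1)) * frob (X - Y))
    (b : ℕ → ℝ) (hb : ∀ j, 0 < b j) (hbmono : Monotone b)
    (hbtop : Filter.Tendsto b Filter.atTop Filter.atTop)
    (X₀ : Matrix (Fin n) (Fin n) ℝ) :
    (X₀.trace = 0 →
      (⨆ j : ℕ, sInf { v : ℝ |
          ∃ φ : EuclideanSpace ℝ (Fin n) → EuclideanSpace ℝ (Fin n),
          ContDiff ℝ (⊤ : ℕ∞) φ ∧ HasCompactSupport φ ∧
          tsupport φ ⊆ Metric.ball (0 : EuclideanSpace ℝ (Fin n)) 1 ∧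
          v = (volume (Metric.ball (0 : EuclideanSpace ℝ (Fin n)) 1)).toReal⁻¹ *
              ∫ y in Metric.ball (0 : EuclideanSpace ℝ (Fin n)) 1,
                (f (mdev (X₀ + jac φ y)) + b j * |(X₀ + jac φ y).trace| ^ p) }) =
      sInf { v : ℝ |
          ∃ φ : EuclideanSpace ℝ (Fin n) → EuclideanSpace ℝ (Fin n),
          ContDiff ℝ (⊤ : ℕ∞) φ ∧ HasCompactSupport φ ∧
          tsupport φ ⊆ Metric.ball (0 : EuclideanSpace ℝ (Fin n)) 1 ∧
          (∀ y, (jac φ y).trace = 0) ∧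
          v = (volume (Metric.ball (0 : EuclideanSpace ℝ (Fin n)) 1)).toReal⁻¹ *
              ∫ y in Metric.ball (0 : EuclideanSpace ℝ (Fin n)) 1, f (X₀ + jac φ y) }) ∧
    (X₀.trace ≠ 0 →
      ¬ BddAbove (Set.range fun j : ℕ => sInf { v : ℝ |
          ∃ φ : EuclideanSpace ℝ (Fin n) → EuclideanSpace ℝ (Fin n),
          ContDiff ℝ (⊤ : ℕ∞) φ ∧ HasCompactSupport φ ∧
          tsupport φ ⊆ Metric.ball (0 : EuclideanSpace ℝ (Fin n)) 1 ∧
          v = (volume (Metric.ball (0 : EuclideanSpace ℝ (Fin n)) 1)).toReal⁻¹ *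
              ∫ y in Metric.ball (0 : EuclideanSpace ℝ (Fin n)) 1,
                (f (mdev (X₀ + jac φ y)) + b j * |(X₀ + jac φ y).trace| ^ p) })) := by
  have hn0 : n ≠ 0 := by omega
  have hlow : ∀ X : Matrix (Fin n) (Fin n) ℝ, X.trace = 0 → α * frob (mils X) ^ p - β ≤ f X :=
    fun X hX => (hgrowth X hX).1
  have hlow' : ∀ X : Matrix (Fin n) (Fin n) ℝ, X.trace = 0 → -β ≤ f X := fun X hX => by
    have h1 := hlow X hX
    have h2 := mul_nonneg hα.le (Real.rpow_nonneg (frob_nonneg (mils X)) p)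
    linarith
  have hz := isTestField_zero (n := n)
  set S : ℕ → Set ℝ := fun j => { v : ℝ |
    ∃ φ : EuclideanSpace ℝ (Fin n) → EuclideanSpace ℝ (Fin n),
    ContDiff ℝ (⊤ : ℕ∞) φ ∧ HasCompactSupport φ ∧
    tsupport φ ⊆ Metric.ball (0 : EuclideanSpace ℝ (Fin n)) 1 ∧
    v = (volume (Metric.ball (0 : EuclideanSpace ℝ (Fin n)) 1)).toReal⁻¹ *
        ∫ y in Metric.ball (0 : EuclideanSpace ℝ (Fin n)) 1,
          (f (mdev (X₀ + jac φ y)) + b j * |(X₀ + jac φ y).trace| ^ p) } with hS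
  set T : Set ℝ := { v : ℝ |
    ∃ φ : EuclideanSpace ℝ (Fin n) → EuclideanSpace ℝ (Fin n),
    ContDiff ℝ (⊤ : ℕ∞) φ ∧ HasCompactSupport φ ∧
    tsupport φ ⊆ Metric.ball (0 : EuclideanSpace ℝ (Fin n)) 1 ∧
    (∀ y, (jac φ y).trace = 0) ∧
    v = (volume (Metric.ball (0 : EuclideanSpace ℝ (Fin n)) 1)).toReal⁻¹ *
        ∫ y in Metric.ball (0 : EuclideanSpace ℝ (Fin n)) 1, f (X₀ + jac φ y) } with hT
  have hSlow : ∀ j, ∀ v ∈ S j, -β + b j * |X₀.trace| ^ p ≤ v := by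
    rintro j v ⟨φ, h1, h2, h3, rfl⟩
    exact le_average_penalized hn0 hp1 hfc hlow' (hb j).le X₀ ⟨h1, h2, h3⟩
  have hSne : ∀ j, (S j).Nonempty := fun j =>
    ⟨_, _, hz.contDiff, hz.hasCompactSupport, hz.tsupport_subset, rfl⟩
  change (X₀.trace = 0 → (⨆ j, sInf (S j)) = sInf T) ∧
    (X₀.trace ≠ 0 → ¬ BddAbove (Set.range fun j => sInf (S j)))
  refine ⟨fun hX₀ => ?_, fun hX₀ => ?_⟩
  · have hTne : T.Nonempty :=
      ⟨_, _, hz.contDiff, hz.hasCompactSupport, hz.tsupport_subset,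
        fun y => by rw [jac_zero, Matrix.trace_zero], rfl⟩
    have hTS : ∀ j, T ⊆ S j := by
      rintro j v ⟨φ, h1, h2, h3, h4, rfl⟩
      refine ⟨φ, h1, h2, h3, ?_⟩
      have h5 : ∀ y, (X₀ + jac φ y).trace = 0 := fun y => by
        rw [Matrix.trace_add, hX₀, h4, add_zero]
      simp only [h5, mdev_of_trace_eq_zero (h5 _), abs_zero,
        Real.zero_rpow (by linarith : p ≠ 0), mul_zero, add_zero]
    have hSbdd : ∀ j, BddBelow (S j) := fun j => ⟨_, hSlow j⟩
    have hle : ∀ j, sInf (S j) ≤ sInf T := fun j => csInf_le_csInf (hSbdd j) hTne (hTS j)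
    refine le_antisymm (ciSup_le hle) (le_of_forall_pos_le_add fun ε hε => ?_)
    have hV : 0 < (volume (Metric.ball (0 : EuclideanSpace ℝ (Fin n)) 1)).toReal := volume_ball_pos
    set V := (volume (Metric.ball (0 : EuclideanSpace ℝ (Fin n)) 1)).toReal
    obtain ⟨b₀, hb₀⟩ := exists_div_free_energy_le hn0 hp1 hα hβ hfc hlow hlip hX₀ (V * sInf T)
      (mul_pos hV hε)
    obtain ⟨j, hj⟩ := (hbtop.eventually_ge_atTop b₀).exists
    have hsup : sInf (S j) ≤ ⨆ j, sInf (S j) :=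
      le_ciSup (f := fun j => sInf (S j)) ⟨sInf T, Set.forall_mem_range.2 hle⟩ j
    have hmain : sInf T - ε ≤ sInf (S j) := by
      refine le_csInf (hSne j) ?_
      rintro v ⟨φ, h1, h2, h3, rfl⟩
      rw [← div_eq_inv_mul, le_div_iff₀ hV]
      by_cases hK : ∫ y in Metric.ball (0 : EuclideanSpace ℝ (Fin n)) 1,
        (f (mdev (X₀ + jac φ y)) + b j * |(X₀ + jac φ y).trace| ^ p) ≤ V * sInf T
      · obtain ⟨ψ, hψ, hdiv, hψle⟩ := hb₀ (b j) hj φ ⟨h1, h2, h3⟩ hK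
        have hmem : sInf T ≤ V⁻¹ *
            ∫ y in Metric.ball (0 : EuclideanSpace ℝ (Fin n)) 1, f (X₀ + jac ψ y) :=
          csInf_le ((hSbdd j).mono (hTS j))
            ⟨ψ, hψ.contDiff, hψ.hasCompactSupport, hψ.tsupport_subset, hdiv, rfl⟩
        rw [← div_eq_inv_mul, le_div_iff₀ hV] at hmem
        linarith
      · have := mul_pos hV hε
        linarith
    linarith
  · rintro ⟨M, hM⟩
    have hs : 0 < |X₀.trace| ^ p := Real.rpow_pos_of_pos (abs_pos.2 hX₀) p
    obtain ⟨j, hj⟩ := (hbtop.eventually_gt_atTop ((M + β) / |X₀.trace| ^ p)).exists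
    rw [div_lt_iff₀ hs] at hj
    have h1 : sInf (S j) ≤ M := hM ⟨j, rfl⟩
    have h2 := le_csInf (hSne j) (hSlow j)
    linarith
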